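/- There exist constants C, c > 0 depending only on Ω such that for all ε ∈ (0, 1]: sup_{θ⋆ ∈ D} P( sup_{λ ∈ [λ_min, λ_max]} ( (1/N)‖θ̂_λ − θ⋆‖² − R⋆(λ) )² ≥ ε ) ≤ (C/ε²) N^q e^{−cNε²}, where R⋆(λ) = δ(τ⋆(λ)² − σ²). -/

import Mathlib

open MeasureTheory ProbabilityTheory
open scoped ENNReal NNReal

noncomputable section

/-- Standard Gaussian density φ. -/
def gphi (x : ℝ) : ℝ := Real.exp (-x ^ 2 / 2) / Real.sqrt (2 * Real.pi)

/-- Standard Gaussian CDF Φ. -/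
def gPhi (x : ℝ) : ℝ := ∫ t in Set.Iic x, gphi t

/-- Soft thresholding η(x; b) = sign(x)(|x| − b)₊. -/
def eta (x b : ℝ) : ℝ := Real.sign x * max (|x| - b) 0

/-- Derivative in x of soft thresholding: η′(x; b) = 1_{|x| > b}. -/
def eta' (x b : ℝ) : ℝ := if b < |x| then 1 else 0

/-- The ℓ_p ball F_p(ξ) = {x : (1/N) ∑ |xᵢ|^p ≤ ξ^p}. -/
def Fball (N : ℕ) (p ξ : ℝ) : Set (Fin N → ℝ) :=
  {x | (1 / (N : ℝ)) * ∑ i, |x i| ^ p ≤ ξ ^ p}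

/-- Number of nonzero entries ‖x‖₀. -/
def l0 {N : ℕ} (x : Fin N → ℝ) : ℕ := (Finset.univ.filter fun i => x i ≠ 0).card

/-- The ℓ₀ ball F_0(s) = {x : ‖x‖₀ ≤ sN}. -/
def F0ball (N : ℕ) (s : ℝ) : Set (Fin N → ℝ) := {x | (l0 x : ℝ) ≤ s * N}

/-- The critical sparsity s_max(δ). -/
def smax (δ : ℝ) : ℝ :=
  δ * sSup ((fun α : ℝ =>
      (1 - (2 / δ) * ((1 + α ^ 2) * gPhi (-α) - α * gphi α)) /
      (1 + α ^ 2 - 2 * ((1 + α ^ 2) * gPhi (-α) - α * gphi α))) '' Set.Ici 0)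

/-- Empirical distribution of the entries of a vector. -/
def empDist {N : ℕ} (θ : Fin N → ℝ) : Measure ℝ :=
  ((N : ℝ≥0∞))⁻¹ • ∑ i : Fin N, Measure.dirac (θ i)

/-- Empirical distribution of pairs of entries of two vectors. -/
def empDist2 {N : ℕ} (u v : Fin N → ℝ) : Measure (ℝ × ℝ) :=
  ((N : ℝ≥0∞))⁻¹ • ∑ i : Fin N, Measure.dirac (u i, v i)

/-- Squared order-2 Wasserstein distance between measures on ℝ². -/
def W2sq (μ ν : Measure (ℝ × ℝ)) : ℝ :=
  sInf {r : ℝ | ∃ γ : Measure ((ℝ × ℝ) × (ℝ × ℝ)),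
    γ.map Prod.fst = μ ∧ γ.map Prod.snd = ν ∧
    r = ∫ q, ((q.1.1 - q.2.1) ^ 2 + (q.1.2 - q.2.2) ^ 2) ∂γ}

/-- Order-2 Wasserstein distance. -/
def W2 (μ ν : Measure (ℝ × ℝ)) : ℝ := Real.sqrt (W2sq μ ν)

/-- Standard Gaussian measure on ℝ. -/
def stdG : Measure ℝ := gaussianReal 0 1

/-- The state-evolution fixed point equations (for (Θ,Z) ∼ μ ⊗ N(0,1)),
together with positivity of (β, τ). -/
def StateEvo (δ σ : ℝ) (μ : Measure ℝ) (lam β τ : ℝ) : Prop :=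
  0 < β ∧ 0 < τ ∧
  τ ^ 2 = σ ^ 2 + (1 / δ) *
    ∫ q : ℝ × ℝ, (eta (q.1 + τ * q.2) (τ * lam / β) - q.1) ^ 2 ∂(μ.prod stdG) ∧
  β = τ * (1 - (1 / δ) *
    ∫ q : ℝ × ℝ, eta' (q.1 + τ * q.2) (τ * lam / β) ∂(μ.prod stdG))

/-- s⋆ = P(|Θ + τZ| ≥ ατ) for (Θ,Z) ∼ μ ⊗ N(0,1). -/
def sStar (μ : Measure ℝ) (τ α : ℝ) : ℝ :=
  ((μ.prod stdG) {q : ℝ × ℝ | α * τ ≤ |q.1 + τ * q.2|}).toReal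

/-- The limit law μ⋆: law of (η(Θ + τZ; ατ), Θ) for (Θ,Z) ∼ μ ⊗ N(0,1). -/
def muStar (μ : Measure ℝ) (τ α : ℝ) : Measure (ℝ × ℝ) :=
  (μ.prod stdG).map (fun q => (eta (q.1 + τ * q.2) (α * τ), q.1))

/-- The limit law for the debiased Lasso: law of (Θ + τZ, Θ). -/
def muStarD (μ : Measure ℝ) (τ : ℝ) : Measure (ℝ × ℝ) :=
  (μ.prod stdG).map (fun q => (q.1 + τ * q.2, q.1))

/-- Law of the design matrix: i.i.d. N(0, 1/n) entries. -/
def PX (n N : ℕ) : Measure (Fin n → Fin N → ℝ) :=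
  Measure.pi fun _ => Measure.pi fun _ => gaussianReal 0 ((n : ℝ≥0))⁻¹

/-- Law of the noise: i.i.d. standard Gaussian entries. -/
def Pz (n : ℕ) : Measure (Fin n → ℝ) :=
  Measure.pi fun _ => gaussianReal 0 1

/-- Joint law of (X, z). -/
def Pmodel (n N : ℕ) : Measure ((Fin n → Fin N → ℝ) × (Fin n → ℝ)) :=
  (PX n N).prod (Pz n)

/-- The response y = Xθ⋆ + σz. -/
def yvec {n N : ℕ} (σ : ℝ) (θstar : Fin N → ℝ) (X : Fin n → Fin N → ℝ)
    (z : Fin n → ℝ) : Fin n → ℝ :=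
  fun i => (∑ j, X i j * θstar j) + σ * z i

/-- The Lasso cost (1/(2n))‖y − Xθ‖² + (λ/n)‖θ‖₁. -/
def lassoCost {n N : ℕ} (X : Fin n → Fin N → ℝ) (y : Fin n → ℝ) (lam : ℝ)
    (θ : Fin N → ℝ) : ℝ :=
  (1 / (2 * (n : ℝ))) * ∑ i, (y i - ∑ j, X i j * θ j) ^ 2
    + (lam / (n : ℝ)) * ∑ j, |θ j|

/-- The uniformity class: D is either an ℓ_p ball F_p(ξ) or an ℓ₀ ball F_0(s) with
s below the critical sparsity, with the corresponding exponent q. -/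
def DFamSpec (δ : ℝ) (Dfam : (M : ℕ) → Set (Fin M → ℝ)) (q : ℝ) : Prop :=
  (∃ p ξ : ℝ, 0 < p ∧ 0 < ξ ∧ (∀ M, Dfam M = Fball M p ξ) ∧ q = max (1 / p - 1) 0) ∨
  (∃ s : ℝ, 0 ≤ s ∧ s < smax δ ∧ (∀ M, Dfam M = F0ball M s) ∧ q = 0)

lemma hasDerivAt_gaussianPDFReal_std (x : ℝ) :
    HasDerivAt (gaussianPDFReal 0 1) (-x * gaussianPDFReal 0 1 x) x := by
  have h : gaussianPDFReal 0 1 = fun x : ℝ =>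
      (Real.sqrt (2 * Real.pi))⁻¹ * Real.exp (-x ^ 2 / 2) := by
    ext y; simp [gaussianPDFReal]
  rw [h]
  have h1 : HasDerivAt (fun x : ℝ => -x ^ 2 / 2) (-x) x := by
    refine (((hasDerivAt_pow 2 x).fun_neg).div_const 2).congr_deriv ?_
    simp; ring
  refine ((h1.exp).const_mul ((Real.sqrt (2 * Real.pi))⁻¹)).congr_deriv ?_
  ring

lemma integrable_std_iff {f : ℝ → ℝ} :
    Integrable f (gaussianReal 0 1) ↔
      Integrable (fun x => gaussianPDFReal 0 1 x * f x) volume := by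
  rw [gaussianReal_of_var_ne_zero 0 one_ne_zero,
    integrable_withDensity_iff_integrable_smul' (measurable_gaussianPDF _ _)
      (ae_of_all _ fun _ => gaussianPDF_lt_top)]
  simp [toReal_gaussianPDF]

lemma integral_std (f : ℝ → ℝ) :
    ∫ x, f x ∂(gaussianReal 0 1) = ∫ x, gaussianPDFReal 0 1 x * f x := by
  simpa using integral_gaussianReal_eq_integral_smul (μ := 0) (v := 1) (f := f) one_ne_zero

lemma integrable_id_std : Integrable (fun x : ℝ => x) (gaussianReal 0 1) := by
  have := (memLp_id_gaussianReal (μ := 0) (v := 1) 1).integrable (by simp)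
  exact this

lemma integral_mul_std_eq {F F' : ℝ → ℝ} {C : ℝ} (hF : ∀ x, HasDerivAt F (F' x) x)
    (hC : ∀ x, |F x| ≤ C) (hC' : ∀ x, |F' x| ≤ C) :
    ∫ x, x * F x ∂(gaussianReal 0 1) = ∫ x, F' x ∂(gaussianReal 0 1) := by
  have hFm : Measurable F := (continuous_iff_continuousAt.2 fun x => (hF x).continuousAt).measurable
  have hF'm : Measurable F' := by
    have : F' = deriv F := funext fun x => (hF x).deriv.symm
    rw [this]; exact measurable_deriv F
  have i1 : Integrable F (gaussianReal 0 1) :=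
    Integrable.of_bound hFm.aestronglyMeasurable C (ae_of_all _ hC)
  have i2 : Integrable F' (gaussianReal 0 1) :=
    Integrable.of_bound hF'm.aestronglyMeasurable C (ae_of_all _ hC')
  have i3 : Integrable (fun x => F x * x) (gaussianReal 0 1) :=
    integrable_id_std.bdd_mul (c := C) hFm.aestronglyMeasurable (ae_of_all _ hC)
  have key := integral_mul_deriv_eq_deriv_mul_of_integrable (u := F) (u' := F')
    (v := gaussianPDFReal 0 1) (v' := fun x => -x * gaussianPDFReal 0 1 x)
    (fun x _ => hF x) (fun x _ => hasDerivAt_gaussianPDFReal_std x)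
    (by
      refine ((integrable_std_iff.1 i3).neg).congr (ae_of_all _ fun x => ?_)
      simp; ring)
    (by
      refine (integrable_std_iff.1 i2).congr (ae_of_all _ fun x => ?_)
      simp; ring)
    (by
      refine (integrable_std_iff.1 i1).congr (ae_of_all _ fun x => ?_)
      simp; ring)
  rw [integral_std, integral_std]
  have e1 : ∀ x, F x * (-x * gaussianPDFReal 0 1 x) = -(gaussianPDFReal 0 1 x * (x * F x)) :=
    fun x => by ring
  simp_rw [e1, integral_neg, neg_inj] at key
  rw [key]
  exact integral_congr_ae (ae_of_all _ fun x => by simp; ring)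

/-- The standard Gaussian measure on `κ → ℝ`. -/
abbrev gaussPi (κ : Type*) [Fintype κ] : Measure (κ → ℝ) :=
  Measure.pi fun _ => gaussianReal 0 1

lemma measurePreserving_update {κ : Type*} [Fintype κ] [DecidableEq κ] (k : κ) :
    MeasurePreserving (fun p : ℝ × (κ → ℝ) => Function.update p.2 k p.1)
      ((gaussianReal 0 1).prod (gaussPi κ)) (gaussPi κ) := by
  have hm : Measurable (fun p : ℝ × (κ → ℝ) => Function.update p.2 k p.1) := by
    rw [measurable_pi_iff]
    intro j
    by_cases h : j = k
    · subst h; simpa using measurable_fst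
    · simp only [Function.update_of_ne h]; fun_prop
  refine ⟨hm, ?_⟩
  symm
  refine Measure.pi_eq fun s hs => ?_
  rw [Measure.map_apply hm (MeasurableSet.univ_pi hs)]
  have : (fun p : ℝ × (κ → ℝ) => Function.update p.2 k p.1) ⁻¹' Set.univ.pi s
      = s k ×ˢ Set.univ.pi (Function.update s k Set.univ) := by
    ext p
    simp only [Set.mem_preimage, Set.mem_pi, Set.mem_univ, true_imp_iff, Set.mem_prod]
    constructor
    · intro h
      refine ⟨by simpa using h k, fun j => ?_⟩
      by_cases hj : j = k
      · subst hj; simp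
      · simpa [Function.update_of_ne hj] using h j
    · rintro ⟨h1, h2⟩ j
      by_cases hj : j = k
      · subst hj; simpa using h1
      · simpa [Function.update_of_ne hj] using h2 j
  rw [this, Measure.prod_prod, Measure.pi_pi, ← Finset.mul_prod_erase _ _ (Finset.mem_univ k),
    ← Finset.mul_prod_erase Finset.univ (fun i => (gaussianReal 0 1) (s i)) (Finset.mem_univ k)]
  simp only [Function.update_self, measure_univ, one_mul]
  congr 1
  refine Finset.prod_congr rfl fun j hj => ?_
  rw [Function.update_of_ne (Finset.ne_of_mem_erase hj)]

lemma integrable_eval_gaussPi {κ : Type*} [Fintype κ] (k : κ) :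
    Integrable (fun G : κ → ℝ => G k) (gaussPi κ) :=
  (measurePreserving_eval (fun _ : κ => gaussianReal 0 1) k).integrable_comp_of_integrable
    integrable_id_std

lemma integral_eval_mul_gaussPi {κ : Type*} [Fintype κ] [DecidableEq κ] (k : κ)
    {F F' : (κ → ℝ) → ℝ} {C : ℝ}
    (hF : ∀ x t, HasDerivAt (fun t => F (Function.update x k t)) (F' (Function.update x k t)) t)
    (hFm : Measurable F) (hF'm : Measurable F')
    (hC : ∀ x, |F x| ≤ C) (hC' : ∀ x, |F' x| ≤ C) :
    ∫ G, G k * F G ∂(gaussPi κ) = ∫ G, F' G ∂(gaussPi κ) := by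
  have mp := measurePreserving_update k
  have i1 : Integrable (fun G => G k * F G) (gaussPi κ) := by
    have := (integrable_eval_gaussPi k).bdd_mul (c := C) hFm.aestronglyMeasurable (ae_of_all _ hC)
    exact this.congr (ae_of_all _ fun x => mul_comm _ _)
  have i2 : Integrable F' (gaussPi κ) :=
    Integrable.of_bound hF'm.aestronglyMeasurable C (ae_of_all _ hC')
  have j1 := mp.integrable_comp_of_integrable i1
  have j2 := mp.integrable_comp_of_integrable i2
  have e1 : ∫ G, G k * F G ∂(gaussPi κ)
      = ∫ p, ((fun G : κ → ℝ => G k * F G) ∘ fun p : ℝ × (κ → ℝ) => Function.update p.2 k p.1) p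
        ∂((gaussianReal 0 1).prod (gaussPi κ)) := by
    conv_lhs => rw [← mp.map_eq]
    rw [integral_map mp.measurable.aemeasurable (by rw [mp.map_eq]; exact i1.1)]
    rfl
  have e2 : ∫ G, F' G ∂(gaussPi κ)
      = ∫ p, (F' ∘ fun p : ℝ × (κ → ℝ) => Function.update p.2 k p.1) p
        ∂((gaussianReal 0 1).prod (gaussPi κ)) := by
    conv_lhs => rw [← mp.map_eq]
    rw [integral_map mp.measurable.aemeasurable (by rw [mp.map_eq]; exact i2.1)]
    rfl
  rw [e1, e2, integral_prod_symm _ j1, integral_prod_symm _ j2]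
  refine integral_congr_ae (ae_of_all _ fun x => ?_)
  simp only [Function.comp, Function.update_self]
  exact integral_mul_std_eq (fun t => hF x t) (fun t => hC _) (fun t => hC' _)

lemma integral_eval_mul_comp_linear {T κ : Type*} [Fintype T] [Fintype κ] [DecidableEq κ]
    {f : (T → ℝ) → ℝ} {f' : T → (T → ℝ) → ℝ}
    (hf : ∀ x, HasFDerivAt f (∑ β, f' β x • ContinuousLinearMap.proj (R := ℝ) (φ := fun _ : T => ℝ) β) x)
    (hf'c : ∀ β, Continuous (f' β)) {C : ℝ} (hC : ∀ x, |f x| ≤ C) (hC' : ∀ β x, |f' β x| ≤ C)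
    (c : T → κ → ℝ) (k : κ) :
    ∫ G, G k * f (fun α => ∑ l, c α l * G l) ∂(gaussPi κ)
      = ∑ β, c β k * ∫ G, f' β (fun α => ∑ l, c α l * G l) ∂(gaussPi κ) := by
  have hC0 : 0 ≤ C := (abs_nonneg _).trans (hC 0)
  have hfc : Continuous f := continuous_iff_continuousAt.2 fun x => (hf x).continuousAt
  have hZc : Continuous (fun G : κ → ℝ => fun α => ∑ l, c α l * G l) := by fun_prop
  have hb : ∀ x, |∑ β, c β k * f' β x| ≤ (1 + ∑ β, |c β k|) * C := by
    intro x
    refine (Finset.abs_sum_le_sum_abs _ _).trans ?_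
    rw [add_mul, Finset.sum_mul]
    have : ∑ β, |c β k * f' β x| ≤ ∑ β, |c β k| * C := by
      refine Finset.sum_le_sum fun β _ => ?_
      rw [abs_mul]
      exact mul_le_mul_of_nonneg_left (hC' β x) (abs_nonneg _)
    linarith
  rw [integral_eval_mul_gaussPi k (F := fun G => f (fun α => ∑ l, c α l * G l))
    (F' := fun G => ∑ β, c β k * f' β (fun α => ∑ l, c α l * G l))
    (C := (1 + ∑ β, |c β k|) * C) ?_ (hfc.comp hZc).measurable ?_ ?_ ?_]
  · rw [integral_finsetSum]
    · simp_rw [integral_const_mul]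
    · intro β _
      refine Integrable.const_mul ?_ _
      exact Integrable.of_bound ((hf'c β).comp hZc).aestronglyMeasurable C
        (ae_of_all _ fun G => hC' β _)
  · intro x t
    have h1 : HasDerivAt (fun t => fun α => ∑ l, c α l * Function.update x k t l)
        (fun α => c α k) t := by
      rw [hasDerivAt_pi]
      intro α
      have h2 : ∀ l, HasDerivAt (fun t => c α l * Function.update x k t l)
          (c α l * if l = k then 1 else 0) t := by
        intro l
        refine HasDerivAt.const_mul _ ?_
        by_cases h : l = k
        · subst h; simpa using hasDerivAt_id' t
        · simpa [h] using hasDerivAt_const t (x l)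
      refine (HasDerivAt.fun_sum (u := Finset.univ) fun l _ => h2 l).congr_deriv ?_
      simp
    refine ((hf _).comp_hasDerivAt t h1).congr_deriv ?_
    simp [mul_comm]
  · refine Continuous.measurable ?_
    exact continuous_finsetSum _ fun β _ => continuous_const.mul ((hf'c β).comp hZc)
  · intro x
    refine (hC _).trans ?_
    have : 0 ≤ ∑ β, |c β k| := Finset.sum_nonneg fun _ _ => abs_nonneg _
    nlinarith
  · intro x; exact hb _

/-- Kahane's comparison inequality for Gaussian vectors. -/
lemma integral_gaussPi_le_of_covariance {T κ : Type*} [Fintype T] [Fintype κ] [DecidableEq κ]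
    {f : (T → ℝ) → ℝ} {f1 : T → (T → ℝ) → ℝ} {f2 : T → T → (T → ℝ) → ℝ}
    (hf : ∀ x, HasFDerivAt f (∑ β, f1 β x • ContinuousLinearMap.proj (R := ℝ) (φ := fun _ : T => ℝ) β) x)
    (hf1 : ∀ α x, HasFDerivAt (f1 α)
      (∑ β, f2 α β x • ContinuousLinearMap.proj (R := ℝ) (φ := fun _ : T => ℝ) β) x)
    (hf2c : ∀ α β, Continuous (f2 α β)) {C : ℝ} (hC : ∀ x, |f x| ≤ C)
    (hC1 : ∀ α x, |f1 α x| ≤ C) (hC2 : ∀ α β x, |f2 α β x| ≤ C)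
    (a b : T → κ → ℝ) (orth : ∀ α β, ∑ k, a α k * b β k = 0)
    (sign : ∀ α β x, 0 ≤ (∑ k, b α k * b β k - ∑ k, a α k * a β k) * f2 α β x) :
    ∫ G, f (fun α => ∑ k, a α k * G k) ∂(gaussPi κ)
      ≤ ∫ G, f (fun α => ∑ k, b α k * G k) ∂(gaussPi κ) := by
  set c : ℝ → T → κ → ℝ := fun θ α k => Real.cos θ * a α k + Real.sin θ * b α k with hc
  set c' : ℝ → T → κ → ℝ := fun θ α k => -Real.sin θ * a α k + Real.cos θ * b α k with hc'
  set Z : ℝ → (κ → ℝ) → T → ℝ := fun θ G α => ∑ k, c θ α k * G k with hZ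
  have hfc : Continuous f := continuous_iff_continuousAt.2 fun x => (hf x).continuousAt
  have hf1c : ∀ α, Continuous (f1 α) :=
    fun α => continuous_iff_continuousAt.2 fun x => (hf1 α x).continuousAt
  have hC0 : 0 ≤ C := (abs_nonneg _).trans (hC 0)
  have hZc : ∀ θ, Continuous (Z θ) := fun θ => by fun_prop
  have hcd : ∀ θ α k, HasDerivAt (fun θ => c θ α k) (c' θ α k) θ := fun θ α k =>
    ((Real.hasDerivAt_cos θ).mul_const _).add ((Real.hasDerivAt_sin θ).mul_const _)
  have hcb : ∀ θ α k, |c' θ α k| ≤ |a α k| + |b α k| := by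
    intro θ α k
    refine (abs_add_le _ _).trans ?_
    rw [abs_mul, abs_mul, abs_neg]
    have h1 := Real.abs_sin_le_one θ
    have h2 := Real.abs_cos_le_one θ
    nlinarith [abs_nonneg (a α k), abs_nonneg (b α k)]
  set φ : ℝ → ℝ := fun θ => ∫ G, f (Z θ G) ∂(gaussPi κ) with hφ
  have hder : ∀ θ, HasDerivAt φ
      (∫ G, ∑ α, f1 α (Z θ G) * ∑ k, c' θ α k * G k ∂(gaussPi κ)) θ := by
    intro θ
    refine (hasDerivAt_integral_of_dominated_loc_of_deriv_le (s := Set.univ)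
      (F := fun θ G => f (Z θ G))
      (F' := fun θ G => ∑ α, f1 α (Z θ G) * ∑ k, c' θ α k * G k)
      (bound := fun G => ∑ α, C * ∑ k, (|a α k| + |b α k|) * |G k|) Filter.univ_mem
      (Filter.Eventually.of_forall fun θ => (hfc.comp (hZc θ)).aestronglyMeasurable)
      (Integrable.of_bound (hfc.comp (hZc θ)).aestronglyMeasurable C (ae_of_all _ fun G => hC _))
      ?_ ?_ ?_ ?_).2
    · refine Continuous.aestronglyMeasurable ?_
      exact continuous_finsetSum _ fun α _ => ((hf1c α).comp (hZc θ)).mul (by fun_prop)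
    · refine ae_of_all _ fun G θ _ => ?_
      rw [Real.norm_eq_abs]
      refine (Finset.abs_sum_le_sum_abs _ _).trans (Finset.sum_le_sum fun α _ => ?_)
      rw [abs_mul]
      refine mul_le_mul (hC1 _ _) ?_ (abs_nonneg _) hC0
      refine (Finset.abs_sum_le_sum_abs _ _).trans (Finset.sum_le_sum fun k _ => ?_)
      rw [abs_mul]
      exact mul_le_mul_of_nonneg_right (hcb _ _ _) (abs_nonneg _)
    · refine integrable_finsetSum _ fun α _ => Integrable.const_mul ?_ _
      exact integrable_finsetSum _ fun k _ => ((integrable_eval_gaussPi k).abs).const_mul _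
    · refine ae_of_all _ fun G θ _ => ?_
      have h1 : HasDerivAt (fun θ => Z θ G) (fun α => ∑ k, c' θ α k * G k) θ := by
        rw [hasDerivAt_pi]
        intro α
        exact HasDerivAt.fun_sum fun k _ => (hcd θ α k).mul_const _
      refine ((hf _).comp_hasDerivAt θ h1).congr_deriv ?_
      simp
  have hval : ∀ θ, (∫ G, ∑ α, f1 α (Z θ G) * ∑ k, c' θ α k * G k ∂(gaussPi κ))
      = Real.sin θ * Real.cos θ * ∫ G, ∑ α, ∑ β,
        (∑ k, b α k * b β k - ∑ k, a α k * a β k) * f2 α β (Z θ G) ∂(gaussPi κ) := by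
    intro θ
    have hi2 : ∀ α β, Integrable (fun G => f2 α β (Z θ G)) (gaussPi κ) := fun α β =>
      Integrable.of_bound ((hf2c α β).comp (hZc θ)).aestronglyMeasurable C
        (ae_of_all _ fun G => hC2 _ _ _)
    have hi1 : ∀ α k, Integrable (fun G => G k * f1 α (Z θ G)) (gaussPi κ) := fun α k => by
      have := (integrable_eval_gaussPi k).bdd_mul (c := C)
        ((hf1c α).comp (hZc θ)).aestronglyMeasurable (ae_of_all _ fun G => hC1 _ _)
      exact this.congr (ae_of_all _ fun x => mul_comm _ _)
    have e1 : ∀ G, ∑ α, f1 α (Z θ G) * ∑ k, c' θ α k * G k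
        = ∑ α, ∑ k, c' θ α k * (G k * f1 α (Z θ G)) := by
      intro G
      refine Finset.sum_congr rfl fun α _ => ?_
      rw [Finset.mul_sum]
      exact Finset.sum_congr rfl fun k _ => by ring
    simp_rw [e1]
    rw [integral_finsetSum _ fun α _ =>
      integrable_finsetSum _ fun k _ => (hi1 α k).const_mul _]
    rw [integral_finsetSum _ fun α _ =>
      integrable_finsetSum _ fun β _ => (hi2 α β).const_mul _, Finset.mul_sum]
    refine Finset.sum_congr rfl fun α _ => ?_
    rw [integral_finsetSum _ fun k _ => (hi1 α k).const_mul _,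
      integral_finsetSum _ fun β _ => (hi2 α β).const_mul _]
    simp_rw [integral_const_mul]
    have e2 : ∀ k, ∫ G, G k * f1 α (Z θ G) ∂(gaussPi κ)
        = ∑ β, c θ β k * ∫ G, f2 α β (Z θ G) ∂(gaussPi κ) := fun k =>
      integral_eval_mul_comp_linear (hf1 α) (hf2c α) (hC1 α) (hC2 α) (c θ) k
    simp_rw [e2, Finset.mul_sum]
    rw [Finset.sum_comm]
    refine Finset.sum_congr rfl fun β _ => ?_
    simp_rw [← mul_assoc, ← Finset.sum_mul]
    congr 1
    have o1 := orth α β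
    have o2 := orth β α
    have : ∀ k, c' θ α k * c θ β k = Real.sin θ * Real.cos θ * (b α k * b β k)
        - Real.sin θ * Real.cos θ * (a α k * a β k) + Real.cos θ ^ 2 * (a β k * b α k)
        - Real.sin θ ^ 2 * (a α k * b β k) := fun k => by simp only [hc, hc']; ring
    simp_rw [this, Finset.sum_sub_distrib, Finset.sum_add_distrib, Finset.sum_sub_distrib,
      ← Finset.mul_sum, o1, o2]
    ring
  have hmono : MonotoneOn φ (Set.Icc 0 (Real.pi / 2)) := by
    refine monotoneOn_of_deriv_nonneg (convex_Icc _ _)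
      (fun θ _ => (hder θ).continuousAt.continuousWithinAt)
      (fun θ _ => (hder θ).differentiableAt.differentiableWithinAt) ?_
    intro θ hθ
    rw [interior_Icc] at hθ
    rw [(hder θ).deriv, hval]
    refine mul_nonneg (mul_nonneg ?_ ?_) ?_
    · exact Real.sin_nonneg_of_nonneg_of_le_pi hθ.1.le (by linarith [hθ.2, Real.pi_pos])
    · exact Real.cos_nonneg_of_neg_pi_div_two_le_of_le (by linarith [hθ.1, Real.pi_pos]) hθ.2.le
    · exact integral_nonneg fun G =>
        Finset.sum_nonneg fun α _ => Finset.sum_nonneg fun β _ => sign _ _ _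
  have h0 := hmono (Set.left_mem_Icc.2 (by positivity)) (Set.right_mem_Icc.2 (by positivity))
    (by positivity : (0:ℝ) ≤ Real.pi / 2)
  simpa [hφ, hZ, hc] using h0

/-- A smooth step: `C²` with bounded derivatives, nondecreasing, zero exactly on the nonpositives. -/
structure SmoothStep (ρ ρ' ρ'' : ℝ → ℝ) (C : ℝ) : Prop where
  hasDeriv : ∀ x, HasDerivAt ρ (ρ' x) x
  hasDeriv' : ∀ x, HasDerivAt ρ' (ρ'' x) x
  cont : Continuous ρ''
  nonneg : ∀ x, 0 ≤ ρ x
  deriv_nonneg : ∀ x, 0 ≤ ρ' x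
  bound : ∀ x, ρ' x ≤ C
  bound' : ∀ x, |ρ'' x| ≤ C
  zero_iff : ∀ x, ρ x = 0 ↔ x ≤ 0

lemma SmoothStep.smul {ρ ρ' ρ'' : ℝ → ℝ} {C : ℝ} (h : SmoothStep ρ ρ' ρ'' C) {k : ℝ} (hk : 0 < k) :
    SmoothStep (fun x => k * ρ x) (fun x => k * ρ' x) (fun x => k * ρ'' x) (k * C) where
  hasDeriv x := (h.hasDeriv x).const_mul k
  hasDeriv' x := (h.hasDeriv' x).const_mul k
  cont := continuous_const.mul h.cont
  nonneg x := mul_nonneg hk.le (h.nonneg x)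
  deriv_nonneg x := mul_nonneg hk.le (h.deriv_nonneg x)
  bound x := mul_le_mul_of_nonneg_left (h.bound x) hk.le
  bound' x := by
    rw [abs_mul, abs_of_pos hk]; exact mul_le_mul_of_nonneg_left (h.bound' x) hk.le
  zero_iff x := by simp [hk.ne', h.zero_iff]

lemma exists_smoothStep : ∃ ρ ρ' ρ'' : ℝ → ℝ, ∃ C, SmoothStep ρ ρ' ρ'' C := by
  have h2 : ContDiff ℝ 2 Real.smoothTransition := by
    have := Real.smoothTransition.contDiff (n := 2); exact_mod_cast this
  have hd : Differentiable ℝ Real.smoothTransition := h2.differentiable (by norm_num)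
  have h1 : ContDiff ℝ 1 (deriv Real.smoothTransition) :=
    (contDiff_succ_iff_deriv.1 (by rw [one_add_one_eq_two]; exact h2)).2.2
  have hd1 : Differentiable ℝ (deriv Real.smoothTransition) := h1.differentiable (by norm_num)
  have h0 : Continuous (deriv (deriv Real.smoothTransition)) := h1.continuous_deriv le_rfl
  have z : ∀ x, x ∉ Set.Icc (0 : ℝ) 1 → deriv Real.smoothTransition x = 0 := by
    intro x hx
    rw [Set.mem_Icc, not_and_or, not_le, not_le] at hx
    rcases hx with hx | hx
    · have : Real.smoothTransition =ᶠ[nhds x] fun _ => 0 := by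
        filter_upwards [Iio_mem_nhds hx] with y hy
        exact Real.smoothTransition.zero_of_nonpos (le_of_lt hy)
      rw [this.deriv_eq]; simp
    · have : Real.smoothTransition =ᶠ[nhds x] fun _ => 1 := by
        filter_upwards [Ioi_mem_nhds hx] with y hy
        exact Real.smoothTransition.one_of_one_le (le_of_lt hy)
      rw [this.deriv_eq]; simp
  have z' : ∀ x, x ∉ Set.Icc (0 : ℝ) 1 → deriv (deriv Real.smoothTransition) x = 0 := by
    intro x hx
    have : deriv Real.smoothTransition =ᶠ[nhds x] fun _ => 0 := by
      filter_upwards [isClosed_Icc.isOpen_compl.mem_nhds hx] with y hy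
      exact z y hy
    rw [this.deriv_eq]; simp
  obtain ⟨C1, hC1⟩ := (isCompact_Icc (a := (0:ℝ)) (b := 1)).exists_bound_of_continuousOn
    (f := deriv Real.smoothTransition) h1.continuous.continuousOn
  obtain ⟨C2, hC2⟩ := (isCompact_Icc (a := (0:ℝ)) (b := 1)).exists_bound_of_continuousOn
    (f := deriv (deriv Real.smoothTransition)) h0.continuousOn
  have p1 : 0 ≤ C1 := (norm_nonneg _).trans (hC1 0 (by simp))
  have p2 : 0 ≤ C2 := (norm_nonneg _).trans (hC2 0 (by simp))
  refine ⟨Real.smoothTransition, deriv Real.smoothTransition, deriv (deriv Real.smoothTransition),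
    max C1 C2, fun x => (hd x).hasDerivAt, fun x => (hd1 x).hasDerivAt, h0,
    Real.smoothTransition.nonneg, fun x => Real.smoothTransition.monotone.deriv_nonneg, ?_, ?_,
    fun x => Real.smoothTransition.zero_iff_nonpos⟩
  · intro x
    by_cases hx : x ∈ Set.Icc (0 : ℝ) 1
    · exact (le_abs_self _).trans ((hC1 x hx).trans (le_max_left _ _))
    · rw [z x hx]; exact p1.trans (le_max_left _ _)
  · intro x
    by_cases hx : x ∈ Set.Icc (0 : ℝ) 1
    · exact (hC2 x hx).trans (le_max_right _ _)
    · rw [z' x hx]; simpa using Or.inl p1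

section GordonComparison

set_option linter.unusedSectionVars false

variable {I J : Type*} [Fintype I] [Fintype J]

/-- The weight `exp (-∑ j, ρ (x (i, j) - t i j))`. -/
def rowWeight (ρ : ℝ → ℝ) (t : I → J → ℝ) (i : I) (x : I × J → ℝ) : ℝ :=
  Real.exp (-∑ j, ρ (x (i, j) - t i j))

variable {ρ ρ' ρ'' : ℝ → ℝ} {C : ℝ} {t : I → J → ℝ}

lemma rowWeight_pos (i : I) (x : I × J → ℝ) : 0 < rowWeight ρ t i x := Real.exp_pos _

lemma SmoothStep.rowWeight_le_one (h : SmoothStep ρ ρ' ρ'' C) (i : I) (x : I × J → ℝ) :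
    rowWeight ρ t i x ≤ 1 := by
  rw [rowWeight, Real.exp_le_one_iff, neg_nonpos]
  exact Finset.sum_nonneg fun j _ => h.nonneg _

lemma SmoothStep.hasFDerivAt_rowWeight (h : SmoothStep ρ ρ' ρ'' C) (i : I) (x : I × J → ℝ) :
    HasFDerivAt (rowWeight ρ t i) (-∑ j, (rowWeight ρ t i x * ρ' (x (i, j) - t i j)) •
      ContinuousLinearMap.proj (R := ℝ) (φ := fun _ : I × J => ℝ) (i, j)) x := by
  have h1 : ∀ j, HasFDerivAt (fun x : I × J → ℝ => ρ (x (i, j) - t i j))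
      (ρ' (x (i, j) - t i j) • ContinuousLinearMap.proj (R := ℝ) (φ := fun _ : I × J => ℝ) (i, j)) x := by
    intro j
    have := (h.hasDeriv (x (i, j) - t i j)).comp_hasFDerivAt x
      ((hasFDerivAt_apply (𝕜 := ℝ) (i, j) x).sub_const (t i j))
    exact this
  have h2 := ((HasFDerivAt.fun_sum (u := Finset.univ) fun j _ => h1 j).fun_neg).exp
  refine h2.congr_fderiv ?_
  rw [smul_neg, Finset.smul_sum]
  simp only [smul_smul]
  rfl

lemma SmoothStep.continuous_rowWeight (h : SmoothStep ρ ρ' ρ'' C) (i : I) :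
    Continuous (rowWeight ρ t i) :=
  continuous_iff_continuousAt.2 fun x => (h.hasFDerivAt_rowWeight i x).continuousAt

variable [DecidableEq I]

lemma SmoothStep.hasFDerivAt_prod_rowWeight (h : SmoothStep ρ ρ' ρ'' C) (u : Finset I)
    (x : I × J → ℝ) :
    HasFDerivAt (fun x => ∏ i ∈ u, (1 - rowWeight ρ t i x))
      (∑ k, ∑ l, (if k ∈ u then (∏ i ∈ u.erase k, (1 - rowWeight ρ t i x)) *
        (rowWeight ρ t k x * ρ' (x (k, l) - t k l)) else 0) •
      ContinuousLinearMap.proj (R := ℝ) (φ := fun _ : I × J => ℝ) (k, l)) x := by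
  have h1 := HasFDerivAt.finsetProd (u := u) (g := fun i x => 1 - rowWeight ρ t i x) (x := x)
    fun i _ => ((h.hasFDerivAt_rowWeight (t := t) i x).const_sub 1)
  refine h1.congr_fderiv ?_
  rw [← Finset.sum_subset (Finset.subset_univ u)]
  · refine Finset.sum_congr rfl fun k hk => ?_
    simp [hk, Finset.smul_sum, smul_smul]
  · intro k _ hk; simp [hk]

variable [DecidableEq J]

lemma SmoothStep.hasFDerivAt_weight_mul (h : SmoothStep ρ ρ' ρ'' C) (i : I) (j : J) (x : I × J → ℝ) :
    HasFDerivAt (fun x => rowWeight ρ t i x * ρ' (x (i, j) - t i j))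
      (∑ l, (rowWeight ρ t i x * ((if l = j then ρ'' (x (i, j) - t i j) else 0)
          - ρ' (x (i, j) - t i j) * ρ' (x (i, l) - t i l))) •
      ContinuousLinearMap.proj (R := ℝ) (φ := fun _ : I × J => ℝ) (i, l)) x := by
  have h1 : HasFDerivAt (fun x : I × J → ℝ => ρ' (x (i, j) - t i j))
      (ρ'' (x (i, j) - t i j) • ContinuousLinearMap.proj (R := ℝ) (φ := fun _ : I × J => ℝ) (i, j)) x := by
    have := (h.hasDeriv' (x (i, j) - t i j)).comp_hasFDerivAt x
      ((hasFDerivAt_apply (𝕜 := ℝ) (i, j) x).sub_const (t i j))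
    exact this
  refine ((h.hasFDerivAt_rowWeight i x).mul h1).congr_fderiv ?_
  ext v
  simp only [add_apply, smul_apply, neg_apply, sum_apply, ContinuousLinearMap.proj_apply,
    smul_eq_mul]
  simp only [mul_sub, sub_mul, Finset.sum_sub_distrib, mul_ite, ite_mul, zero_mul, mul_zero,
    Finset.sum_ite_eq', Finset.mem_univ, if_true, mul_neg, Finset.mul_sum]
  rw [sub_eq_add_neg]
  congr 1
  · ring
  · rw [neg_inj]; exact Finset.sum_congr rfl fun l _ => by ring

end GordonComparison

section GordonComparison

set_option linter.unusedSectionVars false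

variable {I J : Type*} [Fintype I] [Fintype J] [DecidableEq I] [DecidableEq J]
  {ρ ρ' ρ'' : ℝ → ℝ} {C : ℝ} {t : I → J → ℝ}

lemma SmoothStep.prod_rowWeight_mem (h : SmoothStep ρ ρ' ρ'' C) (u : Finset I) (x : I × J → ℝ) :
    0 ≤ ∏ i ∈ u, (1 - rowWeight ρ t i x) ∧ ∏ i ∈ u, (1 - rowWeight ρ t i x) ≤ 1 := by
  have h1 : ∀ i, 0 ≤ 1 - rowWeight ρ t i x := fun i => by
    have := h.rowWeight_le_one (t := t) i x; linarith
  refine ⟨Finset.prod_nonneg fun i _ => h1 i, Finset.prod_le_one (fun i _ => h1 i) fun i _ => ?_⟩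
  have := rowWeight_pos (ρ := ρ) (t := t) i x; linarith

lemma SmoothStep.integral_prod_le (h : SmoothStep ρ ρ' ρ'' C) {κ : Type*} [Fintype κ]
    [DecidableEq κ] (a b : I → J → κ → ℝ)
    (orth : ∀ i j i' j', ∑ k, a i j k * b i' j' k = 0)
    (le : ∀ i j i' j', ∑ k, a i j k * a i' j' k ≤ ∑ k, b i j k * b i' j' k)
    (eq : ∀ i j j', ∑ k, a i j k * a i j' k = ∑ k, b i j k * b i j' k) :
    ∫ G, ∏ i, (1 - rowWeight ρ t i fun q => ∑ k, a q.1 q.2 k * G k) ∂(gaussPi κ)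
      ≤ ∫ G, ∏ i, (1 - rowWeight ρ t i fun q => ∑ k, b q.1 q.2 k * G k) ∂(gaussPi κ) := by
  have hC : 0 ≤ C := (h.deriv_nonneg 0).trans (h.bound 0)
  have hC2 : 0 ≤ C ^ 2 := sq_nonneg _
  have wb : ∀ i x, 0 ≤ rowWeight ρ t i x ∧ rowWeight ρ t i x ≤ 1 := fun i x =>
    ⟨(rowWeight_pos i x).le, h.rowWeight_le_one i x⟩
  have db : ∀ i j x, 0 ≤ rowWeight ρ t i x * ρ' (x (i, j) - t i j) ∧
      rowWeight ρ t i x * ρ' (x (i, j) - t i j) ≤ C := fun i j x =>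
    ⟨mul_nonneg (wb i x).1 (h.deriv_nonneg _), by
      calc _ ≤ 1 * C := mul_le_mul (wb i x).2 (h.bound _) (h.deriv_nonneg _) zero_le_one
        _ = C := one_mul C⟩
  have hρ'c : Continuous ρ' := continuous_iff_continuousAt.2 fun x => (h.hasDeriv' x).continuousAt
  have wc : ∀ i, Continuous (rowWeight ρ t i) := fun i => h.continuous_rowWeight i
  refine integral_gaussPi_le_of_covariance (T := I × J) (κ := κ) (C := 1 + C + C ^ 2)
    (f := fun x => ∏ i, (1 - rowWeight ρ t i x))
    (f1 := fun p x => (∏ i ∈ Finset.univ.erase p.1, (1 - rowWeight ρ t i x)) *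
      (rowWeight ρ t p.1 x * ρ' (x (p.1, p.2) - t p.1 p.2)))
    (f2 := fun p r x =>
      (∏ i ∈ Finset.univ.erase p.1, (1 - rowWeight ρ t i x)) *
        (if r.1 = p.1 then rowWeight ρ t p.1 x * ((if r.2 = p.2 then ρ'' (x (p.1, p.2) - t p.1 p.2)
          else 0) - ρ' (x (p.1, p.2) - t p.1 p.2) * ρ' (x (p.1, r.2) - t p.1 r.2)) else 0)
      + (rowWeight ρ t p.1 x * ρ' (x (p.1, p.2) - t p.1 p.2)) *
        (if r.1 ∈ Finset.univ.erase p.1 then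
          (∏ i ∈ (Finset.univ.erase p.1).erase r.1, (1 - rowWeight ρ t i x)) *
          (rowWeight ρ t r.1 x * ρ' (x (r.1, r.2) - t r.1 r.2)) else 0))
    ?_ ?_ ?_ ?_ ?_ ?_ (fun p => a p.1 p.2) (fun p => b p.1 p.2) (fun p r => orth _ _ _ _) ?_
  · intro x
    refine (h.hasFDerivAt_prod_rowWeight Finset.univ x).congr_fderiv ?_
    rw [Fintype.sum_prod_type]
    simp
  · intro p x
    refine ((h.hasFDerivAt_prod_rowWeight (Finset.univ.erase p.1) x).mul
      (h.hasFDerivAt_weight_mul p.1 p.2 x)).congr_fderiv ?_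
    ext v
    simp only [add_apply, smul_apply, sum_apply, ContinuousLinearMap.proj_apply, smul_eq_mul]
    rw [Fintype.sum_prod_type]
    simp only [add_mul, Finset.sum_add_distrib]
    congr 1
    · rw [Finset.sum_eq_single p.1]
      · simp only [if_true, Finset.mul_sum, mul_assoc]
      · intro i _ hi; simp [hi]
      · simp
    · simp only [Finset.mul_sum, mul_assoc]
  · intro p r
    have c1 : ∀ u : Finset I, Continuous fun x => ∏ i ∈ u, (1 - rowWeight ρ t i x) := fun u =>
      continuous_finsetProd _ fun i _ => continuous_const.sub (wc i)
    have c2 : ∀ i j, Continuous fun x : I × J → ℝ => ρ' (x (i, j) - t i j) := fun i j =>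
      hρ'c.comp (by fun_prop)
    have c3 : ∀ i j, Continuous fun x : I × J → ℝ => ρ'' (x (i, j) - t i j) := fun i j =>
      h.cont.comp (by fun_prop)
    refine ((c1 _).mul ?_).add (((wc _).mul (c2 _ _)).mul ?_)
    · split_ifs
      · exact (wc _).mul ((c3 _ _).sub ((c2 _ _).mul (c2 _ _)))
      · exact (wc _).mul (continuous_const.sub ((c2 _ _).mul (c2 _ _)))
      · exact continuous_const
    · split_ifs
      · exact (c1 _).mul ((wc _).mul (c2 _ _))
      · exact continuous_const
  · intro x
    have := h.prod_rowWeight_mem (t := t) Finset.univ x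
    rw [abs_of_nonneg this.1]; linarith [this.2]
  · intro p x
    have h1 := h.prod_rowWeight_mem (t := t) (Finset.univ.erase p.1) x
    have h2 := db p.1 p.2 x
    rw [abs_mul, abs_of_nonneg h1.1, abs_of_nonneg h2.1]
    calc _ ≤ 1 * C := mul_le_mul h1.2 h2.2 h2.1 zero_le_one
      _ ≤ _ := by linarith
  · intro p r x
    have h1 := h.prod_rowWeight_mem (t := t) (Finset.univ.erase p.1) x
    have h2 := db p.1 p.2 x
    by_cases hr : r.1 = p.1
    · simp only [hr, if_true, Finset.mem_erase, ne_eq, not_true_eq_false, false_and, if_false,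
        mul_zero, add_zero]
      rw [abs_mul, abs_mul, abs_of_nonneg h1.1, abs_of_nonneg (wb p.1 x).1]
      have h3 : |(if r.2 = p.2 then ρ'' (x (p.1, p.2) - t p.1 p.2) else 0) -
          ρ' (x (p.1, p.2) - t p.1 p.2) * ρ' (x (p.1, r.2) - t p.1 r.2)| ≤ C + C ^ 2 := by
        refine (abs_sub _ _).trans (add_le_add ?_ ?_)
        · split_ifs
          · exact h.bound' _
          · simpa using hC
        · rw [abs_mul, abs_of_nonneg (h.deriv_nonneg _), abs_of_nonneg (h.deriv_nonneg _), sq]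
          exact mul_le_mul (h.bound _) (h.bound _) (h.deriv_nonneg _) hC
      calc _ ≤ 1 * (1 * (C + C ^ 2)) :=
            mul_le_mul h1.2 (mul_le_mul (wb p.1 x).2 h3 (abs_nonneg _) zero_le_one)
              (mul_nonneg (wb p.1 x).1 (abs_nonneg _)) zero_le_one
        _ ≤ _ := by linarith
    · simp only [hr, if_false, mul_zero, zero_add, Finset.mem_erase, ne_eq, not_false_eq_true,
        Finset.mem_univ, and_self, if_true]
      have h3 := h.prod_rowWeight_mem (t := t) ((Finset.univ.erase p.1).erase r.1) x
      have h4 := db r.1 r.2 x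
      rw [abs_of_nonneg (mul_nonneg h2.1 (mul_nonneg h3.1 h4.1))]
      calc _ ≤ C * (1 * C) := mul_le_mul h2.2 (mul_le_mul h3.2 h4.2 h4.1 zero_le_one)
              (mul_nonneg h3.1 h4.1) hC
        _ ≤ _ := by nlinarith
  · rintro ⟨i, j⟩ ⟨i', j'⟩ x
    by_cases hr : i' = i
    · subst hr
      simp [eq]
    · refine mul_nonneg (sub_nonneg.2 (le _ _ _ _)) ?_
      simp only [hr, if_false, mul_zero, zero_add, Finset.mem_erase, ne_eq, not_false_eq_true,
        Finset.mem_univ, and_self, if_true]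
      exact mul_nonneg (db i j x).1 (mul_nonneg (h.prod_rowWeight_mem _ x).1 (db i' j' x).1)

end GordonComparison

section GordonComparison

set_option linter.unusedSectionVars false

variable {I J : Type*} [Fintype I] [Fintype J] [DecidableEq I] [DecidableEq J]

lemma SmoothStep.tendsto_prod_rowWeight {ρ ρ' ρ'' : ℝ → ℝ} {C : ℝ} (h : SmoothStep ρ ρ' ρ'' C)
    (t : I → J → ℝ) (x : I × J → ℝ) :
    Filter.Tendsto (fun n : ℕ => ∏ i, (1 - rowWeight (fun y => ((n : ℝ) + 1) * ρ y) t i x))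
      Filter.atTop
      (nhds (Set.indicator {x : I × J → ℝ | ∃ i, ∀ j, x (i, j) ≤ t i j}ᶜ (fun _ => (1 : ℝ)) x)) := by
  by_cases hx : ∃ i, ∀ j, x (i, j) ≤ t i j
  · rw [Set.indicator_of_notMem (by simpa using hx)]
    obtain ⟨i, hi⟩ := hx
    refine tendsto_const_nhds.congr fun n => ?_
    symm
    refine Finset.prod_eq_zero (Finset.mem_univ i) ?_
    have : ∀ j, ρ (x (i, j) - t i j) = 0 := fun j => (h.zero_iff _).2 (by linarith [hi j])
    simp [rowWeight, this]
  · rw [Set.indicator_of_mem (by simpa using hx)]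
    push Not at hx
    suffices H : Filter.Tendsto
        (fun n : ℕ => ∏ i, (1 - rowWeight (fun y => ((n : ℝ) + 1) * ρ y) t i x))
        Filter.atTop (nhds (∏ _i : I, ((1 : ℝ) - 0))) by simpa using H
    refine tendsto_finsetProd _ fun i _ => Filter.Tendsto.const_sub 1 ?_
    obtain ⟨j, hj⟩ := hx i
    have hpos : 0 < ∑ j, ρ (x (i, j) - t i j) := by
      refine Finset.sum_pos' (fun j _ => h.nonneg _) ⟨j, Finset.mem_univ j, ?_⟩
      refine lt_of_le_of_ne (h.nonneg _) (Ne.symm ?_)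
      rw [Ne, h.zero_iff]; linarith
    have h1 : Filter.Tendsto (fun n : ℕ => -(((n : ℝ) + 1) * ∑ j, ρ (x (i, j) - t i j)))
        Filter.atTop Filter.atBot := by
      refine Filter.tendsto_neg_atTop_atBot.comp ?_
      refine Filter.Tendsto.atTop_mul_const hpos ?_
      exact Filter.tendsto_atTop_add_const_right _ _ tendsto_natCast_atTop_atTop
    refine (Real.tendsto_exp_atBot.comp h1).congr fun n => ?_
    simp [rowWeight, Finset.mul_sum]

/-- Gordon's comparison inequality for finitely many Gaussian variables. -/
lemma gordon_finite {κ : Type*} [Fintype κ] [DecidableEq κ] (a b : I → J → κ → ℝ)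
    (orth : ∀ i j i' j', ∑ k, a i j k * b i' j' k = 0)
    (le : ∀ i j i' j', ∑ k, a i j k * a i' j' k ≤ ∑ k, b i j k * b i' j' k)
    (eq : ∀ i j j', ∑ k, a i j k * a i j' k = ∑ k, b i j k * b i j' k) (t : I → J → ℝ) :
    gaussPi κ {G | ∃ i, ∀ j, ∑ k, b i j k * G k ≤ t i j}
      ≤ gaussPi κ {G | ∃ i, ∀ j, ∑ k, a i j k * G k ≤ t i j} := by
  obtain ⟨ρ, ρ', ρ'', C, h⟩ := exists_smoothStep
  have hms : ∀ a : I → J → κ → ℝ,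
      MeasurableSet {G : κ → ℝ | ∃ i, ∀ j, ∑ k, a i j k * G k ≤ t i j} := by
    intro a
    have : {G : κ → ℝ | ∃ i, ∀ j, ∑ k, a i j k * G k ≤ t i j}
        = ⋃ i, ⋂ j, {G | ∑ k, a i j k * G k ≤ t i j} := by ext; simp
    rw [this]
    refine MeasurableSet.iUnion fun i => MeasurableSet.iInter fun j => ?_
    exact measurableSet_le (by fun_prop) measurable_const
  have lim : ∀ a : I → J → κ → ℝ, Filter.Tendsto (fun n : ℕ => ∫ G, ∏ i,
      (1 - rowWeight (fun y => ((n : ℝ) + 1) * ρ y) t i fun q => ∑ k, a q.1 q.2 k * G k) ∂(gaussPi κ))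
      Filter.atTop
      (nhds ((gaussPi κ).real {G | ∃ i, ∀ j, ∑ k, a i j k * G k ≤ t i j}ᶜ)) := by
    intro a
    rw [← integral_indicator_one (hms a).compl]
    refine tendsto_integral_of_dominated_convergence (fun _ => 1) ?_ (integrable_const _) ?_ ?_
    · intro n
      refine Continuous.aestronglyMeasurable ?_
      refine continuous_finsetProd _ fun i _ => continuous_const.sub ?_
      exact ((h.smul (by positivity : (0:ℝ) < (n:ℝ) + 1)).continuous_rowWeight i).comp (by fun_prop)
    · intro n
      refine ae_of_all _ fun G => ?_
      have := (h.smul (by positivity : (0:ℝ) < (n:ℝ) + 1)).prod_rowWeight_mem (t := t) Finset.univ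
        (fun q : I × J => ∑ k, a q.1 q.2 k * G k)
      rw [Real.norm_eq_abs, abs_of_nonneg this.1]
      exact this.2
    · refine ae_of_all _ fun G => ?_
      exact h.tendsto_prod_rowWeight t (fun q : I × J => ∑ k, a q.1 q.2 k * G k)
  have key := le_of_tendsto_of_tendsto' (lim a) (lim b) fun n =>
    (h.smul (by positivity : (0:ℝ) < (n:ℝ) + 1)).integral_prod_le (t := t) a b orth le eq
  rw [probReal_compl_eq_one_sub (hms a), probReal_compl_eq_one_sub (hms b)] at key
  have := sub_le_sub_iff_left 1 |>.1 key
  exact (ENNReal.toReal_le_toReal (measure_ne_top _ _) (measure_ne_top _ _)).1 this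

end GordonComparison

lemma half_le_gaussianReal_Iic : (1 : ℝ≥0∞) ≤ 2 * gaussianReal 0 1 (Set.Iic 0) := by
  have h1 : gaussianReal 0 1 (Set.Ici 0) = gaussianReal 0 1 (Set.Iic 0) := by
    have := gaussianReal_map_neg (μ := 0) (v := 1)
    rw [neg_zero] at this
    conv_lhs => rw [← this]
    rw [Measure.map_apply measurable_neg measurableSet_Ici]
    congr 1; ext x; simp
  have h2 : gaussianReal 0 1 (Set.univ : Set ℝ) ≤ gaussianReal 0 1 (Set.Iic 0) + gaussianReal 0 1 (Set.Ici 0) := by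
    refine (measure_mono ?_).trans (measure_union_le _ _)
    intro x _
    exact le_total x 0
  rw [measure_univ, h1] at h2
  rw [two_mul]; exact h2

lemma gordon_finite_two {I J κ₁ κ₂ : Type*} [Fintype I] [Fintype J]
    [Fintype κ₁] [Fintype κ₂] (a : I → J → κ₁ → ℝ) (c : I → J → ℝ)
    (b : I → J → κ₂ → ℝ) (hc : ∀ i j, 0 ≤ c i j)
    (le : ∀ i j i' j', ∑ k, b i j k * b i' j' k ≤ ∑ k, a i j k * a i' j' k + c i j * c i' j')
    (eq : ∀ i j j', ∑ k, b i j k * b i j' k = ∑ k, a i j k * a i j' k + c i j * c i j')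
    (t : I → J → ℝ) :
    gaussPi κ₁ {G | ∃ i, ∀ j, ∑ k, a i j k * G k ≤ t i j}
      ≤ 2 * gaussPi κ₂ {H | ∃ i, ∀ j, ∑ k, b i j k * H k ≤ t i j} := by
  classical
  set A := {G : κ₁ → ℝ | ∃ i, ∀ j, ∑ k, a i j k * G k ≤ t i j} with hA
  set B := {H : κ₂ → ℝ | ∃ i, ∀ j, ∑ k, b i j k * H k ≤ t i j} with hB
  have key := gordon_finite (κ := κ₁ ⊕ (Unit ⊕ κ₂))
    (fun i j => Sum.elim (fun _ => 0) (Sum.elim (fun _ => 0) (b i j)))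
    (fun i j => Sum.elim (a i j) (Sum.elim (fun _ => c i j) (fun _ => 0)))
    (by intros; simp) (by intros; simpa using le _ _ _ _) (by intros; simpa using eq _ _ _) t
  have mp1 := measurePreserving_sumPiEquivProdPi (fun _ : κ₁ ⊕ (Unit ⊕ κ₂) => gaussianReal 0 1)
  have mp2 := measurePreserving_sumPiEquivProdPi (fun _ : Unit ⊕ κ₂ => gaussianReal 0 1)
  have mp3 : MeasurePreserving (fun G : κ₁ ⊕ (Unit ⊕ κ₂) → ℝ => fun k => G (.inr (.inr k)))
      (gaussPi _) (gaussPi κ₂) :=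
    measurePreserving_snd.comp (mp2.comp (measurePreserving_snd.comp mp1))
  have hms : MeasurableSet A := by
    have : A = ⋃ i, ⋂ j, {G | ∑ k, a i j k * G k ≤ t i j} := by ext; simp [hA]
    rw [this]
    refine MeasurableSet.iUnion fun i => MeasurableSet.iInter fun j => ?_
    exact measurableSet_le (by fun_prop) measurable_const
  have hmsB : MeasurableSet B := by
    have : B = ⋃ i, ⋂ j, {G | ∑ k, b i j k * G k ≤ t i j} := by ext; simp [hB]
    rw [this]
    refine MeasurableSet.iUnion fun i => MeasurableSet.iInter fun j => ?_
    exact measurableSet_le (by fun_prop) measurable_const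
  have eB : gaussPi (κ₁ ⊕ (Unit ⊕ κ₂)) {G | ∃ i, ∀ j, ∑ k,
      Sum.elim (fun _ => 0) (Sum.elim (fun _ => 0) (b i j)) k * G k ≤ t i j} = gaussPi κ₂ B := by
    rw [← mp3.measure_preimage hmsB.nullMeasurableSet]
    congr 1; ext G; simp [hB]
  have eA : gaussPi κ₁ A * gaussianReal 0 1 (Set.Iic 0) ≤
      gaussPi (κ₁ ⊕ (Unit ⊕ κ₂)) {G | ∃ i, ∀ j, ∑ k,
      Sum.elim (a i j) (Sum.elim (fun _ => c i j) (fun _ => 0)) k * G k ≤ t i j} := by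
    have e1 : gaussianReal 0 1 (Set.Iic 0)
        = gaussPi (Unit ⊕ κ₂) ((fun H => H (.inl ())) ⁻¹' Set.Iic 0) :=
      ((measurePreserving_eval (fun _ : Unit ⊕ κ₂ => gaussianReal 0 1) (.inl ())).measure_preimage
        measurableSet_Iic.nullMeasurableSet).symm
    have hm2 : MeasurableSet ((fun H : Unit ⊕ κ₂ → ℝ => H (.inl ())) ⁻¹' Set.Iic 0) :=
      (measurable_pi_apply _) measurableSet_Iic
    rw [e1, ← Measure.prod_prod, ← mp1.measure_preimage (hms.prod hm2).nullMeasurableSet]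
    refine measure_mono ?_
    rintro G ⟨⟨i, hi⟩, h2⟩
    refine ⟨i, fun j => ?_⟩
    have h3 := hi j
    have h2' : G (.inr (.inl ())) ≤ 0 := h2
    have h3' : ∑ k, a i j k * G (.inl k) ≤ t i j := h3
    simp only [Fintype.sum_sum_type, Sum.elim_inl, Sum.elim_inr, Finset.univ_unique,
      Finset.sum_singleton, zero_mul, Finset.sum_const_zero, add_zero]
    have := mul_nonpos_of_nonneg_of_nonpos (hc i j) h2'
    exact (add_le_of_nonpos_right this).trans h3'
  calc gaussPi κ₁ A = gaussPi κ₁ A * 1 := (mul_one _).symm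
    _ ≤ gaussPi κ₁ A * (2 * gaussianReal 0 1 (Set.Iic 0)) := by
        gcongr; exact half_le_gaussianReal_Iic
    _ = 2 * (gaussPi κ₁ A * gaussianReal 0 1 (Set.Iic 0)) := by ring
    _ ≤ 2 * gaussPi κ₂ B := by gcongr; rw [← eB]; exact eA.trans key

/-- Gordon's comparison inequality for countable families, in the two-process form. -/
lemma gordon_countable {I J κ₁ κ₂ : Type*} [Countable I] [Countable J]
    [Fintype κ₁] [Fintype κ₂] (a : I → J → κ₁ → ℝ) (c : I → J → ℝ)
    (b : I → J → κ₂ → ℝ) (hc : ∀ i j, 0 ≤ c i j)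
    (le : ∀ i j i' j', ∑ k, b i j k * b i' j' k ≤ ∑ k, a i j k * a i' j' k + c i j * c i' j')
    (eq : ∀ i j j', ∑ k, b i j k * b i j' k = ∑ k, a i j k * a i j' k + c i j * c i j')
    (t : I → J → ℝ) :
    gaussPi κ₁ {G | ∃ i, ∀ j, ∑ k, a i j k * G k ≤ t i j}
      ≤ 2 * gaussPi κ₂ {H | ∃ i, ∀ j, ∑ k, b i j k * H k ≤ t i j} := by
  classical
  have fin : ∀ (s : Finset I) (r : Finset J),
      gaussPi κ₁ {G | ∃ i ∈ s, ∀ j ∈ r, ∑ k, a i j k * G k ≤ t i j}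
        ≤ 2 * gaussPi κ₂ {H | ∃ i ∈ s, ∀ j ∈ r, ∑ k, b i j k * H k ≤ t i j} := by
    intro s r
    have := gordon_finite_two (I := s) (J := r) (fun i j => a i j) (fun i j => c i j)
      (fun i j => b i j) (fun i j => hc i j) (fun i j i' j' => le i j i' j')
      (fun i j j' => eq i j j') (fun i j => t i j)
    simpa using this
  have step : ∀ s : Finset I,
      gaussPi κ₁ {G | ∃ i ∈ s, ∀ j, ∑ k, a i j k * G k ≤ t i j}
        ≤ 2 * gaussPi κ₂ {H | ∃ i ∈ s, ∀ j, ∑ k, b i j k * H k ≤ t i j} := by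
    intro s
    have e1 : {H : κ₂ → ℝ | ∃ i ∈ s, ∀ j, ∑ k, b i j k * H k ≤ t i j}
        = ⋂ r : Finset J, {H | ∃ i ∈ s, ∀ j ∈ r, ∑ k, b i j k * H k ≤ t i j} := by
      ext H
      simp only [Set.mem_ofPred_eq, Set.mem_iInter]
      refine ⟨fun ⟨i, hi, h⟩ r => ⟨i, hi, fun j _ => h j⟩, fun h => ?_⟩
      by_contra! hcon
      obtain ⟨i₀, hi₀, -⟩ := h ∅
      have : Nonempty J := ⟨(hcon i₀ hi₀).choose⟩
      choose! f hf using hcon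
      obtain ⟨i, hi, h'⟩ := h (s.image f)
      exact absurd (h' (f i) (Finset.mem_image_of_mem f hi)) (not_le.2 (hf i hi))
    have anti : Antitone fun r : Finset J =>
        {H : κ₂ → ℝ | ∃ i ∈ s, ∀ j ∈ r, ∑ k, b i j k * H k ≤ t i j} := by
      intro r r' hr H ⟨i, hi, h⟩
      exact ⟨i, hi, fun j hj => h j (hr hj)⟩
    have hms : ∀ r : Finset J, MeasurableSet
        {H : κ₂ → ℝ | ∃ i ∈ s, ∀ j ∈ r, ∑ k, b i j k * H k ≤ t i j} := by
      intro r
      have : {H : κ₂ → ℝ | ∃ i ∈ s, ∀ j ∈ r, ∑ k, b i j k * H k ≤ t i j}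
          = ⋃ i ∈ s, ⋂ j ∈ r, {H | ∑ k, b i j k * H k ≤ t i j} := by ext; simp
      rw [this]
      refine s.measurableSet_biUnion fun i _ => r.measurableSet_biInter fun j _ => ?_
      exact measurableSet_le (by fun_prop) measurable_const
    rw [e1, anti.measure_iInter (fun r => (hms r).nullMeasurableSet) ⟨∅, measure_ne_top _ _⟩,
      ENNReal.mul_iInf_of_ne (by norm_num) (by norm_num)]
    refine le_iInf fun r => le_trans (measure_mono ?_) (fin s r)
    rintro G ⟨i, hi, h⟩
    exact ⟨i, hi, fun j _ => h j⟩
  have e2 : {G : κ₁ → ℝ | ∃ i, ∀ j, ∑ k, a i j k * G k ≤ t i j}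
      = ⋃ s : Finset I, {G | ∃ i ∈ s, ∀ j, ∑ k, a i j k * G k ≤ t i j} := by
    ext G
    simp only [Set.mem_ofPred_eq, Set.mem_iUnion]
    exact ⟨fun ⟨i, h⟩ => ⟨{i}, i, by simp, h⟩, fun ⟨s, i, _, h⟩ => ⟨i, h⟩⟩
  have mono : Monotone fun s : Finset I =>
      {G : κ₁ → ℝ | ∃ i ∈ s, ∀ j, ∑ k, a i j k * G k ≤ t i j} := by
    intro s s' hs G ⟨i, hi, h⟩
    exact ⟨i, hs hi, h⟩
  rw [e2, mono.measure_iUnion]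
  refine iSup_le fun s => (step s).trans (mul_le_mul' le_rfl (measure_mono ?_))
  rintro H ⟨i, _, h⟩
  exact ⟨i, h⟩

/-- The Euclidean norm of a finite real family. -/
def euc {P : Type*} [Fintype P] (u : P → ℝ) : ℝ := Real.sqrt (∑ p, u p ^ 2)

lemma euc_nonneg {P : Type*} [Fintype P] (u : P → ℝ) : 0 ≤ euc u := Real.sqrt_nonneg _

lemma euc_sq {P : Type*} [Fintype P] (u : P → ℝ) : euc u ^ 2 = ∑ p, u p ^ 2 :=
  Real.sq_sqrt (Finset.sum_nonneg fun _ _ => sq_nonneg _)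

lemma sum_mul_le_euc {P : Type*} [Fintype P] (u v : P → ℝ) : ∑ p, u p * v p ≤ euc u * euc v :=
  Real.sum_mul_le_sqrt_mul_sqrt _ _ _

lemma gordon_bilinear {I J P Q : Type*} [Countable I] [Countable J] [Fintype P] [Fintype Q]
    (s : ℝ) (hs : s * s = 1) (u : I → J → P → ℝ) (v : I → J → Q → ℝ)
    (huv : (∀ i j j', u i j = u i j') ∨ (∀ i j j', v i j = v i j')) (t : I → J → ℝ) :
    gaussPi (P × Q) {G | ∃ i, ∀ j, s * ∑ p, ∑ q, u i j p * v i j q * G (p, q) ≤ t i j}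
      ≤ 2 * gaussPi (P ⊕ Q) {H | ∃ i, ∀ j, s * (euc (v i j) * ∑ p, u i j p * H (.inl p)
          + euc (u i j) * ∑ q, v i j q * H (.inr q)) ≤ t i j} := by
  have ea : ∀ i j i' j', ∑ k : P × Q, s * (u i j k.1 * v i j k.2) * (s * (u i' j' k.1 * v i' j' k.2))
      = (∑ p, u i j p * u i' j' p) * ∑ q, v i j q * v i' j' q := by
    intro i j i' j'
    rw [Fintype.sum_prod_type, Finset.sum_mul_sum]
    refine Finset.sum_congr rfl fun p _ => Finset.sum_congr rfl fun q _ => ?_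
    linear_combination (u i j p * v i j q * u i' j' p * v i' j' q) * hs
  have eb : ∀ i j i' j', ∑ k : P ⊕ Q,
      Sum.elim (fun p => s * (euc (v i j) * u i j p)) (fun q => s * (euc (u i j) * v i j q)) k *
      Sum.elim (fun p => s * (euc (v i' j') * u i' j' p)) (fun q => s * (euc (u i' j') * v i' j' q)) k
      = euc (v i j) * euc (v i' j') * (∑ p, u i j p * u i' j' p)
        + euc (u i j) * euc (u i' j') * ∑ q, v i j q * v i' j' q := by
    intro i j i' j'
    rw [Fintype.sum_sum_type, Finset.mul_sum, Finset.mul_sum]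
    congr 1
    · refine Finset.sum_congr rfl fun p _ => ?_
      simp only [Sum.elim_inl]
      linear_combination (euc (v i j) * u i j p * euc (v i' j') * u i' j' p) * hs
    · refine Finset.sum_congr rfl fun p _ => ?_
      simp only [Sum.elim_inr]
      linear_combination (euc (u i j) * v i j p * euc (u i' j') * v i' j' p) * hs
  have key := gordon_countable
    (a := fun i j (k : P × Q) => s * (u i j k.1 * v i j k.2))
    (c := fun i j => euc (u i j) * euc (v i j))
    (b := fun i j => Sum.elim (fun p => s * (euc (v i j) * u i j p))
      (fun q => s * (euc (u i j) * v i j q)))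
    (fun i j => mul_nonneg (euc_nonneg _) (euc_nonneg _))
    (by
      intro i j i' j'
      rw [ea, eb]
      have h1 := sum_mul_le_euc (u i j) (u i' j')
      have h2 := sum_mul_le_euc (v i j) (v i' j')
      nlinarith [mul_nonneg (sub_nonneg.2 h1) (sub_nonneg.2 h2)])
    (by
      intro i j j'
      rw [ea, eb]
      rcases huv with h | h
      · rw [h i j' j]
        have := euc_sq (u i j)
        have h3 : ∑ p, u i j p * u i j p = euc (u i j) * euc (u i j) := by
          rw [← sq, this]; exact Finset.sum_congr rfl fun _ _ => (sq _).symm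
        rw [h3]; ring
      · rw [h i j' j]
        have := euc_sq (v i j)
        have h3 : ∑ p, v i j p * v i j p = euc (v i j) * euc (v i j) := by
          rw [← sq, this]; exact Finset.sum_congr rfl fun _ _ => (sq _).symm
        rw [h3]; ring)
    t
  have e1 : ∀ i j (G : P × Q → ℝ), ∑ k : P × Q, s * (u i j k.1 * v i j k.2) * G k
      = s * ∑ p, ∑ q, u i j p * v i j q * G (p, q) := by
    intro i j G
    rw [Fintype.sum_prod_type, Finset.mul_sum]
    refine Finset.sum_congr rfl fun p _ => ?_
    rw [Finset.mul_sum]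
    exact Finset.sum_congr rfl fun q _ => by ring
  have e2 : ∀ i j (H : P ⊕ Q → ℝ), ∑ k : P ⊕ Q,
      Sum.elim (fun p => s * (euc (v i j) * u i j p)) (fun q => s * (euc (u i j) * v i j q)) k * H k
      = s * (euc (v i j) * ∑ p, u i j p * H (.inl p) + euc (u i j) * ∑ q, v i j q * H (.inr q)) := by
    intro i j H
    rw [Fintype.sum_sum_type, mul_add, ← mul_assoc, ← mul_assoc, Finset.mul_sum, Finset.mul_sum]
    congr 1 <;> refine Finset.sum_congr rfl fun p _ => ?_
    · simp only [Sum.elim_inl]; ring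
    · simp only [Sum.elim_inr]; ring
  simpa only [e1, e2] using key

lemma exp_le_one_add_add_sq_mul (y : ℝ) : Real.exp y ≤ 1 + y + y ^ 2 * Real.exp |y| := by
  have h0 : 1 ≤ Real.exp |y| := Real.one_le_exp (abs_nonneg y)
  rcases le_or_gt |y| 1 with h | h
  · have := Real.abs_exp_sub_one_sub_id_le h
    have h1 := (abs_le.1 this).2
    nlinarith [sq_nonneg y]
  · rcases lt_abs.1 h with h | h
    · rw [abs_of_pos (by linarith)] at h0 ⊢
      nlinarith [mul_le_mul_of_nonneg_right (by nlinarith : 1 ≤ y ^ 2) (by linarith : 0 ≤ Real.exp y)]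
    · have h1 : Real.exp y ≤ 1 := Real.exp_le_one_iff.2 (by linarith)
      nlinarith [mul_le_mul_of_nonneg_left h0 (sq_nonneg y)]

lemma integrable_exp_sq_std :
    Integrable (fun x : ℝ => Real.exp ((1 + x ^ 2) / 4)) (gaussianReal 0 1) := by
  rw [integrable_std_iff]
  have h := (integrable_exp_neg_mul_sq (b := 1 / 4) (by norm_num)).const_mul
    ((Real.sqrt (2 * Real.pi))⁻¹ * Real.exp (1 / 4))
  refine h.congr (ae_of_all _ fun x => ?_)
  simp only [gaussianPDFReal, NNReal.coe_one, mul_one, sub_zero]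
  rw [mul_assoc, mul_assoc, ← Real.exp_add, ← Real.exp_add]
  congr 2; ring

lemma integrable_sq_std : Integrable (fun x : ℝ => x ^ 2) (gaussianReal 0 1) := by
  have := (memLp_id_gaussianReal (μ := 0) (v := 1) 2).integrable_sq
  exact this

lemma integral_sq_std : ∫ x : ℝ, x ^ 2 ∂(gaussianReal 0 1) = 1 := by
  have h := variance_id_gaussianReal (μ := 0) (v := 1)
  rw [variance_eq_integral aemeasurable_id] at h
  simpa using h

lemma integrable_of_quadratic_bound {F : ℝ → ℝ} (hF : Measurable F) {K : ℝ}
    (hb : ∀ x, |F x| ≤ K * (1 + x ^ 2)) : Integrable F (gaussianReal 0 1) :=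
  (((integrable_const 1).add integrable_sq_std).const_mul K).mono' hF.aestronglyMeasurable
    (ae_of_all _ fun x => by simpa using hb x)

lemma abs_integral_le_of_quadratic_bound {F : ℝ → ℝ} {K : ℝ}
    (hb : ∀ x, |F x| ≤ K * (1 + x ^ 2)) : |∫ x, F x ∂(gaussianReal 0 1)| ≤ 2 * K := by
  have h1 : Integrable (fun x : ℝ => K * (1 + x ^ 2)) (gaussianReal 0 1) :=
    ((integrable_const 1).add integrable_sq_std).const_mul K
  have := norm_integral_le_of_norm_le (f := F) h1 (ae_of_all _ fun x => by simpa using hb x)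
  rw [integral_const_mul, integral_add (integrable_const 1) integrable_sq_std, integral_sq_std] at this
  rw [Real.norm_eq_abs] at this
  refine this.trans (le_of_eq ?_)
  simp; ring

/-- A bound for the moment generating function of a centred quadratically bounded function. -/
lemma mgf_le_of_quadratic_bound {L : ℝ} (hL : 0 < L) {Y : ℝ → ℝ} (hY : Measurable Y)
    (hb : ∀ x, |Y x| ≤ L * (1 + x ^ 2)) (h0 : ∫ x, Y x ∂(gaussianReal 0 1) = 0) {s : ℝ}
    (hs : |s| * L ≤ 1 / 8) :
    Integrable (fun x => Real.exp (s * Y x)) (gaussianReal 0 1) ∧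
    ∫ x, Real.exp (s * Y x) ∂(gaussianReal 0 1) ≤ Real.exp (s ^ 2 *
      (128 * L ^ 2 * ∫ x : ℝ, Real.exp ((1 + x ^ 2) / 4) ∂(gaussianReal 0 1))) := by
  have hsY : ∀ x, |s * Y x| ≤ (1 + x ^ 2) / 8 := fun x => by
    rw [abs_mul]
    calc |s| * |Y x| ≤ |s| * (L * (1 + x ^ 2)) := mul_le_mul_of_nonneg_left (hb x) (abs_nonneg _)
      _ = (|s| * L) * (1 + x ^ 2) := by ring
      _ ≤ (1 / 8) * (1 + x ^ 2) := by gcongr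
      _ = _ := by ring
  have pt : ∀ x, Real.exp (s * Y x) ≤ 1 + s * Y x
      + s ^ 2 * (128 * L ^ 2 * Real.exp ((1 + x ^ 2) / 4)) := by
    intro x
    refine (exp_le_one_add_add_sq_mul _).trans ?_
    have hx : (0 : ℝ) ≤ 1 + x ^ 2 := by positivity
    have h1 : Real.exp |s * Y x| ≤ Real.exp ((1 + x ^ 2) / 8) := Real.exp_le_exp.2 (hsY x)
    have h2 : (Y x) ^ 2 ≤ (L * (1 + x ^ 2)) ^ 2 := by
      rw [← sq_abs (Y x)]; exact pow_le_pow_left₀ (abs_nonneg _) (hb x) 2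
    have h3 : (1 + x ^ 2) ^ 2 ≤ 128 * Real.exp ((1 + x ^ 2) / 8) := by
      have := Real.quadratic_le_exp_of_nonneg (x := (1 + x ^ 2) / 8) (by positivity)
      nlinarith
    have h4 : Real.exp ((1 + x ^ 2) / 4) = Real.exp ((1 + x ^ 2) / 8) * Real.exp ((1 + x ^ 2) / 8) := by
      rw [← Real.exp_add]; congr 1; ring
    have h5 : (Y x) ^ 2 ≤ L ^ 2 * (128 * Real.exp ((1 + x ^ 2) / 8)) := by
      rw [mul_pow] at h2
      exact h2.trans (mul_le_mul_of_nonneg_left h3 (sq_nonneg L))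
    have h6 : (Y x) ^ 2 * Real.exp |s * Y x| ≤ 128 * L ^ 2 * Real.exp ((1 + x ^ 2) / 4) := by
      rw [h4]
      calc _ ≤ L ^ 2 * (128 * Real.exp ((1 + x ^ 2) / 8)) * Real.exp ((1 + x ^ 2) / 8) :=
            mul_le_mul h5 h1 (Real.exp_pos _).le (by positivity)
        _ = _ := by ring
    have := mul_le_mul_of_nonneg_left h6 (sq_nonneg s)
    rw [mul_pow]; linarith
  have iY : Integrable Y (gaussianReal 0 1) := integrable_of_quadratic_bound hY hb
  have iR : Integrable (fun x => 1 + s * Y x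
      + s ^ 2 * (128 * L ^ 2 * Real.exp ((1 + x ^ 2) / 4))) (gaussianReal 0 1) :=
    ((integrable_const 1).add (iY.const_mul s)).add
      ((integrable_exp_sq_std.const_mul _).const_mul _)
  have iE : Integrable (fun x => Real.exp (s * Y x)) (gaussianReal 0 1) :=
    iR.mono' (by fun_prop) (ae_of_all _ fun x => by
      rw [Real.norm_eq_abs, abs_of_pos (Real.exp_pos _)]; exact pt x)
  refine ⟨iE, ?_⟩
  refine (integral_mono iE iR pt).trans ?_
  have i1 : Integrable (fun x => 1 + s * Y x) (gaussianReal 0 1) :=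
    (integrable_const 1).add (iY.const_mul s)
  rw [integral_add i1
    ((integrable_exp_sq_std.const_mul _).const_mul _),
    integral_add (integrable_const 1) (iY.const_mul s), integral_const_mul, h0,
    integral_const_mul, integral_const_mul]
  have := Real.add_one_le_exp (s ^ 2 *
      (128 * L ^ 2 * ∫ x : ℝ, Real.exp ((1 + x ^ 2) / 4) ∂(gaussianReal 0 1)))
  simp only [integral_const, probReal_univ, smul_eq_mul]
  linarith

/-- Concentration of sums of quadratically bounded functions of independent Gaussians. -/
lemma exists_concentration (K : ℝ) (hK : 0 < K) : ∃ c : ℝ, 0 < c ∧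
    ∀ (κ : Type) [Fintype κ] (F : κ → ℝ → ℝ), (∀ k, Measurable (F k)) →
      (∀ k x, |F k x| ≤ K * (1 + x ^ 2)) → ∀ M η : ℝ, (Fintype.card κ : ℝ) ≤ M → 0 < η → η ≤ 1 →
      gaussPi κ {x | M * η ≤ |∑ k, (F k (x k) - ∫ y, F k y ∂(gaussianReal 0 1))|}
        ≤ ENNReal.ofReal (2 * Real.exp (-c * M * η ^ 2)) := by
  set E := ∫ x : ℝ, Real.exp ((1 + x ^ 2) / 4) ∂(gaussianReal 0 1) with hE
  have hE0 : 0 < E := by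
    have : (1 : ℝ) ≤ E := by
      have h1 : ∫ _x : ℝ, (1 : ℝ) ∂(gaussianReal 0 1) ≤ E :=
        integral_mono (integrable_const 1) integrable_exp_sq_std fun x =>
          Real.one_le_exp (by positivity)
      simpa using h1
    linarith
  set L := 3 * K with hLdef
  have hL : 0 < L := by positivity
  set B := 128 * L ^ 2 * E with hB
  have hB0 : 0 < B := by positivity
  set s₀ := min (1 / (8 * L)) (1 / (2 * B)) with hs0
  have hs0p : 0 < s₀ := by rw [hs0]; positivity
  refine ⟨s₀ / 2, by positivity, ?_⟩
  intro κ _ F hF hb M η hM hη hη1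
  have one : ∀ s : ℝ, |s| = s₀ * η →
      (gaussPi κ).real {x | M * η * |s| ≤ s * ∑ k, (F k (x k) - ∫ y, F k y ∂(gaussianReal 0 1))}
        ≤ Real.exp (-(s₀ / 2) * M * η ^ 2) := by
    intro s hs
    set Y : κ → ℝ → ℝ := fun k x => F k x - ∫ y, F k y ∂(gaussianReal 0 1) with hYdef
    have hYm : ∀ k, Measurable (Y k) := fun k => (hF k).sub_const _
    have hYb : ∀ k x, |Y k x| ≤ L * (1 + x ^ 2) := by
      intro k x
      have h1 := abs_integral_le_of_quadratic_bound (hb k)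
      have h2 := abs_sub (F k x) (∫ y, F k y ∂(gaussianReal 0 1))
      have h3 := hb k x
      have h4 : 2 * K ≤ 2 * K * (1 + x ^ 2) := by nlinarith [sq_nonneg x, mul_nonneg hK.le (sq_nonneg x)]
      simp only [hYdef, hLdef]; linarith
    have hY0 : ∀ k, ∫ x, Y k x ∂(gaussianReal 0 1) = 0 := by
      intro k
      simp only [hYdef]
      rw [integral_sub (integrable_of_quadratic_bound (hF k) (hb k)) (integrable_const _)]
      simp
    have hsL : |s| * L ≤ 1 / 8 := by
      rw [hs]
      have h1 : s₀ ≤ 1 / (8 * L) := min_le_left _ _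
      calc s₀ * η * L ≤ 1 / (8 * L) * 1 * L := by gcongr
        _ = 1 / 8 := by field_simp
    have hInt := fun k => mgf_le_of_quadratic_bound hL (hYm k) (hYb k) (hY0 k) hsL
    have hInt' : Integrable (fun x : κ → ℝ => ∏ k, Real.exp (s * Y k (x k))) (gaussPi κ) :=
      Integrable.fintype_prod (f := fun k x => Real.exp (s * Y k x)) fun k => (hInt k).1
    have hexp : ∀ x : κ → ℝ, ∏ k, Real.exp (s * Y k (x k)) = Real.exp (s * ∑ k, Y k (x k)) := by
      intro x; rw [← Real.exp_sum, Finset.mul_sum]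
    have hI : ∫ x : κ → ℝ, ∏ k, Real.exp (s * Y k (x k)) ∂(gaussPi κ) ≤ Real.exp (M * (s ^ 2 * B)) := by
      rw [integral_fintype_prod_eq_prod (f := fun k x => Real.exp (s * Y k x))]
      calc _ ≤ ∏ _k : κ, Real.exp (s ^ 2 * B) :=
            Finset.prod_le_prod (fun k _ => integral_nonneg fun x => (Real.exp_pos _).le)
              fun k _ => (hInt k).2
        _ = Real.exp ((Fintype.card κ : ℝ) * (s ^ 2 * B)) := by
            rw [Finset.prod_const, ← Real.exp_nat_mul]; rfl
        _ ≤ _ := by gcongr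
    have hMk := mul_meas_ge_le_integral_of_nonneg (μ := gaussPi κ)
      (ae_of_all _ fun x => Finset.prod_nonneg fun k _ => (Real.exp_pos _).le) hInt'
      (Real.exp (M * η * |s|))
    have hset : {x : κ → ℝ | Real.exp (M * η * |s|) ≤ ∏ k, Real.exp (s * Y k (x k))}
        = {x | M * η * |s| ≤ s * ∑ k, Y k (x k)} := by
      ext x; simp [hexp]
    rw [hset] at hMk
    have h5 : (gaussPi κ).real {x | M * η * |s| ≤ s * ∑ k, Y k (x k)}
        ≤ Real.exp (M * (s ^ 2 * B)) * Real.exp (-(M * η * |s|)) := by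
      rw [Real.exp_neg, ← div_eq_mul_inv, le_div_iff₀ (Real.exp_pos _), mul_comm]
      exact hMk.trans hI
    refine h5.trans ?_
    rw [← Real.exp_add]
    refine Real.exp_le_exp.2 ?_
    have h6 : s ^ 2 = (s₀ * η) ^ 2 := by rw [← sq_abs, hs]
    have h7 : s₀ * B ≤ 1 / 2 := by
      have h1 : s₀ ≤ 1 / (2 * B) := min_le_right _ _
      calc s₀ * B ≤ 1 / (2 * B) * B := by gcongr
        _ = 1 / 2 := by field_simp
    have hM0 : 0 ≤ M := le_trans (Nat.cast_nonneg _) hM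
    rw [h6, hs]
    have h8 : 0 ≤ M * η ^ 2 * s₀ := by positivity
    nlinarith [mul_le_mul_of_nonneg_left h7 h8]
  have hpos : 0 < s₀ * η := by positivity
  have h1 := one (s₀ * η) (abs_of_pos hpos)
  have h2 := one (-(s₀ * η)) (by rw [abs_neg, abs_of_pos hpos])
  set S : (κ → ℝ) → ℝ := fun x => ∑ k, (F k (x k) - ∫ y, F k y ∂(gaussianReal 0 1)) with hS
  have hsub : {x | M * η ≤ |S x|} ⊆ {x | M * η * |s₀ * η| ≤ s₀ * η * S x} ∪
      {x | M * η * |-(s₀ * η)| ≤ -(s₀ * η) * S x} := by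
    intro x hx
    simp only [Set.mem_union, Set.mem_ofPred_eq, abs_neg, abs_of_pos hpos] at hx ⊢
    rcases le_abs.1 hx with h | h
    · left; nlinarith
    · right; nlinarith
  have h3 : (gaussPi κ).real {x | M * η ≤ |S x|} ≤ 2 * Real.exp (-(s₀ / 2) * M * η ^ 2) :=
    (measureReal_mono hsub).trans ((measureReal_union_le _ _).trans (by linarith))
  rw [← ENNReal.ofReal_toReal (measure_ne_top (gaussPi κ) _)]
  exact ENNReal.ofReal_le_ofReal h3

lemma gphi_eq_gaussianPDFReal (x : ℝ) : gphi x = gaussianPDFReal 0 1 x := by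
  simp [gphi, gaussianPDFReal]; field_simp

lemma integral_indicator_Ioi_std (a : ℝ) (f : ℝ → ℝ) :
    ∫ z, (Set.Ioi a).indicator f z ∂(gaussianReal 0 1)
      = ∫ z in Set.Ioi a, gaussianPDFReal 0 1 z * f z := by
  rw [integral_std, ← integral_indicator measurableSet_Ioi]
  refine integral_congr_ae (ae_of_all _ fun z => ?_)
  by_cases hz : z ∈ Set.Ioi a <;> simp [Set.indicator, hz]

lemma integrable_pdf_mul_quadratic (p q r : ℝ) :
    Integrable (fun z : ℝ => gaussianPDFReal 0 1 z * (p * z ^ 2 + q * z + r)) := by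
  rw [← integrable_std_iff]
  exact ((integrable_sq_std.const_mul p).add (integrable_id_std.const_mul q)).add
    (integrable_const r)

/-- Integration by parts on a half-line against the Gaussian density. -/
lemma integral_Ioi_linear_deriv (a q r : ℝ) :
    ∫ z in Set.Ioi a, gaussianPDFReal 0 1 z * (q - z * (q * z + r))
      = -(gaussianPDFReal 0 1 a * (q * a + r)) := by
  have hd : ∀ z, HasDerivAt (fun z => gaussianPDFReal 0 1 z * (q * z + r))
      (gaussianPDFReal 0 1 z * (q - z * (q * z + r))) z := by
    intro z
    refine ((hasDerivAt_gaussianPDFReal_std z).mul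
      (((hasDerivAt_id' z).const_mul q).add_const r)).congr_deriv ?_
    ring
  have i1 : IntegrableOn (fun z => gaussianPDFReal 0 1 z * (q - z * (q * z + r))) (Set.Ioi a) := by
    refine ((integrable_pdf_mul_quadratic (-q) (-r) q).congr (ae_of_all _ fun z => ?_)).integrableOn
    simp only; ring
  have i2 : IntegrableOn (fun z => gaussianPDFReal 0 1 z * (q * z + r)) (Set.Ioi a) := by
    refine ((integrable_pdf_mul_quadratic 0 q r).congr (ae_of_all _ fun z => ?_)).integrableOn
    simp only; ring
  have lim := tendsto_zero_of_hasDerivAt_of_integrableOn_Ioi (a := a)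
    (fun z _ => hd z) i1 i2
  rw [integral_Ioi_of_hasDerivAt_of_tendsto (hd a).continuousAt.continuousWithinAt
    (fun z _ => hd z) i1 lim, zero_sub]

lemma integral_Ioi_pdf (a : ℝ) :
    ∫ z in Set.Ioi a, gaussianPDFReal 0 1 z = (gaussianReal 0 1).real (Set.Ioi a) := by
  rw [← integral_indicator_one measurableSet_Ioi]
  have := integral_indicator_Ioi_std a (fun _ => 1)
  simp only [mul_one] at this
  rw [← this]; rfl

lemma integral_mul_posPart_std (a : ℝ) :
    ∫ z, z * max (z - a) 0 ∂(gaussianReal 0 1) = (gaussianReal 0 1).real (Set.Ioi a) := by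
  have e : ∀ z : ℝ, z * max (z - a) 0 = (Set.Ioi a).indicator (fun z => z * (z - a)) z := by
    intro z
    by_cases hz : a < z
    · simp [Set.indicator, hz, max_eq_left (by linarith : (0:ℝ) ≤ z - a)]
    · simp [Set.indicator, hz, max_eq_right (by linarith : z - a ≤ (0:ℝ))]
  simp_rw [e]
  rw [integral_indicator_Ioi_std]
  have h := integral_Ioi_linear_deriv a 1 (-a)
  have h1 : ∀ z, gaussianPDFReal 0 1 z * (1 - z * (1 * z + -a))
      = gaussianPDFReal 0 1 z - gaussianPDFReal 0 1 z * (z * (z - a)) := fun z => by ring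
  simp_rw [h1] at h
  rw [integral_sub, integral_Ioi_pdf] at h
  · linarith
  · exact (integrable_gaussianPDFReal 0 1).integrableOn
  · refine ((integrable_pdf_mul_quadratic 1 (-a) 0).congr (ae_of_all _ fun z => ?_)).integrableOn
    simp only; ring

lemma gPhi_neg_eq (a : ℝ) : gPhi (-a) = (gaussianReal 0 1).real (Set.Ioi a) := by
  rw [← integral_Ioi_pdf, gPhi, ← integral_comp_neg_Ioi]
  refine setIntegral_congr_fun measurableSet_Ioi fun z _ => ?_
  simp [gphi, gaussianPDFReal]; field_simp

/-- `E (Z - α)₊²`, in closed form. -/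
def tailSq (α : ℝ) : ℝ := (1 + α ^ 2) * gPhi (-α) - α * gphi α

lemma integral_sq_posPart_std (α : ℝ) :
    ∫ z, (max (z - α) 0) ^ 2 ∂(gaussianReal 0 1) = tailSq α := by
  have e : ∀ z : ℝ, (max (z - α) 0) ^ 2 = (Set.Ioi α).indicator (fun z => (z - α) ^ 2) z := by
    intro z
    by_cases hz : α < z
    · simp [Set.indicator, hz, max_eq_left (by linarith : (0:ℝ) ≤ z - α)]
    · simp [Set.indicator, hz, max_eq_right (by linarith : z - α ≤ (0:ℝ))]
  simp_rw [e]
  rw [integral_indicator_Ioi_std]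
  have h := integral_Ioi_linear_deriv α 1 (-(2 * α))
  have h1 : ∀ z, gaussianPDFReal 0 1 z * (1 - z * (1 * z + -(2 * α)))
      = (1 + α ^ 2) * gaussianPDFReal 0 1 z - gaussianPDFReal 0 1 z * (z - α) ^ 2 := fun z => by ring
  simp_rw [h1] at h
  rw [integral_sub, integral_const_mul, integral_Ioi_pdf] at h
  · rw [tailSq, gPhi_neg_eq, gphi_eq_gaussianPDFReal]
    linarith
  · exact ((integrable_gaussianPDFReal 0 1).const_mul _).integrableOn
  · refine ((integrable_pdf_mul_quadratic 1 (-(2 * α)) (α ^ 2)).congr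
      (ae_of_all _ fun z => ?_)).integrableOn
    simp only; ring

lemma integral_comp_neg_std (f : ℝ → ℝ) :
    ∫ z, f (-z) ∂(gaussianReal 0 1) = ∫ z, f z ∂(gaussianReal 0 1) := by
  rw [integral_std, integral_std, ← integral_neg_eq_self (fun z => gaussianPDFReal 0 1 z * f z)]
  refine integral_congr_ae (ae_of_all _ fun z => ?_)
  simp [gaussianPDFReal]

lemma abs_posPart_sub_le (z α : ℝ) (hα : 0 ≤ α) : 0 ≤ max (z - α) 0 ∧ max (z - α) 0 ≤ |z| :=
  ⟨le_max_right _ _, max_le (by linarith [le_abs_self z]) (abs_nonneg _)⟩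

lemma integral_sq_abs_sub (α : ℝ) (hα : 0 ≤ α) :
    ∫ z, (max (|z| - α) 0) ^ 2 ∂(gaussianReal 0 1) = 2 * tailSq α := by
  have e : ∀ z : ℝ, (max (|z| - α) 0) ^ 2 = (max (z - α) 0) ^ 2 + (max (-z - α) 0) ^ 2 := by
    intro z
    rcases le_total 0 z with hz | hz
    · rw [abs_of_nonneg hz, max_eq_right (by linarith : -z - α ≤ 0)]; simp
    · rw [abs_of_nonpos hz, max_eq_right (by linarith : z - α ≤ 0)]; simp
  have i1 : Integrable (fun z : ℝ => (max (z - α) 0) ^ 2) (gaussianReal 0 1) := by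
    refine integrable_sq_std.mono' (by fun_prop) (ae_of_all _ fun z => ?_)
    have := abs_posPart_sub_le z α hα
    rw [Real.norm_eq_abs, abs_of_nonneg (sq_nonneg _), ← sq_abs z]
    exact pow_le_pow_left₀ this.1 this.2 2
  have i2 : Integrable (fun z : ℝ => (max (-z - α) 0) ^ 2) (gaussianReal 0 1) := by
    refine integrable_sq_std.mono' (by fun_prop) (ae_of_all _ fun z => ?_)
    have := abs_posPart_sub_le (-z) α hα
    rw [Real.norm_eq_abs, abs_of_nonneg (sq_nonneg _), ← sq_abs z, ← abs_neg z]
    exact pow_le_pow_left₀ this.1 this.2 2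
  simp_rw [e]
  rw [integral_add i1 i2, integral_comp_neg_std (fun z => (max (z - α) 0) ^ 2),
    integral_sq_posPart_std, two_mul]

lemma tailSq_nonneg (α : ℝ) : 0 ≤ tailSq α := by
  rw [← integral_sq_posPart_std]; exact integral_nonneg fun z => sq_nonneg _

lemma two_mul_tailSq_le_one (α : ℝ) (hα : 0 ≤ α) : 2 * tailSq α ≤ 1 := by
  rw [← integral_sq_abs_sub α hα, ← integral_sq_std]
  refine integral_mono_of_nonneg (ae_of_all _ fun z => sq_nonneg _) integrable_sq_std
    (ae_of_all _ fun z => ?_)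
  simp only
  rw [← sq_abs z]
  exact pow_le_pow_left₀ (le_max_right _ _) (max_le (by linarith) (abs_nonneg _)) 2

lemma tendsto_tailSq : Filter.Tendsto tailSq Filter.atTop (nhds 0) := by
  have e : tailSq = fun α => ∫ z, (max (z - α) 0) ^ 2 ∂(gaussianReal 0 1) :=
    funext fun α => (integral_sq_posPart_std α).symm
  rw [e]
  suffices H : Filter.Tendsto (fun α : ℝ => ∫ z, (max (z - α) 0) ^ 2 ∂(gaussianReal 0 1))
      Filter.atTop (nhds (∫ _z : ℝ, (0 : ℝ) ∂(gaussianReal 0 1))) by simpa using H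
  refine tendsto_integral_filter_of_dominated_convergence (fun z => z ^ 2) ?_ ?_
    integrable_sq_std ?_
  · exact Filter.Eventually.of_forall fun α => by fun_prop
  · filter_upwards [Filter.eventually_ge_atTop 0] with α hα
    refine ae_of_all _ fun z => ?_
    have := abs_posPart_sub_le z α hα
    rw [Real.norm_eq_abs, abs_of_nonneg (sq_nonneg _), ← sq_abs z]
    exact pow_le_pow_left₀ this.1 this.2 2
  · refine ae_of_all _ fun z => ?_
    refine tendsto_const_nhds.congr' ?_
    filter_upwards [Filter.eventually_ge_atTop z] with α hα
    rw [max_eq_right (by linarith)]; simp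

lemma eta_eq_sub {b : ℝ} (hb : 0 ≤ b) (x : ℝ) : eta x b = max (x - b) 0 - max (-x - b) 0 := by
  rw [eta]
  rcases lt_trichotomy x 0 with h | h | h
  · rw [Real.sign_of_neg h, abs_of_neg h, max_eq_right (by linarith : x - b ≤ 0)]; ring
  · subst h; simp [hb]
  · rw [Real.sign_of_pos h, abs_of_pos h, max_eq_right (by linarith : -x - b ≤ 0)]; ring

/-- Soft thresholding is the proximal map of `b * |·|`. -/
lemma eta_prox {b : ℝ} (hb : 0 ≤ b) (x y : ℝ) :
    (x - eta x b) * (y - eta x b) ≤ b * (|y| - |eta x b|) := by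
  rw [eta_eq_sub hb]
  rcases le_or_gt x (-b) with h | h
  · rw [max_eq_right (by linarith : x - b ≤ 0), max_eq_left (by linarith : 0 ≤ -x - b),
      abs_of_nonpos (by linarith : 0 - (-x - b) ≤ 0)]
    nlinarith [neg_abs_le y]
  · rcases le_or_gt x b with h' | h'
    · rw [max_eq_right (by linarith : x - b ≤ 0), max_eq_right (by linarith : -x - b ≤ 0)]
      simp only [sub_zero, abs_zero]
      calc x * y ≤ |x * y| := le_abs_self _
        _ = |x| * |y| := abs_mul _ _
        _ ≤ b * |y| := mul_le_mul_of_nonneg_right (abs_le.2 ⟨h.le, h'⟩) (abs_nonneg _)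
    · rw [max_eq_left (by linarith : 0 ≤ x - b), max_eq_right (by linarith : -x - b ≤ 0),
        abs_of_nonneg (by linarith : 0 ≤ x - b - 0)]
      nlinarith [le_abs_self y]

lemma continuous_eta_left {b : ℝ} (hb : 0 ≤ b) : Continuous fun x => eta x b := by
  have : (fun x => eta x b) = fun x => max (x - b) 0 - max (-x - b) 0 := funext (eta_eq_sub hb)
  rw [this]; fun_prop

lemma abs_eta_sub_le {b : ℝ} (hb : 0 ≤ b) (θ τ z : ℝ) (hτ : 0 ≤ τ) :
    |eta (θ + τ * z) b - θ| ≤ τ * |z| + b := by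
  have h1 : |eta (θ + τ * z) b - (θ + τ * z)| ≤ b := by
    rw [eta_eq_sub hb, abs_le]
    rcases max_cases (θ + τ * z - b) 0 with ⟨h1, h2⟩ | ⟨h1, h2⟩ <;>
    rcases max_cases (-(θ + τ * z) - b) 0 with ⟨h3, h4⟩ | ⟨h3, h4⟩ <;>
    rw [h1, h3] <;> constructor <;> linarith
  have h2 : |τ * z| = τ * |z| := by rw [abs_mul, abs_of_nonneg hτ]
  calc |eta (θ + τ * z) b - θ| = |(eta (θ + τ * z) b - (θ + τ * z)) + τ * z| := by congr 1; ring
    _ ≤ b + τ * |z| := (abs_add_le _ _).trans (by rw [h2]; linarith)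
    _ = _ := add_comm _ _

/-- Stein's identity for soft thresholding. -/
lemma integral_mul_eta {b : ℝ} (hb : 0 < b) (θ τ : ℝ) (hτ : 0 < τ) :
    ∫ z, z * (eta (θ + τ * z) b - θ) ∂(gaussianReal 0 1)
      = τ * (gaussianReal 0 1).real {z | b < |θ + τ * z|} := by
  set a := (b - θ) / τ with ha
  set a' := (b + θ) / τ with ha'
  have hta : τ * a = b - θ := by rw [ha]; field_simp
  have hta' : τ * a' = b + θ := by rw [ha']; field_simp
  have i0 : ∀ a : ℝ, Integrable (fun z : ℝ => z * max (z - a) 0) (gaussianReal 0 1) := by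
    intro a
    refine integrable_of_quadratic_bound (K := 1 + |a|) (by fun_prop) fun z => ?_
    have h1 : |max (z - a) 0| ≤ |z| + |a| := by
      rw [abs_of_nonneg (le_max_right _ _)]
      exact max_le (by linarith [le_abs_self z, neg_abs_le a]) (by positivity)
    rw [abs_mul]
    calc |z| * |max (z - a) 0| ≤ |z| * (|z| + |a|) := by gcongr
      _ ≤ _ := by
        rw [← sq_abs z]
        nlinarith [abs_nonneg z, abs_nonneg a, sq_nonneg (|z| - 1),
          mul_nonneg (abs_nonneg a) (sq_nonneg (|z| - 1)),
          mul_nonneg (abs_nonneg a) (abs_nonneg z), mul_nonneg (abs_nonneg a) (sq_nonneg |z|)]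
  have i1 : Integrable (fun z : ℝ => -z * max (-z - a') 0) (gaussianReal 0 1) := by
    refine integrable_of_quadratic_bound (K := 1 + |a'|) (by fun_prop) fun z => ?_
    have h1 : |max (-z - a') 0| ≤ |z| + |a'| := by
      rw [abs_of_nonneg (le_max_right _ _)]
      exact max_le (by linarith [neg_abs_le z, neg_abs_le a']) (by positivity)
    rw [abs_mul, abs_neg]
    calc |z| * |max (-z - a') 0| ≤ |z| * (|z| + |a'|) := by gcongr
      _ ≤ _ := by
        rw [← sq_abs z]
        nlinarith [abs_nonneg z, abs_nonneg a', sq_nonneg (|z| - 1),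
          mul_nonneg (abs_nonneg a') (sq_nonneg (|z| - 1)),
          mul_nonneg (abs_nonneg a') (abs_nonneg z), mul_nonneg (abs_nonneg a') (sq_nonneg |z|)]
  have e : ∀ z : ℝ, z * (eta (θ + τ * z) b - θ)
      = (τ * (z * max (z - a) 0) + τ * (-z * max (-z - a') 0)) - θ * z := by
    intro z
    have h1 : max (θ + τ * z - b) 0 = τ * max (z - a) 0 := by
      rw [mul_max_of_nonneg _ _ hτ.le, mul_sub, hta, mul_zero]; congr 1; ring
    have h2 : max (-(θ + τ * z) - b) 0 = τ * max (-z - a') 0 := by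
      rw [mul_max_of_nonneg _ _ hτ.le, mul_sub, hta', mul_zero]; congr 1; ring
    rw [eta_eq_sub hb.le, h1, h2]; ring
  simp_rw [e]
  have i2 : Integrable (fun z : ℝ => τ * (z * max (z - a) 0) + τ * (-z * max (-z - a') 0))
      (gaussianReal 0 1) := ((i0 a).const_mul τ).add (i1.const_mul τ)
  rw [integral_sub i2 (integrable_id_std.const_mul θ),
    integral_add ((i0 a).const_mul τ) (i1.const_mul τ), integral_const_mul, integral_const_mul,
    integral_const_mul, integral_mul_posPart_std,
    integral_comp_neg_std (fun z => z * max (z - a') 0), integral_mul_posPart_std]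
  have hid : ∫ x : ℝ, x ∂(gaussianReal 0 1) = 0 := by
    simp
  have hsym : (gaussianReal 0 1).real (Set.Ioi a') = (gaussianReal 0 1).real (Set.Iio (-a')) := by
    rw [← integral_indicator_one measurableSet_Ioi, ← integral_indicator_one measurableSet_Iio,
      ← integral_comp_neg_std]
    refine integral_congr_ae (ae_of_all _ fun z => ?_)
    simp [Set.indicator, lt_neg]
  have hset : {z | b < |θ + τ * z|} = Set.Ioi a ∪ Set.Iio (-a') := by
    ext z
    have k1 : a < z ↔ b < θ + τ * z := by rw [← mul_lt_mul_iff_right₀ hτ, hta]; constructor <;> intro h <;> linarith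
    have k2 : z < -a' ↔ b < -(θ + τ * z) := by
      rw [← mul_lt_mul_iff_right₀ hτ, mul_neg, hta']; constructor <;> intro h <;> linarith
    simp only [Set.mem_ofPred_eq, Set.mem_union, Set.mem_Ioi, Set.mem_Iio, k1, k2, lt_abs]
  have hdisj : Disjoint (Set.Ioi a) (Set.Iio (-a')) := by
    rw [Set.disjoint_left]
    intro z h1 h2
    have h3 : τ * a < τ * (-a') := mul_lt_mul_of_pos_left (lt_trans h1 h2) hτ
    rw [mul_neg, hta, hta'] at h3; linarith
  rw [hset, measureReal_union hdisj measurableSet_Iio, hid, hsym]; ring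

lemma integral_empDist_prod {N : ℕ} (θ : Fin N → ℝ) {f : ℝ × ℝ → ℝ} (hf : Measurable f)
    (hi : ∀ t, Integrable (fun z => f (t, z)) (gaussianReal 0 1)) :
    ∫ q, f q ∂((empDist θ).prod stdG)
      = (1 / (N : ℝ)) * ∑ i, ∫ z, f (θ i, z) ∂(gaussianReal 0 1) := by
  have hfin : IsFiniteMeasure (empDist θ) := by
    rcases Nat.eq_zero_or_pos N with h | h
    · subst h
      constructor; simp [empDist]
    · constructor
      have : ((N : ℝ≥0∞)) ≠ 0 := by exact_mod_cast h.ne'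
      simp [empDist, ENNReal.mul_lt_top, this, ENNReal.inv_lt_top, pos_iff_ne_zero]
  have hN : IsProbabilityMeasure stdG := inferInstanceAs (IsProbabilityMeasure (gaussianReal 0 1))
  have hI : ∀ g : ℝ → ℝ, Integrable g (∑ i : Fin N, Measure.dirac (θ i)) := by
    intro g
    rw [integrable_finsetSum_measure]
    intro i _
    exact integrable_dirac (by simp)
  have hInt : Integrable f ((empDist θ).prod stdG) := by
    rw [integrable_prod_iff hf.aestronglyMeasurable]
    refine ⟨ae_of_all _ hi, ?_⟩
    rw [empDist]
    rcases Nat.eq_zero_or_pos N with h | h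
    · subst h; simp
    · exact (hI _).smul_measure (by simpa using h.ne')
  rw [integral_prod _ hInt, empDist, integral_smul_measure, integral_finsetSum_measure
    (fun i _ => integrable_dirac (by simp))]
  simp [stdG]

/-- The properties of a solution of the fixed point equations used in the comparison argument:
`w i` is the error of the scalar estimator for the `i`-th coordinate. -/
structure FixedPoint {N : ℕ} (n : ℕ) (σ : ℝ) (θ : Fin N → ℝ) (lam β τ : ℝ)
    (w : Fin N → ℝ → ℝ) : Prop where
  β_pos : 0 < β
  τ_pos : 0 < τ
  meas : ∀ i, Measurable (w i)
  growth : ∀ i z, |w i z| ≤ τ * |z| + τ * lam / β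
  var : (1 / (n : ℝ)) * ∑ i, ∫ z, (w i z) ^ 2 ∂(gaussianReal 0 1) = τ ^ 2 - σ ^ 2
  cov : (1 / (n : ℝ)) * ∑ i, ∫ z, z * w i z ∂(gaussianReal 0 1) = τ - β
  sub : ∀ i z y, β / τ * ((τ * z - w i z) * (y - w i z)) ≤ lam * (|y + θ i| - |w i z + θ i|)
  act : τ - β = τ * ((1 / (n : ℝ)) *
    ∑ i, (gaussianReal 0 1).real {z | τ * lam / β < |θ i + τ * z|})

lemma StateEvo.fixedPoint {N n : ℕ} {δ σ : ℝ} {θ : Fin N → ℝ} {lam β τ : ℝ}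
    (hδ : 0 < δ) (hn : (n : ℝ) = δ * N) (hlam : 0 < lam)
    (h : StateEvo δ σ (empDist θ) lam β τ) :
    FixedPoint n σ θ lam β τ (fun i z => eta (θ i + τ * z) (τ * lam / β) - θ i) := by
  obtain ⟨hβ, hτ, h1, h2⟩ := h
  set b := τ * lam / β with hb
  have hb0 : 0 < b := by positivity
  have hc := continuous_eta_left hb0.le
  have gr : ∀ (t z : ℝ), |eta (t + τ * z) b - t| ≤ τ * |z| + b := fun t z =>
    abs_eta_sub_le hb0.le t τ z hτ.le
  have n1 : (1 / δ) * (1 / (N : ℝ)) = 1 / (n : ℝ) := by rw [hn]; field_simp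
  rw [integral_empDist_prod θ (by have := hc.measurable; fun_prop) ?_] at h1
  swap
  · intro t
    refine integrable_of_quadratic_bound (K := 2 * τ ^ 2 + 2 * b ^ 2)
      (by have := hc.measurable; fun_prop) fun z => ?_
    simp only
    rw [abs_of_nonneg (sq_nonneg _), ← sq_abs (eta _ _ - _), ← sq_abs z]
    refine (pow_le_pow_left₀ (abs_nonneg _) (gr t z) 2).trans ?_
    nlinarith [sq_nonneg (τ * |z| - b), sq_nonneg (b * |z|), sq_nonneg τ]
  have hm : Measurable fun q : ℝ × ℝ => eta' (q.1 + τ * q.2) b := by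
    unfold eta'
    exact Measurable.ite (measurableSet_lt measurable_const (by fun_prop)) measurable_const
      measurable_const
  rw [integral_empDist_prod θ hm ?_] at h2
  swap
  · intro t
    refine Integrable.of_bound (C := 1) (hm.comp (by fun_prop)).aestronglyMeasurable
      (ae_of_all _ fun z => ?_)
    unfold eta'; split_ifs <;> simp
  have act : ∀ t : ℝ, ∫ z, eta' (t + τ * z) b ∂(gaussianReal 0 1)
      = (gaussianReal 0 1).real {z | b < |t + τ * z|} := by
    intro t
    rw [← integral_indicator_one (measurableSet_lt measurable_const (by fun_prop))]
    refine integral_congr_ae (ae_of_all _ fun z => ?_)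
    simp [eta', Set.indicator]
  simp only [act] at h2
  rw [← mul_assoc, n1] at h1 h2
  refine ⟨hβ, hτ, fun i => by have := hc.measurable; fun_prop, fun i z => gr _ _, ?_, ?_, ?_, ?_⟩
  · simp only at h1; linarith
  · simp_rw [integral_mul_eta hb0 _ τ hτ]
    rw [← Finset.mul_sum]
    linear_combination (1 : ℝ) * h2
  · intro i z y
    have := eta_prox hb0.le (θ i + τ * z) (y + θ i)
    have h3 : lam = β / τ * b := by rw [hb]; field_simp
    calc _ = β / τ * ((θ i + τ * z - eta (θ i + τ * z) b) * (y + θ i - eta (θ i + τ * z) b)) := by ring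
      _ ≤ β / τ * (b * (|y + θ i| - |eta (θ i + τ * z) b|)) := by gcongr
      _ = _ := by rw [h3]; simp; ring
  · linear_combination (-1 : ℝ) * h2

/-- Measurable functions of at most linear growth. -/
def LinGrowth (f : ℝ → ℝ) : Prop := Measurable f ∧ ∃ K, 0 ≤ K ∧ ∀ z, |f z| ≤ K * (1 + |z|)

lemma LinGrowth.const (c : ℝ) : LinGrowth fun _ => c :=
  ⟨measurable_const, |c|, abs_nonneg _, fun z => by
    nlinarith [mul_nonneg (abs_nonneg c) (abs_nonneg z)]⟩

lemma LinGrowth.id : LinGrowth fun z => z :=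
  ⟨measurable_id, 1, zero_le_one, fun z => by linarith⟩

lemma LinGrowth.add {f g : ℝ → ℝ} (hf : LinGrowth f) (hg : LinGrowth g) :
    LinGrowth fun z => f z + g z := by
  obtain ⟨mf, K, hK, bf⟩ := hf
  obtain ⟨mg, L, hL, bg⟩ := hg
  exact ⟨mf.add mg, K + L, by positivity, fun z => (abs_add_le _ _).trans (by
    linarith [bf z, bg z])⟩

lemma LinGrowth.const_mul {f : ℝ → ℝ} (c : ℝ) (hf : LinGrowth f) : LinGrowth fun z => c * f z := by
  obtain ⟨mf, K, hK, bf⟩ := hf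
  refine ⟨mf.const_mul c, |c| * K, by positivity, fun z => ?_⟩
  rw [abs_mul, mul_assoc]
  exact mul_le_mul_of_nonneg_left (bf z) (abs_nonneg c)

lemma LinGrowth.abs {f : ℝ → ℝ} (hf : LinGrowth f) : LinGrowth fun z => |f z| := by
  obtain ⟨mf, K, hK, bf⟩ := hf
  exact ⟨by simpa using mf.abs, K, hK, fun z => by rw [abs_abs]; exact bf z⟩

lemma LinGrowth.sub {f g : ℝ → ℝ} (hf : LinGrowth f) (hg : LinGrowth g) :
    LinGrowth fun z => f z - g z := by
  have := hf.add (hg.const_mul (-1))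
  simpa [sub_eq_add_neg] using this

lemma LinGrowth.posPart {f : ℝ → ℝ} (hf : LinGrowth f) : LinGrowth fun z => max (f z) 0 := by
  obtain ⟨mf, K, hK, bf⟩ := hf
  refine ⟨mf.max measurable_const, K, hK, fun z => ?_⟩
  rw [abs_of_nonneg (le_max_right _ _)]
  exact max_le ((le_abs_self _).trans (bf z)) (by positivity)

lemma LinGrowth.exists_mul_bound {f g : ℝ → ℝ} (hf : LinGrowth f) (hg : LinGrowth g) :
    ∃ K, ∀ z, |f z * g z| ≤ K * (1 + z ^ 2) := by
  obtain ⟨mf, K, hK, bf⟩ := hf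
  obtain ⟨mg, L, hL, bg⟩ := hg
  refine ⟨2 * (K * L), fun z => ?_⟩
  rw [abs_mul]
  calc |f z| * |g z| ≤ (K * (1 + |z|)) * (L * (1 + |z|)) := by gcongr <;> [exact bf z; exact bg z]
    _ = (K * L) * (1 + |z|) ^ 2 := by ring
    _ ≤ (K * L) * (2 * (1 + |z| ^ 2)) := by gcongr; nlinarith [sq_nonneg (|z| - 1)]
    _ = _ := by rw [sq_abs]; ring

lemma LinGrowth.integrable_mul {f g : ℝ → ℝ} (hf : LinGrowth f) (hg : LinGrowth g) :
    Integrable (fun z => f z * g z) (gaussianReal 0 1) := by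
  obtain ⟨K, hK⟩ := hf.exists_mul_bound hg
  exact integrable_of_quadratic_bound (hf.1.mul hg.1) hK

lemma LinGrowth.integrable_sq {f : ℝ → ℝ} (hf : LinGrowth f) :
    Integrable (fun z => f z ^ 2) (gaussianReal 0 1) := by
  simpa [sq] using hf.integrable_mul hf

lemma LinGrowth.integrable {f : ℝ → ℝ} (hf : LinGrowth f) : Integrable f (gaussianReal 0 1) := by
  simpa using hf.integrable_mul (LinGrowth.const 1)

/-- The sum over coordinates of Gaussian expectations, normalized by `n`. -/
def gavg {N : ℕ} (n : ℕ) (f : Fin N → ℝ → ℝ) : ℝ :=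
  (1 / (n : ℝ)) * ∑ i, ∫ z, f i z ∂(gaussianReal 0 1)

lemma sum_mul_gavg_le {N n m : ℕ} (c : Fin m → ℝ) (f : Fin m → Fin N → ℝ → ℝ)
    (hf : ∀ k i, Integrable (f k i) (gaussianReal 0 1)) (b : Fin N → ℝ)
    (h : ∀ i z, ∑ k, c k * f k i z ≤ b i) :
    ∑ k, c k * gavg n (f k) ≤ (1 / (n : ℝ)) * ∑ i, b i := by
  have e : ∑ k, c k * gavg n (f k)
      = (1 / (n : ℝ)) * ∑ i, ∫ z, ∑ k, c k * f k i z ∂(gaussianReal 0 1) := by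
    have : ∀ i, ∫ z, ∑ k, c k * f k i z ∂(gaussianReal 0 1)
        = ∑ k, c k * ∫ z, f k i z ∂(gaussianReal 0 1) := by
      intro i
      rw [integral_finsetSum _ fun k _ => (hf k i).const_mul _]
      simp_rw [integral_const_mul]
    simp_rw [this]
    rw [Finset.sum_comm, Finset.mul_sum]
    refine Finset.sum_congr rfl fun k _ => ?_
    rw [gavg, ← Finset.mul_sum]; ring
  rw [e]
  refine mul_le_mul_of_nonneg_left (Finset.sum_le_sum fun i _ => ?_) (by positivity)
  calc ∫ z, ∑ k, c k * f k i z ∂(gaussianReal 0 1) ≤ ∫ _, b i ∂(gaussianReal 0 1) :=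
        integral_mono (integrable_finsetSum _ fun k _ => (hf k i).const_mul _)
          (integrable_const _) (h i)
    _ = b i := by simp

section FixedPoint
variable {N n : ℕ} {σ : ℝ} {θ : Fin N → ℝ} {lam β τ : ℝ} {w : Fin N → ℝ → ℝ}

namespace FixedPoint

lemma linGrowth (h : FixedPoint n σ θ lam β τ w) (hlam : 0 < lam) (i : Fin N) :
    LinGrowth (w i) := by
  have := h.τ_pos
  have := h.β_pos
  refine ⟨h.meas i, τ + τ * lam / β, by positivity, fun z => (h.growth i z).trans ?_⟩
  have : 0 ≤ τ * lam / β := by positivity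
  nlinarith [abs_nonneg z, mul_nonneg this (abs_nonneg z)]

lemma linGrowth_pen (h : FixedPoint n σ θ lam β τ w) (hlam : 0 < lam) (i : Fin N) :
    LinGrowth fun z => |w i z + θ i| - |θ i| :=
  (((h.linGrowth hlam i).add (LinGrowth.const _)).abs).sub (LinGrowth.const _)

lemma gavg_sq (h : FixedPoint n σ θ lam β τ w) : gavg n (fun i z => w i z ^ 2) = τ ^ 2 - σ ^ 2 :=
  h.var

lemma gavg_mul (h : FixedPoint n σ θ lam β τ w) : gavg n (fun i z => z * w i z) = τ - β := h.cov

lemma beta_le_tau (h : FixedPoint n σ θ lam β τ w) : β ≤ τ := by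
  have h1 := h.act
  have h2 : 0 ≤ τ * ((1 / (n : ℝ)) *
    ∑ i, (gaussianReal 0 1).real {z | τ * lam / β < |θ i + τ * z|}) := by
    have := h.τ_pos
    positivity
  linarith

lemma sigma_le_tau (h : FixedPoint n σ θ lam β τ w) : σ ≤ τ := by
  have h2 : 0 ≤ gavg n (fun i z => w i z ^ 2) := by
    rw [gavg]
    exact mul_nonneg (by positivity) (Finset.sum_nonneg fun i _ => integral_nonneg fun z => sq_nonneg _)
  rw [h.gavg_sq] at h2
  have := h.τ_pos
  nlinarith

/-- The expected normalized `ℓ₁` penalty. -/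
lemma lam_mul_pen_le (h : FixedPoint n σ θ lam β τ w) (hlam : 0 < lam) :
    lam * gavg n (fun i z => |w i z + θ i| - |θ i|) ≤ β * σ ^ 2 / τ - β ^ 2 := by
  have hτ := h.τ_pos
  have key := sum_mul_gavg_le (n := n) ![lam, -β, β / τ]
    ![fun i z => |w i z + θ i| - |θ i|, fun i z => z * w i z, fun i z => w i z ^ 2] (by
      intro k i
      fin_cases k
      · exact (h.linGrowth_pen hlam i).integrable
      · exact LinGrowth.id.integrable_mul (h.linGrowth hlam i)
      · exact (h.linGrowth hlam i).integrable_sq) (fun _ => 0) (by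
      intro i z
      have := h.sub i z 0
      simp only [Fin.sum_univ_three, Matrix.cons_val]
      have e : β / τ * ((τ * z - w i z) * (0 - w i z)) = -β * (z * w i z) + β / τ * w i z ^ 2 := by
        field_simp; ring
      rw [e, zero_add] at this
      linarith)
  simp only [Fin.sum_univ_three, Matrix.cons_val, h.gavg_mul, h.gavg_sq, Finset.sum_const_zero,
    mul_zero] at key
  have e : -β * (τ - β) + β / τ * (τ ^ 2 - σ ^ 2) = -(β * σ ^ 2 / τ - β ^ 2) := by
    field_simp; ring
  linarith

lemma pen_ge (h : FixedPoint n σ θ lam β τ w) (hlam : 0 < lam) {δ : ℝ} (hδ : 0 < δ) (hN : 0 < N)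
    (hn : (n : ℝ) = δ * N) :
    -(τ * (1 + 1 / δ) / 2) ≤ gavg n (fun i z => |w i z + θ i| - |θ i|) := by
  have hτ := h.τ_pos
  have hN' : (0 : ℝ) < N := by exact_mod_cast hN
  have key := sum_mul_gavg_le (n := n) ![-1, -(1 / (2 * τ))]
    ![fun i z => |w i z + θ i| - |θ i|, fun i z => w i z ^ 2] (by
      intro k i
      fin_cases k
      · exact (h.linGrowth_pen hlam i).integrable
      · exact (h.linGrowth hlam i).integrable_sq) (fun _ => τ / 2) (by
      intro i z
      simp only [Fin.sum_univ_two, Matrix.cons_val]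
      have h1 : |θ i| ≤ |w i z + θ i| + |w i z| := by
        calc |θ i| = |(w i z + θ i) - w i z| := by congr 1; ring
          _ ≤ _ := abs_sub _ _
      have h2 : |w i z| ≤ τ / 2 + 1 / (2 * τ) * w i z ^ 2 := by
        have : τ / 2 + 1 / (2 * τ) * w i z ^ 2 - |w i z| = (τ - |w i z|) ^ 2 / (2 * τ) := by
          rw [← sq_abs (w i z)]; field_simp; ring
        have : 0 ≤ (τ - |w i z|) ^ 2 / (2 * τ) := by positivity
        linarith
      linarith)
  simp only [Fin.sum_univ_two, Matrix.cons_val, h.gavg_sq, Finset.sum_const, Finset.card_univ,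
    Fintype.card_fin, nsmul_eq_mul, hn] at key
  have e1 : 1 / (δ * N) * (N * (τ / 2)) = τ / δ / 2 := by field_simp
  have e2 : 1 / (2 * τ) * (τ ^ 2 - σ ^ 2) ≤ τ / 2 := by
    rw [div_mul_eq_mul_div, div_le_div_iff₀ (by positivity) (by positivity)]
    nlinarith [sq_nonneg σ]
  rw [e1] at key
  have e3 : τ * (1 + 1 / δ) / 2 = τ / 2 + τ / δ / 2 := by field_simp
  linarith

end FixedPoint
end FixedPoint

/-- At most a fraction `s` of the coordinates exceeds `t` in absolute value. -/
def EffectivelySparse {N : ℕ} (t s : ℝ) (θ : Fin N → ℝ) : Prop :=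
  ((Finset.univ.filter fun i => t < |θ i|).card : ℝ) ≤ s * N

lemma EffectivelySparse.sum_ite_le {N : ℕ} {t s : ℝ} {θ : Fin N → ℝ}
    (h : EffectivelySparse t s θ) {a b : ℝ} (hab : b ≤ a) :
    ∑ i, (if t < |θ i| then a else b) ≤ (s * a + (1 - s) * b) * N := by
  have e : ∀ i, (if t < |θ i| then a else b) = b + (if t < |θ i| then 1 else 0) * (a - b) := by
    intro i; split_ifs <;> ring
  simp_rw [e]
  rw [Finset.sum_add_distrib, ← Finset.sum_mul, Finset.sum_boole]
  simp only [Finset.sum_const, Finset.card_univ, Fintype.card_fin, nsmul_eq_mul]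
  have := mul_le_mul_of_nonneg_right h (sub_nonneg.2 hab)
  linarith

lemma integral_sq_sub_std (a : ℝ) : ∫ z, (z - a) ^ 2 ∂(gaussianReal 0 1) = 1 + a ^ 2 := by
  have hid : ∫ x : ℝ, x ∂(gaussianReal 0 1) = 0 := by
    simp
  have e : ∀ z : ℝ, (z - a) ^ 2 = (z ^ 2 + (-2 * a) * z) + a ^ 2 := fun z => by ring
  simp_rw [e]
  have i1 : Integrable (fun z : ℝ => z ^ 2 + (-2 * a) * z) (gaussianReal 0 1) :=
    integrable_sq_std.add (integrable_id_std.const_mul _)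
  rw [integral_add i1 (integrable_const _),
    integral_add integrable_sq_std (integrable_id_std.const_mul _), integral_const_mul, hid,
    integral_sq_std]
  simp

lemma measureReal_abs_gt_le {a : ℝ} (ha : 0 < a) :
    (gaussianReal 0 1).real {z | a < |z|} ≤ 1 / a ^ 2 := by
  have h := mul_meas_ge_le_integral_of_nonneg (μ := gaussianReal 0 1) (f := fun z : ℝ => z ^ 2)
    (ae_of_all _ fun z => sq_nonneg z) integrable_sq_std (a ^ 2)
  rw [integral_sq_std] at h
  have h2 : (gaussianReal 0 1).real {z | a < |z|} ≤ (gaussianReal 0 1).real {z | a ^ 2 ≤ z ^ 2} := by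
    refine measureReal_mono fun z hz => ?_
    simp only [Set.mem_ofPred_eq] at hz ⊢
    rw [← sq_abs z]
    exact pow_le_pow_left₀ ha.le hz.le 2
  rw [le_div_iff₀ (by positivity)]
  nlinarith [sq_pos_of_pos ha]

section
variable {N n : ℕ} {σ : ℝ} {θ : Fin N → ℝ} {lam β τ : ℝ} {w : Fin N → ℝ → ℝ}

namespace FixedPoint

lemma tau_sub_beta_le (h : FixedPoint n σ θ lam β τ w) (hlam : 0 < lam) {δ : ℝ} (hδ : 0 < δ)
    (hN : 0 < N) (hn : (n : ℝ) = δ * N) {t s α : ℝ} (ht : 0 ≤ t) (hα : 0 ≤ α)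
    (hs : EffectivelySparse t s θ) :
    τ - β ≤ α * gavg n (fun i z => |w i z + θ i| - |θ i|) + 2 * α * t / δ
      + τ * (1 + (s * (1 + α ^ 2) + (1 - s) * (2 * tailSq α)) / δ) / 2 := by
  have hτ := h.τ_pos
  have hN' : (0 : ℝ) < N := by exact_mod_cast hN
  let d : Fin N → ℝ → ℝ := fun i z => if t < |θ i| then (if 0 < θ i then z - α else z - -α)
    else max (|z| - α) 0
  have hd : ∀ i, LinGrowth (d i) := by
    intro i
    simp only [d]
    split_ifs
    · exact LinGrowth.id.sub (LinGrowth.const _)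
    · exact LinGrowth.id.sub (LinGrowth.const _)
    · exact (LinGrowth.id.abs.sub (LinGrowth.const _)).posPart
  have hE : ∀ i, ∫ z, d i z ^ 2 ∂(gaussianReal 0 1)
      = if t < |θ i| then 1 + α ^ 2 else 2 * tailSq α := by
    intro i
    simp only [d]
    split_ifs
    · exact integral_sq_sub_std _
    · rw [integral_sq_sub_std]; ring
    · exact integral_sq_abs_sub α hα
  have key := sum_mul_gavg_le (n := n) ![1, -α, -(1 / (2 * τ)), -(τ / 2)]
    ![fun i z => z * w i z, fun i z => |w i z + θ i| - |θ i|, fun i z => w i z ^ 2,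
      fun i z => d i z ^ 2] (by
      intro k i
      fin_cases k
      · exact LinGrowth.id.integrable_mul (h.linGrowth hlam i)
      · exact (h.linGrowth_pen hlam i).integrable
      · exact (h.linGrowth hlam i).integrable_sq
      · exact (hd i).integrable_sq) (fun _ => 2 * α * t) (by
      intro i z
      simp only [Fin.sum_univ_four, Matrix.cons_val]
      have yng : ∀ x : ℝ, x * w i z ≤ 1 / (2 * τ) * w i z ^ 2 + τ / 2 * x ^ 2 := by
        intro x
        have e : 1 / (2 * τ) * w i z ^ 2 + τ / 2 * x ^ 2 - x * w i z
            = (w i z - τ * x) ^ 2 / (2 * τ) := by field_simp; ring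
        have : 0 ≤ (w i z - τ * x) ^ 2 / (2 * τ) := by positivity
        linarith
      have hαt : 0 ≤ 2 * α * t := by positivity
      by_cases h1 : t < |θ i|
      · by_cases h2 : 0 < θ i
        · have e : d i z = z - α := by simp [d, h1, h2]
          rw [e]
          have h3 : w i z ≤ |w i z + θ i| - |θ i| := by
            rw [abs_of_pos h2]; linarith [le_abs_self (w i z + θ i)]
          nlinarith [yng (z - α), mul_le_mul_of_nonneg_left h3 hα]
        · have e : d i z = z - -α := by simp [d, h1, h2]
          rw [e]
          have h3 : -w i z ≤ |w i z + θ i| - |θ i| := by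
            rw [abs_of_nonpos (not_lt.1 h2)]; linarith [neg_abs_le (w i z + θ i)]
          nlinarith [yng (z - -α), mul_le_mul_of_nonneg_left h3 hα]
      · have e : d i z = max (|z| - α) 0 := by simp [d, h1]
        rw [e]
        have h3 : |w i z| - 2 * t ≤ |w i z + θ i| - |θ i| := by
          have : |w i z| ≤ |w i z + θ i| + |θ i| := by
            calc |w i z| = |(w i z + θ i) - θ i| := by congr 1; ring
              _ ≤ _ := abs_sub _ _
          linarith
        have h4 : max (|z| - α) 0 * |w i z| ≤ 1 / (2 * τ) * w i z ^ 2 + τ / 2 * max (|z| - α) 0 ^ 2 := by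
          rcases le_total 0 (w i z) with h5 | h5
          · rw [abs_of_nonneg h5]; exact yng _
          · rw [abs_of_nonpos h5]
            have := yng (-max (|z| - α) 0)
            rw [neg_sq] at this; linarith
        have h5 : (|z| - α) * |w i z| ≤ max (|z| - α) 0 * |w i z| :=
          mul_le_mul_of_nonneg_right (le_max_left _ _) (abs_nonneg _)
        have h6 : z * w i z ≤ |z| * |w i z| := by rw [← abs_mul]; exact le_abs_self _
        nlinarith [mul_le_mul_of_nonneg_left h3 hα])
  simp only [Fin.sum_univ_four, Matrix.cons_val, h.gavg_mul, h.gavg_sq, Finset.sum_const,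
    Finset.card_univ, Fintype.card_fin, nsmul_eq_mul, hn] at key
  have e1 : 1 / (δ * N) * (N * (2 * α * t)) = 2 * α * t / δ := by field_simp
  have e2 : 1 / (2 * τ) * (τ ^ 2 - σ ^ 2) ≤ τ / 2 := by
    rw [div_mul_eq_mul_div, div_le_div_iff₀ (by positivity) (by positivity)]
    nlinarith [sq_nonneg σ]
  have e3 : gavg n (fun i z => d i z ^ 2)
      ≤ (s * (1 + α ^ 2) + (1 - s) * (2 * tailSq α)) / δ := by
    rw [gavg]
    simp_rw [hE]
    have := hs.sum_ite_le (a := 1 + α ^ 2) (b := 2 * tailSq α) (by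
      nlinarith [two_mul_tailSq_le_one α hα])
    calc _ ≤ 1 / (n : ℝ) * ((s * (1 + α ^ 2) + (1 - s) * (2 * tailSq α)) * N) := by gcongr
      _ = _ := by rw [hn]; field_simp
  rw [e1] at key
  have e4 := mul_le_mul_of_nonneg_left e3 (by positivity : 0 ≤ τ / 2)
  linarith

lemma exists_tau_le {δ σ lmin lmax t s α : ℝ} (hδ : 0 < δ) (hσ : 0 < σ) (hl : 0 < lmin)
    (hll : lmin ≤ lmax) (ht : 0 ≤ t) (hα : 0 ≤ α)
    (hM : s * (1 + α ^ 2) + (1 - s) * (2 * tailSq α) < δ) :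
    ∃ T : ℝ, ∀ (N n : ℕ) (θ : Fin N → ℝ) (lam β τ : ℝ) (w : Fin N → ℝ → ℝ), 0 < N →
      (n : ℝ) = δ * N → EffectivelySparse t s θ → lmin ≤ lam → lam ≤ lmax →
      FixedPoint n σ θ lam β τ w → τ ≤ T := by
  set ρ := (s * (1 + α ^ 2) + (1 - s) * (2 * tailSq α)) / δ with hρ
  have hρ1 : ρ < 1 := by rw [hρ, div_lt_one hδ]; exact hM
  have hlm : 0 < lmax := hl.trans_le hll
  have h1ρ : 0 < 1 - ρ := by linarith
  set K := lmax * (1 + 1 / δ) / (1 - ρ) with hK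
  have hK0 : 0 < K := by positivity
  refine ⟨(σ ^ 2 / (2 * K) + K / 2 + α * (σ ^ 2 / lmin) + 2 * α * t / δ) * (4 / (1 - ρ)), ?_⟩
  intro N n θ lam β τ w hN hn hs h1 h2 h
  have hlam := hl.trans_le h1
  have hτ := h.τ_pos
  have hβ := h.β_pos
  have a1 := h.tau_sub_beta_le hlam hδ hN hn ht hα hs
  have a2 := h.lam_mul_pen_le hlam
  have a3 := h.pen_ge hlam hδ hN hn
  set p := gavg n (fun i z => |w i z + θ i| - |θ i|)
  have a4 : β * σ ^ 2 / τ ≤ σ ^ 2 := by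
    rw [div_le_iff₀ hτ]; nlinarith [h.beta_le_tau, sq_pos_of_pos hσ]
  have a5 : p ≤ σ ^ 2 / lmin := by
    rw [le_div_iff₀ hl]
    rcases le_total p 0 with h0 | h0
    · nlinarith [sq_nonneg σ]
    · nlinarith [sq_nonneg β]
  have a6 : β ^ 2 ≤ σ ^ 2 + lmax * (τ * (1 + 1 / δ) / 2) := by
    have q1 : lam * -(τ * (1 + 1 / δ) / 2) ≤ lam * p := mul_le_mul_of_nonneg_left a3 hlam.le
    have q2 : lam * (τ * (1 + 1 / δ) / 2) ≤ lmax * (τ * (1 + 1 / δ) / 2) := by gcongr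
    linarith
  have a7 : β ≤ σ ^ 2 / (2 * K) + τ * (1 - ρ) / 4 + K / 2 := by
    have q1 : β ≤ β ^ 2 / (2 * K) + K / 2 := by
      have e : β ^ 2 / (2 * K) + K / 2 - β = (β - K) ^ 2 / (2 * K) := by field_simp; ring
      have : 0 ≤ (β - K) ^ 2 / (2 * K) := by positivity
      linarith
    have q2 : β ^ 2 / (2 * K) ≤ (σ ^ 2 + lmax * (τ * (1 + 1 / δ) / 2)) / (2 * K) := by gcongr
    have q3 : (lmax * (τ * (1 + 1 / δ) / 2)) / (2 * K) = τ * (1 - ρ) / 4 := by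
      rw [hK]; field_simp; ring
    rw [add_div, q3] at q2
    linarith
  have a8 := mul_le_mul_of_nonneg_left a5 hα
  rw [mul_div_assoc', le_div_iff₀ h1ρ]
  linarith

lemma exists_le_beta {δ σ lmin t s : ℝ} (hδ : 0 < δ) (hσ : 0 < σ) (hl : 0 < lmin)
    (ht : 0 ≤ t) (hs0 : 0 ≤ s) (hM : s < δ) :
    ∃ b : ℝ, 0 < b ∧ ∀ (N n : ℕ) (θ : Fin N → ℝ) (lam β τ : ℝ) (w : Fin N → ℝ → ℝ), 0 < N →
      (n : ℝ) = δ * N → EffectivelySparse t s θ → lmin ≤ lam →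
      FixedPoint n σ θ lam β τ w → b ≤ β := by
  have hds : 0 < δ - s := by linarith
  set a := Real.sqrt (2 / (δ - s)) with ha
  have ha0 : 0 < a := Real.sqrt_pos.2 (by positivity)
  have ha2 : 1 / a ^ 2 = (δ - s) / 2 := by rw [ha, Real.sq_sqrt (by positivity)]; field_simp
  refine ⟨min (lmin / (a + t / σ)) (σ * ((δ - s) / (2 * δ))), by positivity, ?_⟩
  intro N n θ lam β τ w hN hn hs h1 h
  have hτ := h.τ_pos
  have hβ := h.β_pos
  have hN' : (0 : ℝ) < N := by exact_mod_cast hN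
  rcases lt_or_ge (lam / β) (a + t / σ) with h2 | h2
  · refine (min_le_left _ _).trans ?_
    rw [div_lt_iff₀ hβ] at h2
    rw [div_le_iff₀ (by positivity)]
    linarith
  · refine (min_le_right _ _).trans ?_
    have hP : ∀ i, (gaussianReal 0 1).real {z | τ * lam / β < |θ i + τ * z|}
        ≤ (δ - s) / 2 + if t < |θ i| then 1 else 0 := by
      intro i
      split_ifs with h3
      · have := measureReal_le_one (μ := gaussianReal 0 1) (s := {z | τ * lam / β < |θ i + τ * z|})
        linarith
      · rw [add_zero, ← ha2]
        refine le_trans (measureReal_mono ?_) (measureReal_abs_gt_le ha0)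
        intro z hz
        simp only [Set.mem_ofPred_eq] at hz ⊢
        have q1 : τ * (lam / β) < t + τ * |z| := by
          calc τ * (lam / β) = τ * lam / β := by ring
            _ < _ := hz
            _ ≤ |θ i| + |τ * z| := abs_add_le _ _
            _ ≤ _ := by rw [abs_mul, abs_of_pos hτ]; linarith
        have q2 : t ≤ τ * (t / σ) := by
          rw [mul_div_assoc', le_div_iff₀ hσ]; nlinarith [h.sigma_le_tau]
        have q3 := mul_le_mul_of_nonneg_left h2 hτ.le
        have q4 : τ * a < τ * |z| := by linarith
        exact lt_of_mul_lt_mul_left q4 hτ.le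
    have hsum : ∑ i, (gaussianReal 0 1).real {z | τ * lam / β < |θ i + τ * z|}
        ≤ ((δ - s) / 2 + s) * N := by
      refine (Finset.sum_le_sum fun i _ => hP i).trans ?_
      rw [Finset.sum_add_distrib]
      have := hs.sum_ite_le (a := 1) (b := 0) zero_le_one
      simp only [Finset.sum_const, Finset.card_univ, Fintype.card_fin, nsmul_eq_mul]
      linarith
    have hact := h.act
    have : (1 / (n : ℝ)) * ∑ i, (gaussianReal 0 1).real {z | τ * lam / β < |θ i + τ * z|}
        ≤ ((δ - s) / 2 + s) / δ := by
      calc _ ≤ (1 / (n : ℝ)) * (((δ - s) / 2 + s) * N) := by gcongr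
        _ = _ := by rw [hn]; field_simp
    have h4 := mul_le_mul_of_nonneg_left this hτ.le
    have e : (δ - s) / (2 * δ) = 1 - ((δ - s) / 2 + s) / δ := by field_simp; ring
    have h5 : σ * ((δ - s) / (2 * δ)) ≤ τ * ((δ - s) / (2 * δ)) := by
      gcongr; exact h.sigma_le_tau
    rw [e] at h5 ⊢
    linarith

end FixedPoint
end

lemma smax_eq (δ : ℝ) : smax δ = δ * sSup ((fun α : ℝ =>
    (1 - (2 / δ) * tailSq α) / (1 + α ^ 2 - 2 * tailSq α)) '' Set.Ici 0) := rfl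

lemma effectivelySparse_of_mem_F0ball {N : ℕ} {s : ℝ} {θ : Fin N → ℝ} (h : θ ∈ F0ball N s) :
    EffectivelySparse 0 (min s 1) θ := by
  have h1 : (l0 θ : ℝ) ≤ s * N := h
  have h2 : (l0 θ : ℝ) ≤ 1 * N := by
    rw [one_mul]
    exact_mod_cast (Finset.card_filter_le _ _).trans (by simp)
  have e : (Finset.univ.filter fun i => 0 < |θ i|) = Finset.univ.filter fun i => θ i ≠ 0 := by
    ext i; simp
  rw [EffectivelySparse, e]
  change (l0 θ : ℝ) ≤ _
  rcases min_cases s 1 with ⟨h3, _⟩ | ⟨h3, _⟩ <;> rw [h3] <;> assumption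

lemma effectivelySparse_of_mem_Fball {N : ℕ} {p ξ s : ℝ} (hN : 0 < N) (hp : 0 < p) (hξ : 0 < ξ)
    (hs : 0 < s) {θ : Fin N → ℝ} (h : θ ∈ Fball N p ξ) :
    EffectivelySparse (ξ * s ^ (-(1 / p))) s θ := by
  have hN' : (0 : ℝ) < N := by exact_mod_cast hN
  have h1 : (1 / (N : ℝ)) * ∑ i, |θ i| ^ p ≤ ξ ^ p := h
  set t := ξ * s ^ (-(1 / p)) with ht
  have ht0 : 0 < t := by positivity
  have htp : s * t ^ p = ξ ^ p := by
    rw [ht, Real.mul_rpow hξ.le (by positivity), ← Real.rpow_mul hs.le, neg_mul,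
      one_div_mul_cancel hp.ne', Real.rpow_neg_one]
    field_simp
  have h2 : ((Finset.univ.filter fun i => t < |θ i|).card : ℝ) * t ^ p ≤ ∑ i, |θ i| ^ p := by
    calc _ = ∑ i ∈ Finset.univ.filter fun i => t < |θ i|, t ^ p := by simp
      _ ≤ ∑ i ∈ Finset.univ.filter fun i => t < |θ i|, |θ i| ^ p :=
          Finset.sum_le_sum fun i hi =>
            Real.rpow_le_rpow ht0.le (Finset.mem_filter.1 hi).2.le hp.le
      _ ≤ _ := Finset.sum_le_univ_sum_of_nonneg fun i => by positivity
  rw [div_mul_eq_mul_div, one_mul, div_le_iff₀ hN', ← htp] at h1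
  have h3 : 0 < t ^ p := by positivity
  rw [EffectivelySparse]
  refine le_of_mul_le_mul_right ?_ h3
  linarith

lemma DFamSpec.exists_effectivelySparse {δ q : ℝ} (hδ : 0 < δ) {Dfam : (M : ℕ) → Set (Fin M → ℝ)}
    (hD : DFamSpec δ Dfam q) :
    ∃ t s α : ℝ, 0 ≤ t ∧ 0 ≤ s ∧ s < δ ∧ 0 ≤ α ∧
      s * (1 + α ^ 2) + (1 - s) * (2 * tailSq α) < δ ∧
      ∀ N : ℕ, 0 < N → ∀ θ ∈ Dfam N, EffectivelySparse t s θ := by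
  rcases hD with ⟨p, ξ, hp, hξ, hD, -⟩ | ⟨s, hs0, hs, hD, -⟩
  · obtain ⟨α, hα, hα0⟩ := ((tendsto_tailSq.eventually_lt_const
      (by positivity : (0 : ℝ) < δ / 4)).and (Filter.eventually_ge_atTop 0)).exists
    have hA := tailSq_nonneg α
    set s := min 1 (δ / 4 / (1 + α ^ 2)) with hs
    have hs0 : 0 < s := by positivity
    have h1 : s * (1 + α ^ 2) ≤ δ / 4 := by
      rw [← le_div_iff₀ (by positivity)]; exact min_le_right _ _
    have h2 : s ≤ s * (1 + α ^ 2) := by nlinarith [mul_nonneg hs0.le (sq_nonneg α)]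
    refine ⟨ξ * s ^ (-(1 / p)), s, α, by positivity, hs0.le, by linarith, hα0, ?_, ?_⟩
    · nlinarith [mul_nonneg hs0.le hA]
    · intro N hN θ hθ
      rw [hD] at hθ
      exact effectivelySparse_of_mem_Fball hN hp hξ hs0 hθ
  · rw [smax_eq, mul_comm, ← div_lt_iff₀ hδ] at hs
    obtain ⟨_, ⟨α, hα, rfl⟩, h⟩ := exists_lt_of_lt_csSup (Set.Nonempty.image _ Set.nonempty_Ici) hs
    simp only at h
    have hα0 : 0 ≤ α := hα
    have h1 := two_mul_tailSq_le_one α hα0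
    have h2 : 0 < 1 + α ^ 2 - 2 * tailSq α := by
      refine lt_of_le_of_ne (by nlinarith [sq_nonneg α]) fun h0 => ?_
      rw [← h0, div_zero] at h
      exact absurd h (not_lt.2 (by positivity))
    rw [lt_div_iff₀ h2, div_mul_eq_mul_div, div_lt_iff₀ hδ] at h
    have h3 : (1 - 2 / δ * tailSq α) * δ = δ - 2 * tailSq α := by field_simp
    rw [h3] at h
    have hs' : min s 1 ≤ s := min_le_left _ _
    have hs1 : min s 1 ≤ 1 := min_le_right _ _
    have hs2 : 0 ≤ min s 1 := le_min hs0 zero_le_one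
    have h4 : min s 1 * (1 + α ^ 2) + (1 - min s 1) * (2 * tailSq α) < δ := by
      nlinarith [mul_le_mul_of_nonneg_right hs' h2.le]
    refine ⟨0, min s 1, α, le_rfl, hs2, ?_, hα0, h4, ?_⟩
    · nlinarith [tailSq_nonneg α, mul_nonneg hs2 (sq_nonneg α),
        mul_nonneg (sub_nonneg.2 hs1) (tailSq_nonneg α)]
    · intro N _ θ hθ
      rw [hD] at hθ
      exact effectivelySparse_of_mem_F0ball hθ

/-- Quantitative Cauchy-Schwarz for vectors extended by a common coordinate `σ`. -/
lemma inner_add_gap_le {σ τ τ' A A' B : ℝ} (hτ : 0 < τ) (hτ' : 0 < τ') (h : τ ^ 2 = σ ^ 2 + A)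
    (h' : τ' ^ 2 = σ ^ 2 + A') (hB : B ^ 2 ≤ A * A') (hD : 0 ≤ A + A' - 2 * B) :
    (σ ^ 2 + B) / τ + σ ^ 2 * (A + A' - 2 * B) / (2 * τ ^ 2 * τ') ≤ τ' := by
  have h1 : (σ ^ 2 + B) ^ 2 + σ ^ 2 * (A + A' - 2 * B) ≤ (τ * τ') ^ 2 := by
    rw [mul_pow, h, h']; nlinarith
  have h2 : σ ^ 2 + B ≤ τ * τ' := by
    refine abs_le_of_sq_le_sq' (?_) (by positivity) |>.2
    nlinarith [mul_nonneg (sq_nonneg σ) hD]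
  have h3 : (σ ^ 2 + B) + σ ^ 2 * (A + A' - 2 * B) / (2 * (τ * τ')) ≤ τ * τ' := by
    have h4 : σ ^ 2 * (A + A' - 2 * B) / (2 * (τ * τ')) ≤ τ * τ' - (σ ^ 2 + B) := by
      have : 0 < τ * τ' := by positivity
      rw [div_le_iff₀ (by positivity)]
      nlinarith [sq_nonneg (τ * τ' - (σ ^ 2 + B))]
    linarith
  have e : (σ ^ 2 + B) / τ + σ ^ 2 * (A + A' - 2 * B) / (2 * τ ^ 2 * τ')
      = ((σ ^ 2 + B) + σ ^ 2 * (A + A' - 2 * B) / (2 * (τ * τ'))) / τ := by field_simp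
  rw [e, div_le_iff₀ hτ]
  linarith

namespace FixedPoint
variable {N n : ℕ} {σ : ℝ} {θ : Fin N → ℝ} {lam β τ lam' β' τ' : ℝ} {w w' : Fin N → ℝ → ℝ}

lemma gavg_mul_sq_le (h : FixedPoint n σ θ lam β τ w) (hlam : 0 < lam)
    (h' : FixedPoint n σ θ lam' β' τ' w') (hlam' : 0 < lam') (c : ℝ) :
    2 * c * gavg n (fun i z => w i z * w' i z) ≤ (τ ^ 2 - σ ^ 2) + c ^ 2 * (τ' ^ 2 - σ ^ 2) := by
  have key := sum_mul_gavg_le (n := n) ![2 * c, -1, -c ^ 2]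
    ![fun i z => w i z * w' i z, fun i z => w i z ^ 2, fun i z => w' i z ^ 2] (by
      intro k i
      fin_cases k
      · exact (h.linGrowth hlam i).integrable_mul (h'.linGrowth hlam' i)
      · exact (h.linGrowth hlam i).integrable_sq
      · exact (h'.linGrowth hlam' i).integrable_sq) (fun _ => 0) (by
      intro i z
      simp only [Fin.sum_univ_three, Matrix.cons_val]
      nlinarith [sq_nonneg (w i z - c * w' i z)])
  simp only [Fin.sum_univ_three, Matrix.cons_val, h.gavg_sq, h'.gavg_sq, Finset.sum_const_zero,
    mul_zero] at key
  linarith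

lemma lam_mul_pen_sub_ge (h : FixedPoint n σ θ lam β τ w) (hlam : 0 < lam)
    (h' : FixedPoint n σ θ lam' β' τ' w') (hlam' : 0 < lam') :
    β * (β - β') + β * (τ' - (σ ^ 2 + gavg n (fun i z => w i z * w' i z)) / τ)
      ≤ lam * (gavg n (fun i z => |w' i z + θ i| - |θ i|)
        - gavg n (fun i z => |w i z + θ i| - |θ i|)) := by
  have hτ := h.τ_pos
  have key := sum_mul_gavg_le (n := n) ![β, -(β / τ), -β, β / τ, -lam, lam]
    ![fun i z => z * w' i z, fun i z => w i z * w' i z, fun i z => z * w i z,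
      fun i z => w i z ^ 2, fun i z => |w' i z + θ i| - |θ i|,
      fun i z => |w i z + θ i| - |θ i|] (by
      intro k i
      fin_cases k
      · exact LinGrowth.id.integrable_mul (h'.linGrowth hlam' i)
      · exact (h.linGrowth hlam i).integrable_mul (h'.linGrowth hlam' i)
      · exact LinGrowth.id.integrable_mul (h.linGrowth hlam i)
      · exact (h.linGrowth hlam i).integrable_sq
      · exact (h'.linGrowth_pen hlam' i).integrable
      · exact (h.linGrowth_pen hlam i).integrable) (fun _ => 0) (by
      intro i z
      have := h.sub i z (w' i z)
      simp only [Fin.sum_univ_six, Matrix.cons_val]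
      have e : β / τ * ((τ * z - w i z) * (w' i z - w i z)) = β * (z * w' i z)
          - β / τ * (w i z * w' i z) - β * (z * w i z) + β / τ * w i z ^ 2 := by
        field_simp; ring
      rw [e] at this
      linarith)
  simp only [Fin.sum_univ_six, Matrix.cons_val, h.gavg_sq, h.gavg_mul, h'.gavg_mul,
    Finset.sum_const_zero, mul_zero] at key
  have e : β * (τ' - (σ ^ 2 + gavg n (fun i z => w i z * w' i z)) / τ)
      = β * (τ' - τ) - β / τ * gavg n (fun i z => w i z * w' i z)
        + β / τ * (τ ^ 2 - σ ^ 2) := by field_simp; ring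
  rw [e]
  linarith

set_option maxHeartbeats 1000000 in
/-- The asymptotic risk is Lipschitz in the regularization parameter. -/
lemma sq_sub_sq_tau_le (h : FixedPoint n σ θ lam β τ w) (hlam : 0 < lam)
    (h' : FixedPoint n σ θ lam' β' τ' w') (hlam' : 0 < lam') {δ b T : ℝ} (hδ : 0 < δ) (hσ : 0 < σ)
    (hb : 0 < b) (hN : 0 < N) (hn : (n : ℝ) = δ * N) (hbβ : b ≤ β) (hbβ' : b ≤ β') (hT : τ ≤ T)
    (hT' : τ' ≤ T) :
    |τ ^ 2 - τ' ^ 2| ≤ 2 * T ^ 4 / (σ ^ 2 * b * Real.sqrt δ) * |lam - lam'| := by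
  have hτ := h.τ_pos
  have hτ' := h'.τ_pos
  have hT0 : 0 < T := hτ.trans_le hT
  set A := τ ^ 2 - σ ^ 2 with hA
  set A' := τ' ^ 2 - σ ^ 2 with hA'
  set B := gavg n (fun i z => w i z * w' i z) with hB
  have e1 := h.lam_mul_pen_sub_ge hlam h' hlam'
  have e2 := h'.lam_mul_pen_sub_ge hlam' h hlam
  have comm : gavg n (fun i z => w' i z * w i z) = B := by rw [hB]; simp_rw [mul_comm]
  rw [comm] at e2
  rw [← hB] at e1
  have hBA : B ^ 2 ≤ A * A' := by
    have := discrim_le_zero (a := A') (b := -2 * B) (c := A) fun x => by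
      have := h.gavg_mul_sq_le hlam h' hlam' x
      linarith
    rw [discrim] at this; linarith
  have hD : 0 ≤ A + A' - 2 * B := by
    have := h.gavg_mul_sq_le hlam h' hlam' 1
    linarith
  have g1 := inner_add_gap_le (σ := σ) hτ hτ' (by rw [hA]; ring) (by rw [hA']; ring) hBA hD
  have g2 := inner_add_gap_le (σ := σ) (A := A') (A' := A) (B := B) hτ' hτ (by rw [hA']; ring)
    (by rw [hA]; ring) (by linarith) (by linarith)
  set D := A + A' - 2 * B with hDdef
  have hD' : A' + A - 2 * B = D := by rw [hDdef]; ring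
  rw [hD'] at g2
  set c := σ ^ 2 * b / T ^ 3 with hc
  have hc0 : 0 < c := by positivity
  have lower : ∀ (β₁ τ₁ τ₂ : ℝ), 0 < τ₁ → 0 < τ₂ → τ₁ ≤ T → τ₂ ≤ T → b ≤ β₁ →
      c / 2 * D ≤ β₁ * (σ ^ 2 * D / (2 * τ₁ ^ 2 * τ₂)) := by
    intro β₁ τ₁ τ₂ h1 h2 h3 h4 h5
    have h6 : 0 ≤ β₁ := hb.le.trans h5
    calc c / 2 * D = b * (σ ^ 2 * D / (2 * T ^ 2 * T)) := by rw [hc]; field_simp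
      _ ≤ _ := by gcongr
  have l1 := lower β τ τ' hτ hτ' hT hT' hbβ
  have l2 := lower β' τ' τ hτ' hτ hT' hT hbβ'
  set p := gavg n (fun i z => |w i z + θ i| - |θ i|) with hp
  set p' := gavg n (fun i z => |w' i z + θ i| - |θ i|) with hp'
  have hsum : c * D ≤ (lam - lam') * (p' - p) := by
    have m1 := mul_le_mul_of_nonneg_left g1 h.β_pos.le
    have m2 := mul_le_mul_of_nonneg_left g2 h'.β_pos.le
    nlinarith [sq_nonneg (β - β')]
  have upper : (lam - lam') * (p' - p) ≤ (lam - lam') ^ 2 / (2 * c * δ) + c / 2 * D := by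
    have hN' : (0 : ℝ) < N := by exact_mod_cast hN
    have key := sum_mul_gavg_le (n := n) ![lam - lam', -(lam - lam'), -(c / 2), -(c / 2), c]
      ![fun i z => |w' i z + θ i| - |θ i|, fun i z => |w i z + θ i| - |θ i|,
        fun i z => w i z ^ 2, fun i z => w' i z ^ 2, fun i z => w i z * w' i z] (by
        intro k i
        fin_cases k
        · exact (h'.linGrowth_pen hlam' i).integrable
        · exact (h.linGrowth_pen hlam i).integrable
        · exact (h.linGrowth hlam i).integrable_sq
        · exact (h'.linGrowth hlam' i).integrable_sq
        · exact (h.linGrowth hlam i).integrable_mul (h'.linGrowth hlam' i))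
      (fun _ => (lam - lam') ^ 2 / (2 * c)) (by
        intro i z
        simp only [Fin.sum_univ_five, Matrix.cons_val]
        have q1 : (lam - lam') * (|w' i z + θ i| - |w i z + θ i|)
            ≤ |lam - lam'| * |w' i z - w i z| := by
          refine (le_abs_self _).trans ?_
          rw [abs_mul]
          refine mul_le_mul_of_nonneg_left ?_ (abs_nonneg _)
          have := abs_abs_sub_abs_le (w' i z + θ i) (w i z + θ i)
          simpa using this
        have q2 : |lam - lam'| * |w' i z - w i z|
            ≤ (lam - lam') ^ 2 / (2 * c) + c / 2 * (w' i z - w i z) ^ 2 := by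
          rw [← sq_abs (lam - lam'), ← sq_abs (w' i z - w i z)]
          have e : |lam - lam'| ^ 2 / (2 * c) + c / 2 * |w' i z - w i z| ^ 2
              - |lam - lam'| * |w' i z - w i z|
              = (|lam - lam'| - c * |w' i z - w i z|) ^ 2 / (2 * c) := by field_simp; ring
          have : 0 ≤ (|lam - lam'| - c * |w' i z - w i z|) ^ 2 / (2 * c) := by positivity
          linarith
        have q3 : c / 2 * (w' i z - w i z) ^ 2
            = c / 2 * w i z ^ 2 + c / 2 * w' i z ^ 2 - c * (w i z * w' i z) := by ring
        linarith)
    simp only [Fin.sum_univ_five, Matrix.cons_val, h.gavg_sq, h'.gavg_sq, Finset.sum_const,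
      Finset.card_univ, Fintype.card_fin, nsmul_eq_mul, hn] at key
    have e : 1 / (δ * N) * (N * ((lam - lam') ^ 2 / (2 * c))) = (lam - lam') ^ 2 / (2 * c * δ) := by
      field_simp
    rw [e] at key
    have : c / 2 * D = c / 2 * A + c / 2 * A' - c * B := by rw [hDdef]; ring
    linarith
  have hDle : D ≤ (lam - lam') ^ 2 / (c ^ 2 * δ) := by
    rw [le_div_iff₀ (by positivity)]
    have h1 : c / 2 * D ≤ (lam - lam') ^ 2 / (2 * c * δ) := by linarith
    rw [le_div_iff₀ (by positivity)] at h1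
    nlinarith
  have hAA : (A - A') ^ 2 ≤ D * (4 * T ^ 2) := by
    have hs : (A - A') ^ 2 ≤ D * (A + A' + 2 * B) := by rw [hDdef]; nlinarith
    have hA4 : A + A' + 2 * B ≤ 4 * T ^ 2 := by
      have : τ ^ 2 ≤ T ^ 2 := by gcongr
      have : τ' ^ 2 ≤ T ^ 2 := by gcongr
      have : A + A' - 2 * B = D := rfl
      nlinarith [sq_nonneg σ]
    exact hs.trans (mul_le_mul_of_nonneg_left hA4 hD)
  have hfin : (A - A') ^ 2 ≤ (2 * T ^ 4 / (σ ^ 2 * b * Real.sqrt δ) * |lam - lam'|) ^ 2 := by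
    refine hAA.trans ((mul_le_mul_of_nonneg_right hDle (by positivity)).trans (le_of_eq ?_))
    rw [hc, mul_pow (2 * T ^ 4 / (σ ^ 2 * b * Real.sqrt δ)), div_pow (2 * T ^ 4),
      mul_pow (σ ^ 2 * b) (Real.sqrt δ), Real.sq_sqrt hδ.le, sq_abs]
    field_simp; ring
  have : τ ^ 2 - τ' ^ 2 = A - A' := by rw [hA, hA']; ring
  rw [this]
  exact abs_le_of_sq_le_sq hfin (by positivity)

end FixedPoint

lemma div_sub_div_le_of_sq_close {σ τ S R a η : ℝ} (hσ : 0 < σ) (hτ : σ ≤ τ) (hR : σ ≤ R)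
    (hS : 0 ≤ S) (ha : |a| ≤ S * R) (h : |R ^ 2 - τ ^ 2| ≤ η) :
    a / τ ≤ a / R + S * η / (2 * σ ^ 2) := by
  have hτ0 := hσ.trans_le hτ
  have hR0 := hσ.trans_le hR
  have h1 : |R - τ| ≤ η / (2 * σ) := by
    rw [le_div_iff₀ (by positivity)]
    calc |R - τ| * (2 * σ) ≤ |R - τ| * |R + τ| := by
          gcongr; rw [abs_of_pos (by positivity)]; linarith
      _ = |R ^ 2 - τ ^ 2| := by rw [← abs_mul]; congr 1; ring
      _ ≤ η := h
  have h0 : 0 ≤ η := (abs_nonneg _).trans h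
  have e : a / τ - a / R = a * (R - τ) / (τ * R) := by field_simp
  have h2 : a * (R - τ) ≤ S * R * (η / (2 * σ)) := by
    calc a * (R - τ) ≤ |a * (R - τ)| := le_abs_self _
      _ = |a| * |R - τ| := abs_mul _ _
      _ ≤ _ := by gcongr
  have h3 : a * (R - τ) / (τ * R) ≤ S * η / (2 * σ ^ 2) := by
    calc a * (R - τ) / (τ * R) ≤ S * R * (η / (2 * σ)) / (τ * R) := by gcongr
      _ = S * η / (2 * σ * τ) := by field_simp
      _ ≤ S * η / (2 * σ ^ 2) := by
        rw [sq, ← mul_assoc]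
        gcongr
  linarith

lemma primal_lower_bound {σ τ β lam T Λ G e q qs m ms B pw ps p η S : ℝ} (hσ : 0 < σ)
    (hστ : σ ≤ τ) (hτT : τ ≤ T) (hβ : 0 < β) (hβτ : β ≤ τ) (hlam : 0 < lam) (hΛ : lam ≤ Λ)
    (hη : η ≤ 1) (hG : 1 - η ≤ G) (he : |e| ≤ η) (hms : |ms - (τ ^ 2 - σ ^ 2)| ≤ η)
    (hqs : |qs - (τ - β)| ≤ η) (hps : |ps - p| ≤ η)
    (hsub : β / τ * (τ * q - τ * qs - B + ms) ≤ lam * (pw - ps)) (hB : B ^ 2 ≤ ms * m)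
    (hm : 0 ≤ m) (hms0 : 0 ≤ ms) (hD : 0 ≤ ms + m - 2 * B) (hS : S = Real.sqrt (σ ^ 2 + m)) :
    β ^ 2 / 2 + lam * p - (Λ + T * (3 + 1 / σ + 1 / (2 * σ ^ 2))) * η * (1 + S)
      + β * (σ ^ 2 * (ms + m - 2 * B) / (2 * (T ^ 2 + 1) * S))
    ≤ β * (S * G - q + e) - β ^ 2 / 2 + lam * pw := by
  have hτ := hσ.trans_le hστ
  have hη0 : 0 ≤ η := (abs_nonneg _).trans he
  have hS2 : S ^ 2 = σ ^ 2 + m := by rw [hS, Real.sq_sqrt (by positivity)]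
  have hS0 : 0 < S := by rw [hS]; positivity
  set R := Real.sqrt (σ ^ 2 + ms) with hR
  have hR2 : R ^ 2 = σ ^ 2 + ms := by rw [hR, Real.sq_sqrt (by positivity)]
  have hR0 : 0 < R := by rw [hR]; positivity
  have hσR : σ ≤ R := by
    refine abs_le_of_sq_le_sq' ?_ hR0.le |>.2
    rw [hR2]; linarith
  have gap := inner_add_gap_le (σ := σ) hR0 hS0 hR2 hS2 hB hD
  set D := ms + m - 2 * B with hDdef
  have d1 : σ ^ 2 * D / (2 * (T ^ 2 + 1) * S) ≤ σ ^ 2 * D / (2 * R ^ 2 * S) := by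
    have : R ^ 2 ≤ T ^ 2 + 1 := by
      rw [hR2]
      have := (abs_le.1 hms).2
      have : τ ^ 2 ≤ T ^ 2 := by gcongr
      linarith
    gcongr
  have d2 : (σ ^ 2 + B) / τ ≤ (σ ^ 2 + B) / R + S * η / (2 * σ ^ 2) := by
    refine div_sub_div_le_of_sq_close hσ hστ hσR hS0.le ?_ ?_
    · refine abs_le_of_sq_le_sq ?_ (by positivity)
      rw [mul_pow, hS2, hR2]
      nlinarith [mul_nonneg (sq_nonneg σ) hD]
    · rw [hR2]
      have : σ ^ 2 + ms - τ ^ 2 = ms - (τ ^ 2 - σ ^ 2) := by ring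
      rw [this]; exact hms
  have d3 : S - η * S ≤ S * G := by nlinarith
  have d4 : τ - σ ^ 2 / τ - η / σ ≤ ms / τ := by
    have h1 : (τ ^ 2 - σ ^ 2 - η) / τ ≤ ms / τ := by
      gcongr
      have := (abs_le.1 hms).1
      linarith
    have h2 : (τ ^ 2 - σ ^ 2 - η) / τ = τ - σ ^ 2 / τ - η / τ := by field_simp
    have h3 : η / τ ≤ η / σ := by gcongr
    linarith
  have d5 : β + σ ^ 2 * D / (2 * (T ^ 2 + 1) * S) - η * (1 + S) * (3 + 1 / σ + 1 / (2 * σ ^ 2))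
      ≤ S * G + e - qs + (ms - B) / τ := by
    have h1 := (abs_le.1 he).1
    have h2 := (abs_le.1 hqs).2
    have h3 : (σ ^ 2 + B) / τ = σ ^ 2 / τ + B / τ := by rw [add_div]
    have h4 : (ms - B) / τ = ms / τ - B / τ := by rw [sub_div]
    have h5 : η * S + 2 * η + η / σ + S * η / (2 * σ ^ 2)
        ≤ η * (1 + S) * (3 + 1 / σ + 1 / (2 * σ ^ 2)) := by
      have : η * (1 + S) * (3 + 1 / σ + 1 / (2 * σ ^ 2)) - (η * S + 2 * η + η / σ
          + S * η / (2 * σ ^ 2)) = η + 2 * (η * S) + η * S / σ + η / (2 * σ ^ 2) := by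
        field_simp; ring
      have : 0 ≤ η + 2 * (η * S) + η * S / σ + η / (2 * σ ^ 2) := by positivity
      linarith
    linarith
  have d6 := mul_le_mul_of_nonneg_left d5 hβ.le
  have d7 : lam * (p - η) ≤ lam * ps := by
    have := (abs_le.1 hps).1
    exact mul_le_mul_of_nonneg_left (by linarith) hlam.le
  have d8 : β * (η * (1 + S) * (3 + 1 / σ + 1 / (2 * σ ^ 2)))
      ≤ T * (η * (1 + S) * (3 + 1 / σ + 1 / (2 * σ ^ 2))) := by gcongr; linarith
  have d9 : lam * η ≤ Λ * η * (1 + S) := by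
    have : lam * η ≤ Λ * η := by gcongr
    have h2 : 0 ≤ Λ * η * S := mul_nonneg (mul_nonneg (hlam.le.trans hΛ) hη0) hS0.le
    linarith only [this, h2]
  have d10 : β / τ * (τ * q - τ * qs - B + ms) = β * (q - qs + (ms - B) / τ) := by
    field_simp; ring
  rw [d10] at hsub
  set k := 3 + 1 / σ + 1 / (2 * σ ^ 2)
  set X := σ ^ 2 * D / (2 * (T ^ 2 + 1) * S)
  set Y := (ms - B) / τ
  have d11 : β * (β + X) - T * (η * (1 + S) * k) ≤ β * (S * G + e - qs + Y) := by linarith only [d6, d8]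
  have d12 : (Λ + T * k) * η * (1 + S) = Λ * η * (1 + S) + T * (η * (1 + S) * k) := by ring
  rw [d12]
  linarith only [d11, d7, d9, hsub]

lemma sq_mul_one_add_le {T η t δ m ms B m0 : ℝ} (hδ : 0 < δ) (hη : η ≤ 1)
    (ht : 0 < t) (ht1 : t ≤ 1) (hηt : η ≤ t / (2 * δ)) (hms : |ms - m0| ≤ η) (hm0 : m0 ≤ T ^ 2)
    (hms0 : 0 ≤ ms) (hB : B ^ 2 ≤ ms * m) (hm : 0 ≤ m) (hD : 0 ≤ ms + m - 2 * B)
    (h : t < |δ * m - δ * m0|) :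
    t ^ 2 * (1 + m) ≤ (5 + 2 * T ^ 2) * (5 + 8 * δ ^ 2 * (5 + 3 * T ^ 2)) * (ms + m - 2 * B) := by
  set D := ms + m - 2 * B with hDdef
  have hmsT : ms ≤ T ^ 2 + 1 := by linarith [(abs_le.1 hms).2]
  have h1 : t / (2 * δ) ≤ |m - ms| := by
    have h2 : t / δ < |m - m0| := by
      rw [div_lt_iff₀ hδ]
      rw [← mul_sub, abs_mul, abs_of_pos hδ] at h; linarith
    have h3 : |m - m0| ≤ |m - ms| + |ms - m0| := abs_sub_le _ _ _
    have h4 : t / δ = t / (2 * δ) + t / (2 * δ) := by field_simp; ring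
    linarith
  have h2 : (m - ms) ^ 2 ≤ D * (2 * (m + ms)) := by
    have : (m - ms) ^ 2 ≤ D * (ms + m + 2 * B) := by rw [hDdef]; nlinarith
    refine this.trans (mul_le_mul_of_nonneg_left ?_ hD)
    linarith
  have h3 : (t / (2 * δ)) ^ 2 ≤ (m - ms) ^ 2 := by
    rw [← sq_abs (m - ms)]
    gcongr
  have h4 : m ≤ 2 * ms + 2 * D := by
    have hd : 0 ≤ (4 * ms + m) - 4 * B := by
      by_contra hc
      have : (4 * ms + m) ^ 2 < (4 * B) ^ 2 := by
        apply pow_lt_pow_left₀ (by linarith) (by positivity) (by norm_num)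
      nlinarith [sq_nonneg (4 * ms - m)]
    rw [hDdef]; linarith
  have t2 : t ^ 2 ≤ 1 := by nlinarith
  rcases le_total 1 D with hD1 | hD1
  · have a1 : 1 + m ≤ (5 + 2 * T ^ 2) * D := by nlinarith [mul_nonneg (sq_nonneg T) hD]
    have a2 : t ^ 2 * (1 + m) ≤ 1 + m := by nlinarith
    have a3 : (5 + 2 * T ^ 2) * D
        ≤ (5 + 2 * T ^ 2) * (5 + 8 * δ ^ 2 * (5 + 3 * T ^ 2)) * D := by
      refine mul_le_mul_of_nonneg_right ?_ hD
      have : 0 ≤ (5 + 2 * T ^ 2) * (8 * δ ^ 2 * (5 + 3 * T ^ 2)) := by positivity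
      nlinarith [sq_nonneg T]
    linarith
  · have a0 : m ≤ 4 + 2 * T ^ 2 := by linarith
    have a1 : (t / (2 * δ)) ^ 2 ≤ D * (2 * (5 + 3 * T ^ 2)) :=
      (h3.trans h2).trans (mul_le_mul_of_nonneg_left (by linarith) hD)
    have a2 : t ^ 2 ≤ 8 * δ ^ 2 * (5 + 3 * T ^ 2) * D := by
      rw [div_pow, div_le_iff₀ (by positivity)] at a1
      linarith
    have a3 : t ^ 2 * (1 + m) ≤ (8 * δ ^ 2 * (5 + 3 * T ^ 2) * D) * (5 + 2 * T ^ 2) :=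
      mul_le_mul a2 (by linarith) (by linarith) (by positivity)
    have a4 : 0 ≤ (8 * δ ^ 2 * (5 + 3 * T ^ 2) * D) := by positivity
    have a5 : 0 ≤ 5 * (5 + 2 * T ^ 2) * D := by positivity
    nlinarith

/-- Squared Euclidean norm normalized by `n`. -/
def msq {N : ℕ} (n : ℕ) (v : Fin N → ℝ) : ℝ := (1 / (n : ℝ)) * ∑ j, v j ^ 2

/-- Normalized increase of the `ℓ₁` norm when moving from `θ` to `θ + v`. -/
def penGap {N : ℕ} (n : ℕ) (θ v : Fin N → ℝ) : ℝ := (1 / (n : ℝ)) * ∑ j, (|v j + θ j| - |θ j|)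

lemma msq_nonneg {N : ℕ} (n : ℕ) (v : Fin N → ℝ) : 0 ≤ msq n v := by
  rw [msq]; positivity

/-- The typical behaviour of the Gaussian vectors entering the comparison problem. -/
structure GoodEvent {N : ℕ} (n : ℕ) (σ : ℝ) (θ : Fin N → ℝ) (β τ : ℝ) (w : Fin N → ℝ → ℝ)
    (p η : ℝ) (H : Fin n ⊕ Option (Fin N) → ℝ) : Prop where
  noise : |(1 / (n : ℝ)) * ∑ i, H (.inl i) ^ 2 - 1| ≤ η
  shift : |σ * H (.inr none) / Real.sqrt n| ≤ η
  risk : |msq n (fun j => w j (H (.inr (some j)))) - (τ ^ 2 - σ ^ 2)| ≤ η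
  corr : |(1 / (n : ℝ)) * ∑ j, H (.inr (some j)) * w j (H (.inr (some j))) - (τ - β)| ≤ η
  penalty : |penGap n θ (fun j => w j (H (.inr (some j)))) - p| ≤ η

lemma sq_sum_mul_le_msq {N n : ℕ} (v v' : Fin N → ℝ) :
    ((1 / (n : ℝ)) * ∑ j, v j * v' j) ^ 2 ≤ msq n v * msq n v' := by
  rw [msq, msq, mul_pow]
  calc _ ≤ (1 / (n : ℝ)) ^ 2 * ((∑ j, v j ^ 2) * ∑ j, v' j ^ 2) := by
        gcongr; exact Finset.sum_mul_sq_le_sq_mul_sq _ _ _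
    _ = _ := by ring

lemma msq_sub {N n : ℕ} (v v' : Fin N → ℝ) :
    msq n (fun j => v j - v' j) = msq n v + msq n v' - 2 * ((1 / (n : ℝ)) * ∑ j, v j * v' j) := by
  simp only [msq, sub_sq, Finset.sum_add_distrib, Finset.sum_sub_distrib, mul_assoc,
    ← Finset.mul_sum]
  ring

namespace GoodEvent
variable {N n : ℕ} {σ : ℝ} {θ : Fin N → ℝ} {lam β τ : ℝ} {w : Fin N → ℝ → ℝ} {p η : ℝ}
  {H : Fin n ⊕ Option (Fin N) → ℝ}

lemma sq_norm (h : GoodEvent n σ θ β τ w p η H) :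
    |(euc (fun i => H (.inl i)) / Real.sqrt n) ^ 2 - 1| ≤ η := by
  rw [div_pow, euc_sq, Real.sq_sqrt (by positivity)]
  have := h.noise
  rwa [one_div, inv_mul_eq_div] at this

lemma one_sub_le_norm (h : GoodEvent n σ θ β τ w p η H) (hη : η ≤ 1) :
    1 - η ≤ euc (fun i => H (.inl i)) / Real.sqrt n := by
  have h1 := (abs_le.1 h.sq_norm).1
  have h0 : 0 ≤ euc (fun i => H (.inl i)) / Real.sqrt n := div_nonneg (euc_nonneg _) (by positivity)
  have h2 : 0 ≤ η := (abs_nonneg _).trans h.noise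
  refine abs_le_of_sq_le_sq' ?_ h0 |>.2
  nlinarith

set_option maxHeartbeats 1000000 in
lemma primal (h : GoodEvent n σ θ β τ w p η H) (hfp : FixedPoint n σ θ lam β τ w)
    {δ T Λ b t γ : ℝ} (hδ : 0 < δ) (hσ : 0 < σ) (hlam : 0 < lam) (hΛ : lam ≤ Λ) (hT : τ ≤ T)
    (hb : 0 < b) (hbβ : b ≤ β) (hη : η ≤ 1) (ht : 0 < t) (ht1 : t ≤ 1) (hηt : η ≤ t / (2 * δ))
    (hγ : 0 ≤ γ) (hsmall : 2 * γ + (Λ + T * (3 + 1 / σ + 1 / (2 * σ ^ 2))) * η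
      < b * (σ ^ 2 * t ^ 2 / (4 * (T ^ 2 + 1) * (2 + σ ^ 2)
        * ((5 + 2 * T ^ 2) * (5 + 8 * δ ^ 2 * (5 + 3 * T ^ 2))))))
    (v : Fin N → ℝ) (hv : t < |δ * msq n v - δ * (τ ^ 2 - σ ^ 2)|) :
    β ^ 2 / 2 + lam * p + 2 * γ * (1 + Real.sqrt (msq n v)) <
      (max (Real.sqrt (σ ^ 2 + msq n v) * (euc (fun i => H (.inl i)) / Real.sqrt n)
        - (1 / (n : ℝ)) * ∑ j, H (.inr (some j)) * v j + σ * H (.inr none) / Real.sqrt n) 0) ^ 2 / 2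
      + lam * penGap n θ v := by
  set ws : Fin N → ℝ := fun j => w j (H (.inr (some j))) with hws
  set m := msq n v with hm
  set ms := msq n ws with hms
  set S := Real.sqrt (σ ^ 2 + m) with hS
  set B := (1 / (n : ℝ)) * ∑ j, ws j * v j with hB
  set q := (1 / (n : ℝ)) * ∑ j, H (.inr (some j)) * v j with hq
  set qs := (1 / (n : ℝ)) * ∑ j, H (.inr (some j)) * ws j with hqs
  set G := euc (fun i => H (.inl i)) / Real.sqrt n
  set e := σ * H (.inr none) / Real.sqrt n
  have hτ := hfp.τ_pos
  have hm0 : 0 ≤ m := msq_nonneg _ _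
  have hms0 : 0 ≤ ms := msq_nonneg _ _
  have hBm : B ^ 2 ≤ ms * m := sq_sum_mul_le_msq _ _
  have hD : 0 ≤ ms + m - 2 * B := by
    rw [hB, hms, hm, ← msq_sub]; exact msq_nonneg _ _
  have hsub : β / τ * (τ * q - τ * qs - B + ms) ≤ lam * (penGap n θ v - penGap n θ ws) := by
    have e1 : β / τ * (τ * q - τ * qs - B + ms) = (1 / (n : ℝ)) * ∑ j,
        β / τ * ((τ * H (.inr (some j)) - ws j) * (v j - ws j)) := by
      have : ∀ j, β / τ * ((τ * H (.inr (some j)) - ws j) * (v j - ws j))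
          = β / τ * (τ * (H (.inr (some j)) * v j) - τ * (H (.inr (some j)) * ws j)
            - ws j * v j + ws j ^ 2) := fun j => by ring
      simp_rw [this, ← Finset.mul_sum, Finset.sum_add_distrib, Finset.sum_sub_distrib,
        ← Finset.mul_sum]
      rw [hq, hqs, hB, hms, msq]; ring
    have e2 : lam * (penGap n θ v - penGap n θ ws) = (1 / (n : ℝ)) * ∑ j,
        lam * (|v j + θ j| - |ws j + θ j|) := by
      simp only [penGap, ← Finset.mul_sum, Finset.sum_sub_distrib]; ring
    rw [e1, e2]
    exact mul_le_mul_of_nonneg_left (Finset.sum_le_sum fun j _ => hfp.sub j _ _) (by positivity)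
  have lb := primal_lower_bound (S := S) hσ hfp.sigma_le_tau hT hfp.β_pos hfp.beta_le_tau hlam hΛ hη
    (h.one_sub_le_norm hη) h.shift h.risk h.corr h.penalty hsub hBm hm0 hms0 hD hS
  have gr := sq_mul_one_add_le hδ hη ht ht1 hηt h.risk (B := B) (m := m) (T := T)
    (by nlinarith [sq_nonneg σ, hτ.le.trans hT]) hms0 hBm hm0 hD hv
  set D := ms + m - 2 * B with hDdef
  set K1 := Λ + T * (3 + 1 / σ + 1 / (2 * σ ^ 2)) with hK1
  set K2 := (5 + 2 * T ^ 2) * (5 + 8 * δ ^ 2 * (5 + 3 * T ^ 2)) with hK2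
  set x := S * G - q + e with hx
  have hS0 : 0 < S := by rw [hS]; positivity
  have hS2 : S ^ 2 = σ ^ 2 + m := by rw [hS, Real.sq_sqrt (by positivity)]
  have hK20 : 0 < K2 := by rw [hK2]; positivity
  have c1 : (1 + S) * S ≤ 2 * (2 + σ ^ 2) * (1 + m) := by
    have h1 := mul_nonneg (sq_nonneg σ) hm0
    nlinarith only [sq_nonneg (S - 1), h1, hS2, hm0, sq_nonneg σ]
  have c2 : σ ^ 2 * t ^ 2 / (4 * (T ^ 2 + 1) * (2 + σ ^ 2) * K2) * (1 + S)
      ≤ σ ^ 2 * D / (2 * (T ^ 2 + 1) * S) := by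
    rw [div_mul_eq_mul_div, div_le_div_iff₀ (by positivity) (by positivity)]
    have a1 : t ^ 2 * ((1 + S) * S) ≤ t ^ 2 * (2 * (2 + σ ^ 2) * (1 + m)) := by gcongr
    have a2 : t ^ 2 * (2 * (2 + σ ^ 2) * (1 + m)) ≤ 2 * (2 + σ ^ 2) * (K2 * D) := by
      have := mul_le_mul_of_nonneg_left gr (by positivity : 0 ≤ 2 * (2 + σ ^ 2))
      linarith
    have a3 := mul_le_mul_of_nonneg_left (a1.trans a2)
      (by positivity : 0 ≤ σ ^ 2 * (2 * (T ^ 2 + 1)))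
    linarith
  have c3 : (2 * γ + K1 * η) * (1 + S) < β * (σ ^ 2 * D / (2 * (T ^ 2 + 1) * S)) := by
    calc _ < b * (σ ^ 2 * t ^ 2 / (4 * (T ^ 2 + 1) * (2 + σ ^ 2) * K2)) * (1 + S) := by
          gcongr
      _ = b * (σ ^ 2 * t ^ 2 / (4 * (T ^ 2 + 1) * (2 + σ ^ 2) * K2) * (1 + S)) := by ring
      _ ≤ b * (σ ^ 2 * D / (2 * (T ^ 2 + 1) * S)) := by gcongr
      _ ≤ _ := by gcongr
  have c4 : β * x - β ^ 2 / 2 ≤ (max x 0) ^ 2 / 2 := by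
    have : β * x ≤ β * max x 0 := mul_le_mul_of_nonneg_left (le_max_left _ _) hfp.β_pos.le
    nlinarith [sq_nonneg (β - max x 0)]
  have c5 : 2 * γ * (1 + Real.sqrt m) ≤ 2 * γ * (1 + S) := by
    gcongr; rw [hS]; exact Real.sqrt_le_sqrt (by nlinarith [sq_nonneg σ])
  linarith only [lb, c3, c4, c5]

lemma dual (h : GoodEvent n σ θ β τ w p η H) (hfp : FixedPoint n σ θ lam β τ w)
    {T Λ : ℝ} (hσ : 0 < σ) (hlam : 0 < lam) (hΛ : lam ≤ Λ) (hT : τ ≤ T) (hη : η ≤ 1) (a : ℝ) :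
    a * (Real.sqrt (σ ^ 2 + msq n (fun j => w j (H (.inr (some j)))))
        * (euc (fun i => H (.inl i)) / Real.sqrt n)
        - (1 / (n : ℝ)) * ∑ j, H (.inr (some j)) * w j (H (.inr (some j)))
        + σ * H (.inr none) / Real.sqrt n) - a ^ 2 / 2
      + lam * penGap n θ (fun j => w j (H (.inr (some j))))
    ≤ β ^ 2 / 2 + lam * p
      + (((T ^ 2 + 2) / σ + 2) * (2 * T + ((T ^ 2 + 2) / σ + 2)) / 2 + Λ) * η := by
  set ms := msq n (fun j => w j (H (.inr (some j)))) with hms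
  set R := Real.sqrt (σ ^ 2 + ms) with hR
  set G := euc (fun i => H (.inl i)) / Real.sqrt n
  set qs := (1 / (n : ℝ)) * ∑ j, H (.inr (some j)) * w j (H (.inr (some j)))
  set e := σ * H (.inr none) / Real.sqrt n
  set ps := penGap n θ (fun j => w j (H (.inr (some j))))
  set K := (T ^ 2 + 2) / σ + 2 with hK
  have hτ := hfp.τ_pos
  have hT0 : 0 < T := hτ.trans_le hT
  have hη0 : 0 ≤ η := (abs_nonneg _).trans h.noise
  have hms0 : 0 ≤ ms := msq_nonneg _ _
  have hR2 : R ^ 2 = σ ^ 2 + ms := by rw [hR, Real.sq_sqrt (by positivity)]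
  have hG0 : 0 ≤ G := div_nonneg (euc_nonneg _) (by positivity)
  have hR0 : 0 ≤ R := Real.sqrt_nonneg _
  have hRτ : |R ^ 2 - τ ^ 2| ≤ η := by
    rw [hR2]
    have : σ ^ 2 + ms - τ ^ 2 = ms - (τ ^ 2 - σ ^ 2) := by ring
    rw [this]; exact h.risk
  have hRT : R ^ 2 ≤ T ^ 2 + 1 := by
    have := (abs_le.1 hRτ).2
    have : τ ^ 2 ≤ T ^ 2 := by gcongr
    linarith
  have h1 : |(R * G) ^ 2 - τ ^ 2| ≤ (T ^ 2 + 2) * η := by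
    have e1 : (R * G) ^ 2 - τ ^ 2 = R ^ 2 * (G ^ 2 - 1) + (R ^ 2 - τ ^ 2) := by ring
    rw [e1]
    calc _ ≤ |R ^ 2 * (G ^ 2 - 1)| + |R ^ 2 - τ ^ 2| := abs_add_le _ _
      _ ≤ (T ^ 2 + 1) * η + η := by
        rw [abs_mul, abs_of_nonneg (sq_nonneg R)]
        gcongr
        exact h.sq_norm
      _ = _ := by ring
  have h2 : |R * G - τ| ≤ (T ^ 2 + 2) / σ * η := by
    rw [div_mul_eq_mul_div, le_div_iff₀ hσ]
    refine le_trans ?_ h1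
    have e2 : (R * G) ^ 2 - τ ^ 2 = (R * G - τ) * (R * G + τ) := by ring
    rw [e2, abs_mul]
    have h3 : σ ≤ |R * G + τ| := by
      rw [abs_of_nonneg (by positivity)]
      nlinarith [hfp.sigma_le_tau, mul_nonneg hR0 hG0]
    gcongr
  set y := R * G - qs + e with hy
  have h3 : |y - β| ≤ K * η := by
    have e3 : y - β = (R * G - τ) + (-(qs - (τ - β)) + e) := by rw [hy]; ring
    rw [e3]
    refine (abs_add_le _ _).trans ?_
    have h4 : |-(qs - (τ - β)) + e| ≤ η + η := by
      refine (abs_add_le _ _).trans ?_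
      rw [abs_neg]
      exact add_le_add h.corr h.shift
    rw [hK]; linarith
  have hK0 : 0 < K := by positivity
  have h5 : y ^ 2 / 2 ≤ β ^ 2 / 2 + K * (2 * T + K) / 2 * η := by
    have hKη : K * η ≤ K := by nlinarith
    have h6 : y ≤ β + K * η := by linarith [(abs_le.1 h3).2]
    have h7 : -(β + K * η) ≤ y := by linarith [(abs_le.1 h3).1, hfp.β_pos]
    have h8 : y ^ 2 ≤ (β + K * η) ^ 2 := sq_le_sq' h7 h6
    have hβT : β ≤ T := hfp.beta_le_tau.trans hT
    have h9 : β * (K * η) ≤ T * (K * η) := by gcongr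
    have h10 : (K * η) * (K * η) ≤ K * (K * η) := by gcongr
    linarith
  have h11 : a * y - a ^ 2 / 2 ≤ y ^ 2 / 2 := by nlinarith [sq_nonneg (a - y)]
  have h12 : lam * ps ≤ lam * p + Λ * η := by
    have q1 : lam * ps ≤ lam * (p + η) :=
      mul_le_mul_of_nonneg_left (by linarith [(abs_le.1 h.penalty).2]) hlam.le
    have q2 : lam * η ≤ Λ * η := by gcongr
    linarith
  linarith only [h5, h11, h12]

end GoodEvent

/-- The residual of the Lasso at error vector `w`, driven by the Gaussian matrix `G`. -/
def resid {n N : ℕ} (σ : ℝ) (G : Fin n × Option (Fin N) → ℝ) (w : Fin N → ℝ) (i : Fin n) : ℝ :=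
  σ * G (i, none) - (∑ j, G (i, some j) * w j) / Real.sqrt n

/-- The Lasso cost at error vector `w`, shifted by its penalty at `θ`. -/
def errCost {n N : ℕ} (σ : ℝ) (θ : Fin N → ℝ) (lam : ℝ) (G : Fin n × Option (Fin N) → ℝ)
    (w : Fin N → ℝ) : ℝ :=
  (1 / (2 * (n : ℝ))) * ∑ i, resid σ G w i ^ 2 + lam * penGap n θ w

/-- The vector multiplying the rows of the Gaussian matrix in the residual at `w`. -/
def liftVec {N : ℕ} (n : ℕ) (σ : ℝ) (w : Fin N → ℝ) (q : Option (Fin N)) : ℝ :=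
  q.elim σ fun j => -(w j / Real.sqrt n)

lemma continuous_msq {N : ℕ} (n : ℕ) : Continuous (msq n : (Fin N → ℝ) → ℝ) := by
  unfold msq; fun_prop

lemma continuous_penGap {N : ℕ} (n : ℕ) (θ : Fin N → ℝ) : Continuous (penGap n θ) := by
  unfold penGap; fun_prop

lemma continuous_euc {κ : Type*} [Fintype κ] : Continuous (euc : (κ → ℝ) → ℝ) := by
  unfold euc; fun_prop

lemma continuous_liftVec {N : ℕ} (n : ℕ) (σ : ℝ) :
    Continuous (liftVec n σ : (Fin N → ℝ) → Option (Fin N) → ℝ) := by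
  refine continuous_pi fun q => ?_
  cases q with
  | none => exact continuous_const
  | some j => simp only [liftVec, Option.elim]; fun_prop

lemma continuous_resid {n N : ℕ} (σ : ℝ) (G : Fin n × Option (Fin N) → ℝ) (i : Fin n) :
    Continuous (fun w => resid σ G w i) := by
  unfold resid; fun_prop

lemma continuous_errCost {n N : ℕ} (σ : ℝ) (θ : Fin N → ℝ) (lam : ℝ)
    (G : Fin n × Option (Fin N) → ℝ) : Continuous (errCost σ θ lam G) := by
  have h1 := fun i => continuous_resid σ G i
  have h2 := continuous_penGap n θ
  unfold errCost; fun_prop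

lemma sum_liftVec_mul {n N : ℕ} (σ : ℝ) (w : Fin N → ℝ) (f : Option (Fin N) → ℝ) :
    ∑ q, liftVec n σ w q * f q = σ * f none - (∑ j, f (some j) * w j) / Real.sqrt n := by
  simp only [Fintype.sum_option, liftVec, Option.elim, Finset.sum_div, sub_eq_add_neg,
    ← Finset.sum_neg_distrib]
  congr 1
  exact Finset.sum_congr rfl fun j _ => by ring

lemma euc_liftVec {n N : ℕ} (σ : ℝ) (w : Fin N → ℝ) :
    euc (liftVec n σ w) = Real.sqrt (σ ^ 2 + msq n w) := by
  rw [← Real.sqrt_sq (euc_nonneg _), euc_sq]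
  congr 1
  simp only [Fintype.sum_option, liftVec, Option.elim, msq, neg_sq, div_pow,
    Real.sq_sqrt (Nat.cast_nonneg n), ← Finset.sum_div]
  ring

lemma sum_sum_liftVec {n N : ℕ} (σ : ℝ) (w : Fin N → ℝ) (u : Fin n → ℝ)
    (G : Fin n × Option (Fin N) → ℝ) :
    ∑ p, ∑ q, u p * liftVec n σ w q * G (p, q) = ∑ p, u p * resid σ G w p := by
  refine Finset.sum_congr rfl fun p _ => ?_
  simp only [mul_assoc, ← Finset.mul_sum]
  rw [sum_liftVec_mul σ w (fun q => G (p, q)), resid]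

/-- The Gaussian comparison for lower bounds on the Lasso cost over an open set. -/
lemma gaussPi_exists_errCost_lt_le {n N : ℕ} (hn : 0 < n) (σ : ℝ) (θ : Fin N → ℝ) (lam : ℝ)
    {S : Set (Fin N → ℝ)} (hS : IsOpen S) {Φ : (Fin N → ℝ) → ℝ} (hΦ : Continuous Φ)
    (E : Set (Fin n ⊕ Option (Fin N) → ℝ))
    (hpos : ∀ H ∈ E, 0 < euc (fun i => H (.inl i)))
    (hE : ∀ H ∈ E, ∀ w ∈ S, Φ w <
      (max (Real.sqrt (σ ^ 2 + msq n w) * (euc (fun i => H (.inl i)) / Real.sqrt n)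
        - (1 / (n : ℝ)) * ∑ j, H (.inr (some j)) * w j + σ * H (.inr none) / Real.sqrt n) 0) ^ 2 / 2
      + lam * penGap n θ w) :
    gaussPi (Fin n × Option (Fin N)) {G | ∃ w ∈ S, errCost σ θ lam G w < Φ w}
      ≤ 2 * gaussPi (Fin n ⊕ Option (Fin N)) Eᶜ := by
  have hn' : (0 : ℝ) < n := by exact_mod_cast hn
  let W := TopologicalSpace.denseSeq (Fin N → ℝ)
  let U := TopologicalSpace.denseSeq (Fin n → ℝ)
  let I := {k : ℕ // W k ∈ S ∧ lam * penGap n θ (W k) ≤ Φ (W k)}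
  have key := gordon_bilinear (I := I) (J := ℕ) (P := Fin n) (Q := Option (Fin N)) 1 (by norm_num)
    (fun _ j => U j) (fun k _ => liftVec n σ (W k)) (Or.inr fun _ _ _ => rfl)
    (fun k j => euc (U j) * Real.sqrt (2 * n * (Φ (W k) - lam * penGap n θ (W k))))
  refine (measure_mono ?_).trans (key.trans (mul_le_mul_right (measure_mono ?_) 2))
  · rintro G ⟨w, hw, hlt⟩
    have hop : IsOpen (S ∩ {w | errCost σ θ lam G w < Φ w}) :=
      hS.inter (isOpen_lt (continuous_errCost σ θ lam G) hΦ)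
    obtain ⟨_, ⟨hk, hk'⟩, k, rfl⟩ :=
      (TopologicalSpace.denseRange_denseSeq (Fin N → ℝ)).inter_open_nonempty _ hop ⟨w, hw, hlt⟩
    have hk2 : (1 / (2 * (n : ℝ))) * ∑ i, resid σ G (W k) i ^ 2
        < Φ (W k) - lam * penGap n θ (W k) := by
      have : errCost σ θ lam G (W k) < Φ (W k) := hk'
      rw [errCost] at this
      linarith
    have h0 : 0 ≤ (1 / (2 * (n : ℝ))) * ∑ i, resid σ G (W k) i ^ 2 := by positivity
    refine ⟨⟨k, hk, by linarith⟩, fun j => ?_⟩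
    simp only [one_mul]
    rw [sum_sum_liftVec]
    refine (sum_mul_le_euc _ _).trans ?_
    refine mul_le_mul_of_nonneg_left ?_ (euc_nonneg _)
    refine Real.le_sqrt_of_sq_le ?_
    rw [euc_sq]
    have h3 := mul_le_mul_of_nonneg_left hk2.le (by positivity : 0 ≤ 2 * (n : ℝ))
    have h4 : 2 * (n : ℝ) * ((1 / (2 * (n : ℝ))) * ∑ i, resid σ G (W k) i ^ 2)
        = ∑ i, resid σ G (W k) i ^ 2 := by field_simp
    linarith
  · rintro H ⟨⟨k, hk, hk'⟩, hH⟩ hHE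
    simp only [one_mul] at hH
    set g : Fin n → ℝ := fun i => H (.inl i) with hg
    set v := liftVec n σ (W k) with hv
    set Γ := Φ (W k) - lam * penGap n θ (W k) with hΓ
    have hall : ∀ u : Fin n → ℝ, euc v * ∑ p, u p * H (.inl p) + euc u * ∑ q, v q * H (.inr q)
        ≤ euc u * Real.sqrt (2 * n * Γ) := by
      have hcl : IsClosed {u : Fin n → ℝ | euc v * ∑ p, u p * H (.inl p)
          + euc u * ∑ q, v q * H (.inr q) ≤ euc u * Real.sqrt (2 * n * Γ)} := by
        have := continuous_euc (κ := Fin n)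
        exact isClosed_le (by fun_prop) (by fun_prop)
      intro u
      exact (hcl.closure_subset_iff.2 (Set.range_subset_iff.2 fun j => hH j))
        ((TopologicalSpace.denseRange_denseSeq (Fin n → ℝ)) u)
    have h1 := hall g
    have hgpos : 0 < euc g := hpos H hHE
    have h2 : ∑ p, g p * H (.inl p) = euc g * euc g := by
      rw [← sq, euc_sq]; exact Finset.sum_congr rfl fun p _ => by rw [hg]; ring
    have h3 : euc v * euc g + ∑ q, v q * H (.inr q) ≤ Real.sqrt (2 * n * Γ) := by
      rw [h2] at h1
      refine le_of_mul_le_mul_left ?_ hgpos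
      linarith
    have h4 := hE H hHE (W k) hk
    rw [hv, sum_liftVec_mul σ (W k) (fun q => H (.inr q)), ← hv] at h3
    have hΓ0 : 0 ≤ Γ := by rw [hΓ]; linarith
    set x := Real.sqrt (σ ^ 2 + msq n (W k)) * (euc (fun i => H (.inl i)) / Real.sqrt n)
        - (1 / (n : ℝ)) * ∑ j, H (.inr (some j)) * W k j + σ * H (.inr none) / Real.sqrt n with hx
    have hs : Real.sqrt n * Real.sqrt n = n := Real.mul_self_sqrt hn'.le
    have hs0 : 0 < Real.sqrt n := Real.sqrt_pos.2 hn'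
    have h5 : x * Real.sqrt n = euc v * euc g + (σ * H (.inr none)
        - (∑ j, H (.inr (some j)) * W k j) / Real.sqrt n) := by
      have hone : 1 / (n : ℝ) = 1 / (Real.sqrt n * Real.sqrt n) := by rw [hs]
      rw [hx, hv, euc_liftVec, ← hg, hone]
      field_simp
      ring
    have h6 : max x 0 * Real.sqrt n ≤ Real.sqrt (2 * n * Γ) := by
      rcases le_total x 0 with h | h
      · rw [max_eq_right h, zero_mul]; exact Real.sqrt_nonneg _
      · rw [max_eq_left h, h5]; exact h3
    have h7 : (max x 0 * Real.sqrt n) ^ 2 ≤ 2 * n * Γ := by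
      rw [← Real.sq_sqrt (by positivity : 0 ≤ 2 * (n : ℝ) * Γ)]
      gcongr
    rw [mul_pow, Real.sq_sqrt hn'.le] at h7
    have h8 : max x 0 ^ 2 ≤ 2 * Γ := by
      refine le_of_mul_le_mul_right ?_ hn'
      linarith
    linarith

lemma resid_segment {n N : ℕ} (σ : ℝ) (G : Fin n × Option (Fin N) → ℝ) (v w : Fin N → ℝ) (s : ℝ)
    (i : Fin n) : resid σ G (fun j => v j + s * (w j - v j)) i
      = resid σ G v i + s * (resid σ G w i - resid σ G v i) := by
  have : ∑ j, G (i, some j) * (v j + s * (w j - v j))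
      = ∑ j, G (i, some j) * v j + s * (∑ j, G (i, some j) * w j - ∑ j, G (i, some j) * v j) := by
    rw [← Finset.sum_sub_distrib, Finset.mul_sum, ← Finset.sum_add_distrib]
    exact Finset.sum_congr rfl fun j _ => by ring
  rw [resid, resid, resid, this]
  ring

lemma penGap_segment_le {n N : ℕ} (θ v w : Fin N → ℝ) {s : ℝ} (hs : 0 ≤ s) (hs1 : s ≤ 1) :
    penGap n θ (fun j => v j + s * (w j - v j))
      ≤ penGap n θ v + s * (penGap n θ w - penGap n θ v) := by
  have e : penGap n θ v + s * (penGap n θ w - penGap n θ v) = (1 / (n : ℝ)) *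
      ∑ j, ((|v j + θ j| - |θ j|) + s * ((|w j + θ j| - |θ j|) - (|v j + θ j| - |θ j|))) := by
    simp only [penGap, Finset.sum_add_distrib, ← Finset.mul_sum, Finset.sum_sub_distrib]
    ring
  rw [e, penGap]
  refine mul_le_mul_of_nonneg_left (Finset.sum_le_sum fun j _ => ?_) (by positivity)
  have h1 : v j + s * (w j - v j) + θ j = (1 - s) * (v j + θ j) + s * (w j + θ j) := by ring
  have h2 := abs_add_le ((1 - s) * (v j + θ j)) (s * (w j + θ j))
  rw [abs_mul, abs_mul, abs_of_nonneg hs, abs_of_nonneg (by linarith : 0 ≤ 1 - s)] at h2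
  rw [h1]
  linarith

/-- First-order optimality of a minimizer of the Lasso cost, in variational form. -/
lemma errCost_le_of_forall_le {n N : ℕ} (hn : 0 < n) {σ : ℝ} {θ : Fin N → ℝ} {lam : ℝ}
    (hlam : 0 ≤ lam) {G : Fin n × Option (Fin N) → ℝ} {v : Fin N → ℝ}
    (hv : ∀ w, errCost σ θ lam G v ≤ errCost σ θ lam G w) (w : Fin N → ℝ) :
    n * errCost σ θ lam G v ≤ ∑ i, resid σ G v i * resid σ G w i
      - (∑ i, resid σ G v i ^ 2) / 2 + n * (lam * penGap n θ w) := by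
  have hn' : (0 : ℝ) < n := by exact_mod_cast hn
  set A := ∑ i, resid σ G v i ^ 2 with hA
  set B := ∑ i, resid σ G v i * resid σ G w i with hB
  set Q := ∑ i, (resid σ G w i - resid σ G v i) ^ 2 with hQ
  have hcost : ∀ w', n * errCost σ θ lam G w'
      = (∑ i, resid σ G w' i ^ 2) / 2 + n * (lam * penGap n θ w') := fun w' => by
    rw [errCost]; field_simp
  have hseg : ∀ s : ℝ, 0 < s → s ≤ 1 →
      0 ≤ (B - A) + s * (Q / 2) + n * (lam * (penGap n θ w - penGap n θ v)) := by
    intro s hs hs1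
    have h1 := mul_le_mul_of_nonneg_left (hv (fun j => v j + s * (w j - v j))) hn'.le
    rw [hcost, hcost] at h1
    have h2 : ∑ i, resid σ G (fun j => v j + s * (w j - v j)) i ^ 2
        = A + 2 * s * (B - A) + s ^ 2 * Q := by
      rw [hA, hB, hQ, ← Finset.sum_sub_distrib, Finset.mul_sum, Finset.mul_sum,
        ← Finset.sum_add_distrib, ← Finset.sum_add_distrib]
      exact Finset.sum_congr rfl fun i _ => by rw [resid_segment]; ring
    have h3 := mul_le_mul_of_nonneg_left (mul_le_mul_of_nonneg_left
      (penGap_segment_le (n := n) θ v w hs.le hs1) hlam) hn'.le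
    rw [h2] at h1
    refine nonneg_of_mul_nonneg_right (a := s) ?_ hs
    linarith
  have hlim : 0 ≤ (B - A) + n * (lam * (penGap n θ w - penGap n θ v)) := by
    have ht : Filter.Tendsto (fun s : ℝ => (B - A) + s * (Q / 2)
        + n * (lam * (penGap n θ w - penGap n θ v))) (nhdsWithin 0 (Set.Ioi 0))
        (nhds ((B - A) + 0 * (Q / 2) + n * (lam * (penGap n θ w - penGap n θ v)))) := by
      refine Filter.Tendsto.mono_left (Continuous.tendsto ?_ 0) nhdsWithin_le_nhds
      fun_prop
    have := ge_of_tendsto ht (b := 0) (by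
      filter_upwards [Ioc_mem_nhdsGT (show (0 : ℝ) < 1 by norm_num)] with s hs
      exact hseg s hs.1 hs.2)
    simpa using this
  rw [hcost]
  linarith

/-- The Gaussian comparison for upper bounds on the minimal Lasso cost. -/
lemma gaussPi_exists_lt_errCost_le {n N : ℕ} (hn : 0 < n) (σ : ℝ) (θ : Fin N → ℝ) {lam : ℝ}
    (hlam : 0 ≤ lam) (L R : ℝ) (E : Set (Fin n ⊕ Option (Fin N) → ℝ))
    (hE : ∀ H ∈ E, ∃ w ∈ Metric.ball (0 : Fin N → ℝ) R, ∀ a : ℝ,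
      a * (Real.sqrt (σ ^ 2 + msq n w) * (euc (fun i => H (.inl i)) / Real.sqrt n)
        - (1 / (n : ℝ)) * ∑ j, H (.inr (some j)) * w j + σ * H (.inr none) / Real.sqrt n)
        - a ^ 2 / 2 + lam * penGap n θ w < L) :
    gaussPi (Fin n × Option (Fin N))
        {G | ∃ v, (∀ w, errCost σ θ lam G v ≤ errCost σ θ lam G w) ∧ L < errCost σ θ lam G v}
      ≤ 2 * gaussPi (Fin n ⊕ Option (Fin N)) Eᶜ := by
  have hn' : (0 : ℝ) < n := by exact_mod_cast hn
  let W := TopologicalSpace.denseSeq (Fin N → ℝ)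
  let U := TopologicalSpace.denseSeq (Fin n → ℝ)
  let J := {k : ℕ // W k ∈ Metric.ball (0 : Fin N → ℝ) R}
  have key := gordon_bilinear (I := ℕ) (J := J) (P := Fin n) (Q := Option (Fin N)) (-1)
    (by norm_num) (fun i _ => U i) (fun _ k => liftVec n σ (W k)) (Or.inl fun _ _ _ => rfl)
    (fun i k => -(n * L + euc (U i) ^ 2 / 2 - n * (lam * penGap n θ (W k))))
  refine (measure_mono ?_).trans (key.trans (mul_le_mul_right (measure_mono ?_) 2))
  · rintro G ⟨v, hv, hlt⟩
    have hr : ∀ᶠ u in nhds (resid σ G v), ∀ w ∈ Metric.closedBall (0 : Fin N → ℝ) R,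
        n * L < ∑ i, u i * resid σ G w i - (∑ i, u i ^ 2) / 2 + n * (lam * penGap n θ w) := by
      refine (isCompact_closedBall _ _).eventually_forall_of_forall_eventually fun w _ => ?_
      have h1 : n * L < ∑ i, resid σ G v i * resid σ G w i
          - (∑ i, resid σ G v i ^ 2) / 2 + n * (lam * penGap n θ w) :=
        (mul_lt_mul_of_pos_left hlt hn').trans_le (errCost_le_of_forall_le hn hlam hv w)
      have hc : Continuous fun x : (Fin n → ℝ) × (Fin N → ℝ) => ∑ i, x.1 i * resid σ G x.2 i
          - (∑ i, x.1 i ^ 2) / 2 + n * (lam * penGap n θ x.2) := by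
        have c1 := fun i => (continuous_resid σ G i).comp
          (continuous_snd (X := Fin n → ℝ) (Y := Fin N → ℝ))
        have c2 := (continuous_penGap n θ).comp
          (continuous_snd (X := Fin n → ℝ) (Y := Fin N → ℝ))
        simp only [Function.comp_def] at c1 c2
        fun_prop
      exact hc.continuousAt.eventually (lt_mem_nhds h1)
    obtain ⟨_, ⟨i, rfl⟩, hi⟩ := (TopologicalSpace.denseRange_denseSeq
      (Fin n → ℝ)).inter_nhds_nonempty hr
    refine ⟨i, fun k => ?_⟩
    have := hi (W k) (Metric.ball_subset_closedBall k.2)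
    rw [sum_sum_liftVec, euc_sq]
    linarith
  · rintro H ⟨i, hH⟩ hHE
    obtain ⟨w, hw, hwL⟩ := hE H hHE
    set u := U i with hu
    have hcl : IsClosed {w : Fin N → ℝ | -1 * (euc (liftVec n σ w) * ∑ p, u p * H (.inl p)
          + euc u * ∑ q, liftVec n σ w q * H (.inr q))
          ≤ -(n * L + euc u ^ 2 / 2 - n * (lam * penGap n θ w))} := by
      have c1 := continuous_euc.comp (continuous_liftVec (N := N) n σ)
      have c2 := fun q => (continuous_apply q).comp (continuous_liftVec (N := N) n σ)
      have c3 := continuous_penGap n θ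
      simp only [Function.comp_def] at c1 c2
      exact isClosed_le (by fun_prop) (by fun_prop)
    have hw' : w ∈ closure (Metric.ball (0 : Fin N → ℝ) R ∩ Set.range W) :=
      (TopologicalSpace.denseRange_denseSeq (Fin N → ℝ)).open_subset_closure_inter
        Metric.isOpen_ball hw
    have h1 := hcl.closure_subset_iff.2 (by
      rintro _ ⟨hk, k, rfl⟩
      exact hH ⟨k, hk⟩) hw'
    simp only [Set.mem_ofPred_eq] at h1
    rw [euc_liftVec, sum_liftVec_mul σ w (fun q => H (.inr q))] at h1
    have h2 := hwL (euc u / Real.sqrt n)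
    have h3 := sum_mul_le_euc u (fun i => H (.inl i))
    have h4 := mul_le_mul_of_nonneg_left h3 (Real.sqrt_nonneg (σ ^ 2 + msq n w))
    have hs : Real.sqrt n * Real.sqrt n = n := Real.mul_self_sqrt hn'.le
    have hs0 : 0 < Real.sqrt n := Real.sqrt_pos.2 hn'
    have h5 := mul_lt_mul_of_pos_left h2 hn'
    have h6 : (n : ℝ) * (euc u / Real.sqrt n * (Real.sqrt (σ ^ 2 + msq n w)
        * (euc (fun i => H (.inl i)) / Real.sqrt n)
        - (1 / (n : ℝ)) * ∑ j, H (.inr (some j)) * w j + σ * H (.inr none) / Real.sqrt n)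
        - (euc u / Real.sqrt n) ^ 2 / 2 + lam * penGap n θ w)
        = Real.sqrt (σ ^ 2 + msq n w) * (euc u * euc (fun i => H (.inl i)))
          + euc u * (σ * H (.inr none) - (∑ j, H (.inr (some j)) * w j) / Real.sqrt n)
          - euc u ^ 2 / 2 + n * (lam * penGap n θ w) := by
      rw [div_pow, Real.sq_sqrt hn'.le]
      have hone : (n : ℝ) * (1 / n) = 1 := by field_simp
      have e : ∀ a b c d e f : ℝ, (n : ℝ) * (a / Real.sqrt n * (b * (c / Real.sqrt n)
          - (1 / (n : ℝ)) * d + e / Real.sqrt n) - a ^ 2 / n / 2 + f)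
          = Real.sqrt n * Real.sqrt n * (a / Real.sqrt n * (b * (c / Real.sqrt n)
            + e / Real.sqrt n)) - (n * (1 / n)) * (a / Real.sqrt n * d)
            - (n * (1 / n)) * (a ^ 2 / 2) + n * f := fun a b c d e f => by rw [hs]; ring
      rw [e, hone]
      field_simp
      ring
    rw [h6] at h5
    linarith

/-- Concentration of separable functions of the comparison Gaussian vector, normalized by `n`. -/
lemma exists_concentration_sum {δ : ℝ} (hδ : 0 < δ) {K : ℝ} (hK : 0 < K) : ∃ c : ℝ, 0 < c ∧
    ∀ (N n : ℕ), 0 < N → (n : ℝ) = δ * N → ∀ F : Fin n ⊕ Option (Fin N) → ℝ → ℝ,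
      (∀ k, Measurable (F k)) → (∀ k x, |F k x| ≤ K * (1 + x ^ 2)) → ∀ η : ℝ, 0 < η → η ≤ 1 →
      gaussPi (Fin n ⊕ Option (Fin N))
        {H | η < |(1 / (n : ℝ)) * (∑ k, (F k (H k) - ∫ y, F k y ∂(gaussianReal 0 1)))|}
      ≤ ENNReal.ofReal (2 * Real.exp (-c * N * η ^ 2)) := by
  obtain ⟨c, hc, h⟩ := exists_concentration K hK
  refine ⟨c * (δ ^ 2 / (δ + 2)), by positivity, fun N n hN hn F hFm hFb η hη hη1 => ?_⟩
  have hN' : (0 : ℝ) < N := by exact_mod_cast hN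
  have hN1 : (1 : ℝ) ≤ N := by exact_mod_cast hN
  have hn' : (0 : ℝ) < n := by rw [hn]; positivity
  have hcard : (Fintype.card (Fin n ⊕ Option (Fin N)) : ℝ) ≤ (δ + 2) * N := by
    simp only [Fintype.card_sum, Fintype.card_option, Fintype.card_fin]
    push_cast
    rw [hn]; linarith
  have h1 := h _ F hFm hFb ((δ + 2) * N) (δ / (δ + 2) * η) hcard (by positivity) (by
    have : δ / (δ + 2) ≤ 1 := by rw [div_le_one (by positivity)]; linarith
    have h0 : 0 ≤ δ / (δ + 2) := by positivity
    nlinarith)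
  refine (measure_mono fun H hH => ?_).trans (h1.trans_eq ?_)
  · simp only [Set.mem_ofPred_eq] at hH ⊢
    rw [abs_mul, abs_of_pos (by positivity : 0 < 1 / (n : ℝ)), one_div, inv_mul_eq_div,
      lt_div_iff₀ hn'] at hH
    refine le_trans (le_of_eq ?_) hH.le
    rw [hn]; field_simp
  · congr 3
    field_simp

/-- Gaussian tail bound for a single coordinate. -/
lemma gaussPi_lt_abs_le {κ : Type*} [Fintype κ] (k : κ) {x : ℝ} (hx : 0 ≤ x) :
    gaussPi κ {H | x < |H k|} ≤ ENNReal.ofReal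
      ((∫ y, Real.exp ((1 + y ^ 2) / 4) ∂(gaussianReal 0 1)) * Real.exp (-x ^ 2 / 4)) := by
  have hmp : MeasurePreserving (Function.eval k) (gaussPi κ) (gaussianReal 0 1) :=
    measurePreserving_eval _ k
  have hms : MeasurableSet {y : ℝ | x < |y|} := measurableSet_lt measurable_const (by fun_prop)
  have h1 : gaussPi κ {H | x < |H k|} = gaussianReal 0 1 {y : ℝ | x < |y|} :=
    hmp.measure_preimage hms.nullMeasurableSet
  rw [h1, ← ofReal_measureReal]
  refine ENNReal.ofReal_le_ofReal ?_
  have h2 := mul_meas_ge_le_integral_of_nonneg (μ := gaussianReal 0 1)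
    (ae_of_all _ fun y => (Real.exp_pos ((1 + y ^ 2) / 4)).le) integrable_exp_sq_std
    (Real.exp (x ^ 2 / 4))
  have h3 : (gaussianReal 0 1).real {y : ℝ | x < |y|}
      ≤ (gaussianReal 0 1).real {y : ℝ | Real.exp (x ^ 2 / 4) ≤ Real.exp ((1 + y ^ 2) / 4)} := by
    refine measureReal_mono fun y hy => ?_
    have h4 : x < |y| := hy
    have h5 : x ^ 2 ≤ y ^ 2 := by rw [← sq_abs y]; gcongr
    exact Real.exp_le_exp.2 (by linarith)
  rw [neg_div, Real.exp_neg, ← div_eq_mul_inv, le_div_iff₀' (Real.exp_pos _)]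
  exact (mul_le_mul_of_nonneg_left h3 (Real.exp_pos _).le).trans h2

lemma exists_goodEvent_prob {δ σ Λ b T : ℝ} (hδ : 0 < δ) (hσ : 0 < σ) (hΛ : 0 < Λ) (hb : 0 < b)
    (hT : 0 < T) : ∃ C c : ℝ, 0 < C ∧ 0 < c ∧
    ∀ (N n : ℕ) (θ : Fin N → ℝ) (lam β τ : ℝ) (w : Fin N → ℝ → ℝ), 0 < N → (n : ℝ) = δ * N →
      0 < lam → lam ≤ Λ → FixedPoint n σ θ lam β τ w → b ≤ β → τ ≤ T →
      ∀ η : ℝ, 0 < η → η ≤ 1 →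
      gaussPi (Fin n ⊕ Option (Fin N))
        {H | GoodEvent n σ θ β τ w (gavg n fun i z => |w i z + θ i| - |θ i|) η H}ᶜ
      ≤ ENNReal.ofReal (C * Real.exp (-c * N * η ^ 2)) := by
  set A := T + T * Λ / b with hA
  have hA0 : 0 < A := by positivity
  set K := 1 + 2 * A + 2 * A ^ 2 with hK
  obtain ⟨c, hc, hconc⟩ := exists_concentration_sum hδ (by positivity : 0 < K)
  set E := ∫ y, Real.exp ((1 + y ^ 2) / 4) ∂(gaussianReal 0 1) with hE
  have hE0 : 0 ≤ E := integral_nonneg fun y => (Real.exp_pos _).le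
  set c' := min c (δ / (4 * σ ^ 2)) with hc'
  refine ⟨8 + E, c', by positivity, lt_min hc (by positivity),
    fun N n θ lam β τ w hN hn hlam hlamΛ hfp hbβ hτT η hη hη1 => ?_⟩
  have hN' : (0 : ℝ) < N := by exact_mod_cast hN
  have hn' : (0 : ℝ) < n := by rw [hn]; positivity
  set p := gavg n fun i z => |w i z + θ i| - |θ i| with hp
  have hwb : ∀ j z, |w j z| ≤ A * (1 + |z|) := fun j z => by
    have h1 := hfp.growth j z
    have h0 := hfp.τ_pos
    have h2 : τ * lam / β ≤ T * Λ / b := by gcongr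
    have h3 : τ * |z| ≤ T * |z| := by gcongr
    have h4 : 0 ≤ T * Λ / b * |z| := by positivity
    rw [hA]; linarith
  have hbase : ∀ f : Fin N → ℝ → ℝ, (∀ j, Measurable (f j)) →
      (∀ j z, |f j z| ≤ K * (1 + z ^ 2)) →
      gaussPi (Fin n ⊕ Option (Fin N))
        {H | η < |(1 / (n : ℝ)) * ∑ j, f j (H (.inr (some j))) - gavg n f|}
      ≤ ENNReal.ofReal (2 * Real.exp (-c * N * η ^ 2)) := by
    intro f hfm hfb
    have := hconc N n hN hn (Sum.elim (fun _ _ => 0) (fun q => q.elim (fun _ => 0) f))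
      (by rintro (i | _ | j) <;> simp [hfm]) (by
        rintro (i | _ | j) x
        · simp only [Sum.elim_inl, abs_zero]; positivity
        · simp only [Sum.elim_inr, Option.elim, abs_zero]; positivity
        · exact hfb j x) η hη hη1
    refine le_trans (measure_mono fun H hH => ?_) this
    simp only [Set.mem_ofPred_eq] at hH ⊢
    simpa [Fintype.sum_sum_type, Fintype.sum_option, gavg, mul_sub, Finset.sum_sub_distrib]
      using hH
  have hnoise : gaussPi (Fin n ⊕ Option (Fin N))
      {H | η < |(1 / (n : ℝ)) * ∑ i, H (.inl i) ^ 2 - 1|}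
      ≤ ENNReal.ofReal (2 * Real.exp (-c * N * η ^ 2)) := by
    have := hconc N n hN hn (Sum.elim (fun _ x => x ^ 2) (fun _ _ => 0))
      (by rintro (i | q)
          · exact (by fun_prop : Measurable fun x : ℝ => x ^ 2)
          · exact measurable_const) (by
        rintro (i | q) x
        · simp only [Sum.elim_inl, abs_of_nonneg (sq_nonneg x), hK]
          nlinarith [mul_nonneg hA0.le (sq_nonneg x), mul_nonneg (sq_nonneg A) (sq_nonneg x), sq_nonneg A]
        · simp only [Sum.elim_inr, abs_zero]; positivity) η hη hη1
    refine le_trans (measure_mono fun H hH => ?_) this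
    simp only [Set.mem_ofPred_eq] at hH ⊢
    simpa [Fintype.sum_sum_type, integral_sq_std, mul_sub, Finset.sum_sub_distrib, hn'.ne']
      using hH
  have hshift : gaussPi (Fin n ⊕ Option (Fin N)) {H | η < |σ * H (.inr none) / Real.sqrt n|}
      ≤ ENNReal.ofReal (E * Real.exp (-c' * N * η ^ 2)) := by
    have h1 := gaussPi_lt_abs_le (Sum.inr none : Fin n ⊕ Option (Fin N))
      (by positivity : 0 ≤ Real.sqrt n * η / σ)
    refine le_trans (measure_mono fun H hH => ?_) (h1.trans (ENNReal.ofReal_le_ofReal ?_))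
    · simp only [Set.mem_ofPred_eq] at hH ⊢
      rw [abs_div, abs_mul, abs_of_pos hσ, abs_of_nonneg (Real.sqrt_nonneg n),
        lt_div_iff₀ (Real.sqrt_pos.2 hn')] at hH
      rw [div_lt_iff₀ hσ]
      linarith
    · refine mul_le_mul_of_nonneg_left (Real.exp_le_exp.2 ?_) hE0
      rw [div_pow, mul_pow, Real.sq_sqrt hn'.le, hn]
      have h2 : c' * (N * η ^ 2) ≤ δ / (4 * σ ^ 2) * (N * η ^ 2) :=
        mul_le_mul_of_nonneg_right (min_le_right _ _) (by positivity)
      have h3 : -(δ * N * η ^ 2 / σ ^ 2) / 4 = -(δ / (4 * σ ^ 2) * (N * η ^ 2)) := by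
        field_simp
      rw [h3]; linarith
  have hquad : ∀ z : ℝ, A * (1 + |z|) ≤ 2 * A * (1 + z ^ 2) := fun z => by
    have : 1 + |z| ≤ 2 * (1 + z ^ 2) := by nlinarith [sq_abs z, sq_nonneg (|z| - 1)]
    nlinarith
  have hrisk := hbase (fun j z => w j z ^ 2) (fun j => (hfp.meas j).pow_const 2) fun j z => by
    rw [abs_of_nonneg (sq_nonneg _), ← sq_abs]
    have h1 : |w j z| ^ 2 ≤ (A * (1 + |z|)) ^ 2 := by gcongr; exact hwb j z
    have h2 : (1 + |z|) ^ 2 ≤ 2 * (1 + z ^ 2) := by nlinarith [sq_abs z, sq_nonneg (|z| - 1)]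
    have h3 := mul_le_mul_of_nonneg_left h2 (sq_nonneg A)
    have h4 : 0 ≤ (1 + 2 * A) * (1 + z ^ 2) := by positivity
    rw [hK]; linarith
  have hcorr := hbase (fun j z => z * w j z) (fun j => measurable_id.mul (hfp.meas j)) fun j z => by
    rw [abs_mul]
    have h1 : |z| * |w j z| ≤ |z| * (A * (1 + |z|)) := by gcongr; exact hwb j z
    have h2 : |z| * (1 + |z|) ≤ 2 * (1 + z ^ 2) := by nlinarith [sq_abs z, sq_nonneg (|z| - 1)]
    have h3 := mul_le_mul_of_nonneg_left h2 hA0.le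
    have h4 : 0 ≤ (1 + 2 * A ^ 2) * (1 + z ^ 2) := by positivity
    rw [hK]; linarith
  have hpen := hbase (fun j z => |w j z + θ j| - |θ j|) (fun j => (hfp.linGrowth_pen hlam j).1)
    fun j z => by
    have h1 : |(|w j z + θ j| - |θ j|)| ≤ |w j z| := by
      have := abs_abs_sub_abs_le (w j z + θ j) (θ j)
      rwa [add_sub_cancel_right] at this
    have h4 : 0 ≤ (1 + 2 * A ^ 2) * (1 + z ^ 2) := by positivity
    have h5 := (h1.trans (hwb j z)).trans (hquad z)
    rw [hK]; linarith
  rw [hfp.gavg_sq] at hrisk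
  rw [hfp.gavg_mul] at hcorr
  have hexp : Real.exp (-c * N * η ^ 2) ≤ Real.exp (-c' * N * η ^ 2) := by
    refine Real.exp_le_exp.2 ?_
    have : c' * (N * η ^ 2) ≤ c * (N * η ^ 2) :=
      mul_le_mul_of_nonneg_right (min_le_left _ _) (by positivity)
    linarith
  have hx : ∀ {μ : ℝ≥0∞}, μ ≤ ENNReal.ofReal (2 * Real.exp (-c * N * η ^ 2)) →
      μ ≤ ENNReal.ofReal (2 * Real.exp (-c' * N * η ^ 2)) := fun h =>
    h.trans (ENNReal.ofReal_le_ofReal (by linarith))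
  have hsub : {H | GoodEvent n σ θ β τ w p η H}ᶜ ⊆
      {H : Fin n ⊕ Option (Fin N) → ℝ | η < |(1 / (n : ℝ)) * ∑ i, H (.inl i) ^ 2 - 1|}
      ∪ ({H | η < |σ * H (.inr none) / Real.sqrt n|}
      ∪ ({H | η < |(1 / (n : ℝ)) * ∑ j, w j (H (.inr (some j))) ^ 2 - (τ ^ 2 - σ ^ 2)|}
      ∪ ({H | η < |(1 / (n : ℝ)) * ∑ j, H (.inr (some j)) * w j (H (.inr (some j))) - (τ - β)|}
      ∪ {H | η < |(1 / (n : ℝ)) * ∑ j, (|w j (H (.inr (some j))) + θ j| - |θ j|) - p|}))) := by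
    intro H hH
    by_contra hcon
    simp only [Set.mem_union, Set.mem_ofPred_eq, not_or, not_lt] at hcon
    exact hH ⟨hcon.1, hcon.2.1, hcon.2.2.1, hcon.2.2.2.1, hcon.2.2.2.2⟩
  refine (measure_mono hsub).trans ?_
  refine (measure_union_le _ _).trans ((add_le_add (hx hnoise) ((measure_union_le _ _).trans
    (add_le_add hshift ((measure_union_le _ _).trans (add_le_add (hx hrisk)
    ((measure_union_le _ _).trans (add_le_add (hx hcorr) (hx hpen)))))))).trans_eq ?_)
  have e0 := (Real.exp_pos (-c' * N * η ^ 2)).le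
  rw [← ENNReal.ofReal_add (by positivity) (by positivity),
    ← ENNReal.ofReal_add (by positivity) (by positivity),
    ← ENNReal.ofReal_add (by positivity) (by positivity),
    ← ENNReal.ofReal_add (by positivity) (by positivity)]
  congr 1; ring

set_option maxHeartbeats 1000000 in
/-- With overwhelming probability, error vectors of atypical risk have large Lasso cost and the
minimal Lasso cost is not larger than its asymptotic value. -/
lemma exists_errCost_prob {δ σ Λ b T : ℝ} (hδ : 0 < δ) (hσ : 0 < σ) (hΛ : 0 < Λ) (hb : 0 < b)
    (hT : 0 < T) : ∃ C c κ : ℝ, 0 < C ∧ 0 < c ∧ 0 < κ ∧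
    ∀ (N n : ℕ) (θ : Fin N → ℝ) (lam β τ : ℝ) (w : Fin N → ℝ → ℝ), 0 < N → (n : ℝ) = δ * N →
      0 < lam → lam ≤ Λ → FixedPoint n σ θ lam β τ w → b ≤ β → τ ≤ T → ∃ L : ℝ,
      ∀ t : ℝ, 0 < t → t ≤ 1 →
      gaussPi (Fin n × Option (Fin N)) {G | ∃ v, t < |δ * msq n v - δ * (τ ^ 2 - σ ^ 2)| ∧
          errCost σ θ lam G v < L + 2 * (κ * t ^ 2) * (1 + Real.sqrt (msq n v))}
        ≤ ENNReal.ofReal (C * Real.exp (-c * N * t ^ 4)) ∧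
      gaussPi (Fin n × Option (Fin N)) {G | ∃ v,
          (∀ v', errCost σ θ lam G v ≤ errCost σ θ lam G v') ∧
          L + κ * t ^ 2 < errCost σ θ lam G v}
        ≤ ENNReal.ofReal (C * Real.exp (-c * N * t ^ 4)) := by
  obtain ⟨C, c, hC, hc, hgood⟩ := exists_goodEvent_prob hδ hσ hΛ hb hT
  set K1 := Λ + T * (3 + 1 / σ + 1 / (2 * σ ^ 2)) with hK1
  set K2 := (5 + 2 * T ^ 2) * (5 + 8 * δ ^ 2 * (5 + 3 * T ^ 2)) with hK2
  set K3 := ((T ^ 2 + 2) / σ + 2) * (2 * T + ((T ^ 2 + 2) / σ + 2)) / 2 + Λ with hK3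
  set A := b * σ ^ 2 / (4 * (T ^ 2 + 1) * (2 + σ ^ 2) * K2) with hA
  have hK10 : 0 < K1 := by positivity
  have hK20 : 0 < K2 := by positivity
  have hK30 : 0 < K3 := by positivity
  have hA0 : 0 < A := by positivity
  set r := min (min (1 / 2) (1 / (2 * δ))) (min (A / (4 * K1)) (A / (8 * K3))) with hr
  have hr0 : 0 < r := by positivity
  have hr1 : r ≤ 1 / 2 := (min_le_left _ _).trans (min_le_left _ _)
  have hr2 : r ≤ 1 / (2 * δ) := (min_le_left _ _).trans (min_le_right _ _)
  have hr3 : r ≤ A / (4 * K1) := (min_le_right _ _).trans (min_le_left _ _)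
  have hr4 : r ≤ A / (8 * K3) := (min_le_right _ _).trans (min_le_right _ _)
  rw [le_div_iff₀ (by positivity)] at hr3 hr4
  refine ⟨2 * C, c * r ^ 2, A / 4, by positivity, by positivity, by positivity,
    fun N n θ lam β τ w hN hn hlam hlamΛ hfp hbβ hτT => ?_⟩
  have hN' : (0 : ℝ) < N := by exact_mod_cast hN
  have hn' : (0 : ℝ) < n := by rw [hn]; positivity
  have hn0 : 0 < n := by exact_mod_cast hn'
  set p := gavg n fun i z => |w i z + θ i| - |θ i| with hp
  refine ⟨β ^ 2 / 2 + lam * p, fun t ht ht1 => ?_⟩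
  have ht2 : t ^ 2 ≤ t := by nlinarith
  have ht20 : 0 < t ^ 2 := by positivity
  set η := r * t ^ 2 with hη
  have hη0 : 0 < η := by positivity
  have hη1 : η ≤ 1 / 2 := by
    have h1 := mul_le_mul_of_nonneg_left (ht2.trans ht1) hr0.le
    linarith only [h1, hr1, hη]
  have hηt : η ≤ t / (2 * δ) := by
    calc η ≤ 1 / (2 * δ) * t := by rw [hη]; gcongr
      _ = t / (2 * δ) := by ring
  have hsmall : 2 * (A / 4 * t ^ 2) + K1 * η
      < b * (σ ^ 2 * t ^ 2 / (4 * (T ^ 2 + 1) * (2 + σ ^ 2) * K2)) := by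
    have e : b * (σ ^ 2 * t ^ 2 / (4 * (T ^ 2 + 1) * (2 + σ ^ 2) * K2)) = A * t ^ 2 := by
      rw [hA]; ring
    rw [e, hη]
    have h1 := mul_le_mul_of_nonneg_right hr3 ht20.le
    have h2 := mul_pos hA0 ht20
    linarith only [h1, h2]
  have hsmall' : K3 * η < A / 4 * t ^ 2 := by
    rw [hη]
    have h1 := mul_le_mul_of_nonneg_right hr4 ht20.le
    have h2 := mul_pos hA0 ht20
    linarith only [h1, h2]
  set E := {H : Fin n ⊕ Option (Fin N) → ℝ | GoodEvent n σ θ β τ w p η H} with hE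
  have hprob : 2 * gaussPi (Fin n ⊕ Option (Fin N)) Eᶜ
      ≤ ENNReal.ofReal (2 * C * Real.exp (-(c * r ^ 2) * N * t ^ 4)) := by
    have h1 := hgood N n θ lam β τ w hN hn hlam hlamΛ hfp hbβ hτT η hη0 (by linarith)
    refine (mul_le_mul_right h1 2).trans_eq ?_
    rw [← ENNReal.ofReal_ofNat 2, ← ENNReal.ofReal_mul (by norm_num), hη]
    have e : -c * N * (r * t ^ 2) ^ 2 = -(c * r ^ 2) * N * t ^ 4 := by ring
    rw [e, mul_assoc 2 C]
  constructor
  · refine le_trans (le_of_eq ?_) ((gaussPi_exists_errCost_lt_le hn0 σ θ lam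
      (S := {v | t < |δ * msq n v - δ * (τ ^ 2 - σ ^ 2)|})
      (Φ := fun v => β ^ 2 / 2 + lam * p + 2 * (A / 4 * t ^ 2) * (1 + Real.sqrt (msq n v)))
      ?_ ?_ E ?_ ?_).trans hprob)
    · rfl
    · have := continuous_msq (N := N) n
      exact isOpen_lt continuous_const (by fun_prop)
    · have := continuous_msq (N := N) n
      fun_prop
    · intro H hH
      have h1 := GoodEvent.one_sub_le_norm hH (by linarith)
      have h2 : 0 < euc (fun i => H (.inl i)) / Real.sqrt n := by linarith
      exact (div_pos_iff_of_pos_right (Real.sqrt_pos.2 hn')).1 h2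
    · intro H hH v hv
      exact GoodEvent.primal hH hfp hδ hσ hlam hlamΛ hτT hb hbβ (by linarith) ht ht1 hηt
        (by positivity) hsmall v hv
  · refine (gaussPi_exists_lt_errCost_le hn0 σ θ hlam.le _ (Real.sqrt (n * (T ^ 2 + 1)) + 1) E
      fun H hH => ?_).trans hprob
    refine ⟨fun j => w j (H (.inr (some j))), ?_, fun a => ?_⟩
    · have h1 := (abs_le.1 (GoodEvent.risk hH)).2
      set ws : Fin N → ℝ := fun j => w j (H (.inr (some j)))
      have h2 : msq n ws ≤ T ^ 2 + 1 := by
        have : τ ^ 2 ≤ T ^ 2 := by have := hfp.τ_pos; gcongr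
        linarith [sq_nonneg σ]
      rw [mem_ball_zero_iff, pi_norm_lt_iff (by positivity)]
      intro j
      have h3 : ws j ^ 2 ≤ n * (T ^ 2 + 1) := by
        rw [msq, one_div, inv_mul_le_iff₀ hn'] at h2
        exact (Finset.single_le_sum (f := fun j => ws j ^ 2) (fun _ _ => sq_nonneg _)
          (Finset.mem_univ j)).trans h2
      have h4 := Real.abs_le_sqrt h3
      rw [Real.norm_eq_abs]; linarith
    · refine (GoodEvent.dual hH hfp hσ hlam hlamΛ hτT (by linarith) a).trans_lt ?_
      rw [hK3] at hsmall'
      linarith only [hsmall']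

/-- The Gaussian matrix built from the normalized design and the noise. -/
def designMatrix {n N : ℕ} (ω : (Fin n → Fin N → ℝ) × (Fin n → ℝ)) (k : Fin n × Option (Fin N)) : ℝ :=
  k.2.elim (ω.2 k.1) fun j => Real.sqrt n * ω.1 k.1 j

lemma measurePreserving_designMatrix {n N : ℕ} (hn : 0 < n) :
    MeasurePreserving (designMatrix (n := n) (N := N)) (Pmodel n N)
      (gaussPi (Fin n × Option (Fin N))) := by
  have hm : Measurable (designMatrix (n := n) (N := N)) := by
    refine measurable_pi_lambda _ fun k => ?_
    obtain ⟨i, _ | j⟩ := k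
    · exact (measurable_pi_apply i).comp measurable_snd
    · have h1 : Measurable fun ω : (Fin n → Fin N → ℝ) × (Fin n → ℝ) => ω.1 i :=
        (measurable_pi_apply i).comp measurable_fst
      exact ((measurable_pi_apply j).comp h1).const_mul _
  have hn' : (0 : ℝ) < n := by exact_mod_cast hn
  have hmap : (gaussianReal 0 (n : ℝ≥0)⁻¹).map (Real.sqrt n * ·) = gaussianReal 0 1 := by
    rw [gaussianReal_map_const_mul, mul_zero]
    congr 1
    ext
    simp only [NNReal.coe_mul, NNReal.coe_mk, NNReal.coe_inv, NNReal.coe_natCast, NNReal.coe_one]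
    rw [Real.sq_sqrt hn'.le, mul_inv_cancel₀ hn'.ne']
  refine ⟨hm, (Measure.pi_eq fun s hs => ?_).symm⟩
  rw [Measure.map_apply hm (MeasurableSet.univ_pi hs)]
  have hpre : designMatrix (n := n) (N := N) ⁻¹' (Set.univ.pi s)
      = (Set.univ.pi fun i => Set.univ.pi fun j => (Real.sqrt n * ·) ⁻¹' s (i, some j))
        ×ˢ (Set.univ.pi fun i => s (i, none)) := by
    ext ω
    simp only [Set.mem_preimage, Set.mem_univ_pi, Set.mem_prod, Prod.forall, Option.forall,
      designMatrix, Option.elim, forall_and]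
    exact and_comm
  rw [hpre, Pmodel, PX, Pz, Measure.prod_prod, Measure.pi_pi, Measure.pi_pi,
    Fintype.prod_prod_type]
  simp only [Fintype.prod_option, Finset.prod_mul_distrib, Measure.pi_pi]
  rw [mul_comm]
  congr 1
  refine Finset.prod_congr rfl fun i _ => Finset.prod_congr rfl fun j _ => ?_
  rw [← hmap, Measure.map_apply (by fun_prop) (hs _)]

lemma errCost_designMatrix {n N : ℕ} (hn : 0 < n) (σ : ℝ) (θ : Fin N → ℝ) (lam : ℝ)
    (ω : (Fin n → Fin N → ℝ) × (Fin n → ℝ)) (v : Fin N → ℝ) :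
    errCost σ θ lam (designMatrix ω) v = lassoCost ω.1 (yvec σ θ ω.1 ω.2) lam (fun j => v j + θ j)
      - lam / n * ∑ j, |θ j| := by
  have hn' : (0 : ℝ) < n := by exact_mod_cast hn
  have hs : Real.sqrt n ≠ 0 := (Real.sqrt_pos.2 hn').ne'
  have h1 : ∀ i, resid σ (designMatrix ω) v i
      = yvec σ θ ω.1 ω.2 i - ∑ j, ω.1 i j * (v j + θ j) := fun i => by
    simp only [resid, designMatrix, Option.elim, yvec, mul_assoc, ← Finset.mul_sum, mul_add,
      Finset.sum_add_distrib]
    rw [mul_div_cancel_left₀ _ hs]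
    ring
  simp only [errCost, lassoCost, h1, penGap, Finset.sum_sub_distrib]
  ring

lemma errCost_le_of_isMinOn {n N : ℕ} (hn : 0 < n) {σ : ℝ} {θ : Fin N → ℝ} {lam : ℝ}
    {ω : (Fin n → Fin N → ℝ) × (Fin n → ℝ)} {θ' : Fin N → ℝ}
    (h : IsMinOn (lassoCost ω.1 (yvec σ θ ω.1 ω.2) lam) Set.univ θ') (v : Fin N → ℝ) :
    errCost σ θ lam (designMatrix ω) (fun j => θ' j - θ j) ≤ errCost σ θ lam (designMatrix ω) v := by
  rw [errCost_designMatrix hn, errCost_designMatrix hn]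
  simp only [sub_add_cancel]
  exact sub_le_sub_right (h (Set.mem_univ _)) _

lemma abs_penGap_le {N n : ℕ} {δ : ℝ} (hδ : 0 < δ) (hN : 0 < N) (hn : (n : ℝ) = δ * N)
    (θ v : Fin N → ℝ) : |penGap n θ v| ≤ Real.sqrt (msq n v) / Real.sqrt δ := by
  have hN' : (0 : ℝ) < N := by exact_mod_cast hN
  have hn' : (0 : ℝ) < n := by rw [hn]; positivity
  have h1 : |penGap n θ v| ≤ (1 / (n : ℝ)) * ∑ j, |v j| := by
    rw [penGap, abs_mul, abs_of_pos (by positivity : 0 < 1 / (n : ℝ))]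
    refine mul_le_mul_of_nonneg_left ((Finset.abs_sum_le_sum_abs _ _).trans
      (Finset.sum_le_sum fun j _ => ?_)) (by positivity)
    have := abs_abs_sub_abs_le (v j + θ j) (θ j)
    rwa [add_sub_cancel_right] at this
  refine h1.trans ?_
  rw [← Real.sqrt_div (msq_nonneg _ _)]
  refine Real.le_sqrt_of_sq_le ?_
  have h2 : (∑ j, |v j|) ^ 2 ≤ N * ∑ j, v j ^ 2 := by
    have := sq_sum_le_card_mul_sum_sq (s := Finset.univ) (f := fun j => |v j|)
    simpa using this
  calc ((1 / (n : ℝ)) * ∑ j, |v j|) ^ 2 = (1 / (n : ℝ)) ^ 2 * (∑ j, |v j|) ^ 2 := by ring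
    _ ≤ (1 / (n : ℝ)) ^ 2 * (N * ∑ j, v j ^ 2) := by gcongr
    _ = msq n v / δ := by rw [msq, hn]; field_simp

lemma errCost_sub {N n : ℕ} (σ : ℝ) (θ : Fin N → ℝ) (lam lam' : ℝ)
    (G : Fin n × Option (Fin N) → ℝ) (v : Fin N → ℝ) :
    errCost σ θ lam' G v = errCost σ θ lam G v + (lam' - lam) * penGap n θ v := by
  rw [errCost, errCost]; ring

/-- Control of the risk of the minimizer at a regularization level close to one at which the cost
is well behaved. -/
lemma abs_msq_sub_le_of_near {N n : ℕ} {δ : ℝ} (hδ : 0 < δ) (hN : 0 < N) (hn : (n : ℝ) = δ * N)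
    {σ : ℝ} {θ : Fin N → ℝ} {lam lam' Δ t γ M L m : ℝ} {G : Fin n × Option (Fin N) → ℝ}
    {v v' : Fin N → ℝ} (hv : ∀ w, errCost σ θ lam G v ≤ errCost σ θ lam G w)
    (hv' : ∀ w, errCost σ θ lam' G v' ≤ errCost σ θ lam' G w) (hlam : |lam - lam'| ≤ Δ)
    (hlow : ¬ ∃ w, t < |δ * msq n w - δ * m| ∧
      errCost σ θ lam' G w < L + 2 * γ * (1 + Real.sqrt (msq n w)))
    (hup : ¬ ∃ w, (∀ w', errCost σ θ lam' G w ≤ errCost σ θ lam' G w') ∧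
      L + γ < errCost σ θ lam' G w)
    (hγ : 0 < γ) (hM1 : 1 ≤ M) (hM : δ * m + t ≤ δ * M ^ 2)
    (hΔ : Δ * (M / Real.sqrt δ) ≤ γ / 2) :
    |δ * msq n v - δ * m| ≤ t := by
  push Not at hlow hup
  have hΔ0 : 0 ≤ Δ := (abs_nonneg _).trans hlam
  have hcv' := hup v' hv'
  have hmv' : msq n v' ≤ M ^ 2 := by
    by_contra hcon
    push Not at hcon
    have h1 : δ * M ^ 2 < δ * msq n v' := by gcongr
    have h2 := hlow v' (lt_of_lt_of_le (by linarith) (le_abs_self _))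
    have h3 := mul_nonneg hγ.le (Real.sqrt_nonneg (msq n v'))
    linarith
  have hsv' : Real.sqrt (msq n v') ≤ M := Real.sqrt_le_iff.2 ⟨by linarith, hmv'⟩
  have hsd : 0 < Real.sqrt δ := Real.sqrt_pos.2 hδ
  by_contra hcon
  push Not at hcon
  have h1 := hlow v hcon
  have e1 := errCost_sub σ θ lam lam' G v
  have e2 := errCost_sub σ θ lam lam' G v'
  have h2 := hv v'
  set s := Real.sqrt (msq n v) with hs
  have hs0 : 0 ≤ s := Real.sqrt_nonneg _
  have h3 : (lam' - lam) * penGap n θ v - (lam' - lam) * penGap n θ v'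
      ≤ Δ * (s / Real.sqrt δ) + Δ * (M / Real.sqrt δ) := by
    have q1 : (lam' - lam) * penGap n θ v ≤ Δ * (s / Real.sqrt δ) := by
      refine (le_abs_self _).trans ?_
      rw [abs_mul, abs_sub_comm]
      gcongr
      exact abs_penGap_le hδ hN hn θ v
    have q2 : -((lam' - lam) * penGap n θ v') ≤ Δ * (M / Real.sqrt δ) := by
      refine (neg_le_abs _).trans ?_
      rw [abs_mul, abs_sub_comm]
      gcongr
      exact (abs_penGap_le hδ hN hn θ v').trans (by gcongr)
    linarith
  have h4 : Δ * (s / Real.sqrt δ) ≤ Δ * (M / Real.sqrt δ) * s := by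
    have : s / Real.sqrt δ ≤ M / Real.sqrt δ * s := by
      rw [div_mul_eq_mul_div]
      gcongr
      nlinarith
    calc _ ≤ Δ * (M / Real.sqrt δ * s) := by gcongr
      _ = _ := by ring
  have h5 : Δ * (M / Real.sqrt δ) * s ≤ γ / 2 * s := by gcongr
  have h6 := mul_nonneg hγ.le hs0
  linarith only [h1, e1, e2, h2, hcv', h3, h4, h5, h6, hΔ, hγ]

set_option maxHeartbeats 1000000 in
/-- Theorem 2, Eq. (risk): uniform control of the Lasso risk over λ and θ⋆. -/
theorem stmt1 (δ σ lmin lmax q : ℝ)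
    (hδ : 0 < δ) (hσ : 0 < σ) (hl : 0 < lmin) (hll : lmin ≤ lmax)
    (Dfam : (M : ℕ) → Set (Fin M → ℝ))
    (hD : DFamSpec δ Dfam q) :
    ∃ C c : ℝ, 0 < C ∧ 0 < c ∧
      ∀ (N n : ℕ), 0 < N → (n : ℝ) = δ * N →
      ∀ θstar ∈ Dfam N,
      ∀ βstar τstar : ℝ → ℝ,
      (∀ lam ∈ Set.Icc lmin lmax,
        StateEvo δ σ (empDist θstar) lam (βstar lam) (τstar lam)) →
      ∀ θhat : ℝ → (Fin n → Fin N → ℝ) → (Fin n → ℝ) → (Fin N → ℝ),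
      (∀ lam ∈ Set.Icc lmin lmax, ∀ (X : Fin n → Fin N → ℝ) (z : Fin n → ℝ),
        IsMinOn (lassoCost X (yvec σ θstar X z) lam) Set.univ (θhat lam X z)) →
      ∀ ε : ℝ, ε ∈ Set.Ioc (0 : ℝ) 1 →
      Pmodel n N
        {ω | ∃ lam ∈ Set.Icc lmin lmax,
          ε ≤ ((1 / (N : ℝ)) * ∑ j, (θhat lam ω.1 ω.2 j - θstar j) ^ 2
              - δ * ((τstar lam) ^ 2 - σ ^ 2)) ^ 2}
      ≤ ENNReal.ofReal (C / ε ^ 2 * (N : ℝ) ^ q * Real.exp (-c * N * ε ^ 2)) := by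
  obtain ⟨t₀, s, α, ht₀, hs0, hsδ, hα, hMα, hsparse⟩ := hD.exists_effectivelySparse hδ
  obtain ⟨T₀, hT₀⟩ := FixedPoint.exists_tau_le hδ hσ hl hll ht₀ hα hMα
  obtain ⟨b, hb, hbβ⟩ := FixedPoint.exists_le_beta hδ hσ hl ht₀ hs0 hsδ
  set T := max T₀ 1 with hT
  have hT1 : 1 ≤ T := le_max_right _ _
  have hT0 : 0 < T := by linarith
  have hlm : 0 < lmax := hl.trans_le hll
  obtain ⟨C, c, κ, hC, hc, hκ, hprob⟩ := exists_errCost_prob hδ hσ hlm hb hT0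
  set M := T + 1 + 1 / δ with hM
  have hδi : 0 < 1 / δ := by positivity
  have hM1 : 1 ≤ M := by linarith
  have hM2 : T ^ 2 + 1 / δ ≤ M ^ 2 := by rw [hM]; nlinarith
  set Lp := 2 * T ^ 4 / (σ ^ 2 * b * Real.sqrt δ) with hLp
  have hsd : 0 < Real.sqrt δ := Real.sqrt_pos.2 hδ
  have hLp0 : 0 < Lp := by positivity
  set d := min (κ * Real.sqrt δ / (8 * M)) (1 / (4 * δ * Lp)) with hd
  have hd0 : 0 < d := by positivity
  have hd1 : d * (M / Real.sqrt δ) ≤ κ / 8 := by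
    have h1 : d ≤ κ * Real.sqrt δ / (8 * M) := min_le_left _ _
    calc d * (M / Real.sqrt δ) ≤ κ * Real.sqrt δ / (8 * M) * (M / Real.sqrt δ) := by gcongr
      _ = κ / 8 := by field_simp
  have hd2 : δ * (Lp * d) ≤ 1 / 4 := by
    have h1 : d ≤ 1 / (4 * δ * Lp) := min_le_right _ _
    calc δ * (Lp * d) ≤ δ * (Lp * (1 / (4 * δ * Lp))) := by gcongr
      _ = 1 / 4 := by field_simp
  have hw0 : 0 ≤ lmax - lmin := by linarith
  refine ⟨2 * C * ((lmax - lmin) / d + 1), c / 16, by positivity, by positivity, ?_⟩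
  intro N n hN hn θstar hθ βstar τstar hSE θhat hmin ε hε
  obtain ⟨hε0, hε1⟩ := hε
  have hN' : (0 : ℝ) < N := by exact_mod_cast hN
  have hn' : (0 : ℝ) < n := by rw [hn]; positivity
  have hn0 : 0 < n := by exact_mod_cast hn'
  have hq : 0 ≤ q := by
    rcases hD with ⟨p, ξ, -, -, -, h⟩ | ⟨s, -, -, -, h⟩
    · rw [h]; exact le_max_right _ _
    · exact h.ge
  have hpos : ∀ lam ∈ Set.Icc lmin lmax, 0 < lam := fun lam h => hl.trans_le h.1
  have hfp := fun lam (h : lam ∈ Set.Icc lmin lmax) =>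
    (hSE lam h).fixedPoint hδ hn (hpos lam h)
  have hτT : ∀ lam ∈ Set.Icc lmin lmax, τstar lam ≤ T := fun lam h =>
    (hT₀ N n _ _ _ _ _ hN hn (hsparse N hN _ hθ) h.1 h.2 (hfp lam h)).trans (le_max_left _ _)
  have hbb : ∀ lam ∈ Set.Icc lmin lmax, b ≤ βstar lam := fun lam h =>
    hbβ N n _ _ _ _ _ hN hn (hsparse N hN _ hθ) h.1 (hfp lam h)
  have hex := fun lam (h : lam ∈ Set.Icc lmin lmax) =>
    hprob N n _ _ _ _ _ hN hn (hpos lam h) h.2 (hfp lam h) (hbb lam h) (hτT lam h)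
  choose L hL using hex
  set t := Real.sqrt ε / 2 with ht
  have hse0 : 0 < Real.sqrt ε := Real.sqrt_pos.2 hε0
  have hse1 : Real.sqrt ε ≤ 1 := by rw [Real.sqrt_le_one]; exact hε1
  have hsq : Real.sqrt ε ^ 2 = ε := Real.sq_sqrt hε0.le
  have ht0 : 0 < t := by positivity
  have ht1 : t ≤ 1 := by linarith
  have ht2 : t ^ 2 = ε / 4 := by rw [ht, div_pow, hsq]; norm_num
  have ht4 : t ^ 4 = ε ^ 2 / 16 := by
    have : t ^ 4 = (t ^ 2) ^ 2 := by ring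
    rw [this, ht2]; ring
  set Δ := d * ε with hΔ
  have hΔ0 : 0 < Δ := by positivity
  set K := ⌊(lmax - lmin) / Δ⌋₊ with hK
  set node : ℕ → ℝ := fun k => lmin + k * Δ with hnode
  have hmem : ∀ k ∈ Finset.range (K + 1), node k ∈ Set.Icc lmin lmax := by
    intro k hk
    have h1 : (k : ℝ) ≤ K := by exact_mod_cast Nat.lt_succ_iff.1 (Finset.mem_range.1 hk)
    have h2 : (K : ℝ) ≤ (lmax - lmin) / Δ := Nat.floor_le (by positivity)
    have h3 : (k : ℝ) * Δ ≤ lmax - lmin := by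
      rw [← le_div_iff₀ hΔ0]; exact h1.trans h2
    have h4 : 0 ≤ (k : ℝ) * Δ := by positivity
    exact ⟨by simp only [hnode]; linarith, by simp only [hnode]; linarith⟩
  set low : ∀ lam ∈ Set.Icc lmin lmax, Set (Fin n × Option (Fin N) → ℝ) := fun lam h =>
    {G | ∃ v, t < |δ * msq n v - δ * ((τstar lam) ^ 2 - σ ^ 2)| ∧
      errCost σ θstar lam G v < L lam h + 2 * (κ * t ^ 2) * (1 + Real.sqrt (msq n v))} with hlow
  set up : ∀ lam ∈ Set.Icc lmin lmax, Set (Fin n × Option (Fin N) → ℝ) := fun lam h =>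
    {G | ∃ v, (∀ v', errCost σ θstar lam G v ≤ errCost σ θstar lam G v') ∧
      L lam h + κ * t ^ 2 < errCost σ θstar lam G v} with hup
  set x := C * Real.exp (-c * N * t ^ 4) with hx
  have hx0 : 0 ≤ x := by positivity
  have hsub : {ω : (Fin n → Fin N → ℝ) × (Fin n → ℝ) | ∃ lam ∈ Set.Icc lmin lmax,
      ε ≤ ((1 / (N : ℝ)) * ∑ j, (θhat lam ω.1 ω.2 j - θstar j) ^ 2
        - δ * ((τstar lam) ^ 2 - σ ^ 2)) ^ 2}
      ⊆ ⋃ k ∈ (Finset.range (K + 1)).attach, designMatrix ⁻¹'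
        (low (node k) (hmem k k.2) ∪ up (node k) (hmem k k.2)) := by
    rintro ω ⟨lam, hlam, hω⟩
    by_contra hcon
    set k := ⌊(lam - lmin) / Δ⌋₊ with hk
    have hlam0 : 0 ≤ (lam - lmin) / Δ := div_nonneg (by linarith [hlam.1]) hΔ0.le
    have hkK : k ∈ Finset.range (K + 1) := by
      rw [Finset.mem_range, Nat.lt_succ_iff]
      exact Nat.floor_le_floor (by gcongr; exact hlam.2)
    have hk1 : (k : ℝ) * Δ ≤ lam - lmin := by
      rw [← le_div_iff₀ hΔ0]; exact Nat.floor_le hlam0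
    have hk2 : lam - lmin ≤ (k + 1) * Δ := by
      rw [← div_le_iff₀ hΔ0]; exact (Nat.lt_floor_add_one _).le
    have hnear : |lam - node k| ≤ Δ := by
      rw [abs_le]; simp only [hnode]
      constructor <;> linarith
    have hnk := hmem k hkK
    simp only [Set.mem_iUnion, not_exists] at hcon
    have hcon' := hcon ⟨k, hkK⟩ (Finset.mem_attach _ _)
    rw [Set.mem_preimage, Set.mem_union, not_or] at hcon'
    have hclose := abs_msq_sub_le_of_near hδ hN hn
      (errCost_le_of_isMinOn hn0 (ω := ω) (hmin lam hlam ω.1 ω.2))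
      (errCost_le_of_isMinOn hn0 (ω := ω) (hmin (node k) hnk ω.1 ω.2)) hnear hcon'.1 hcon'.2
      (by positivity) hM1 (by
        have h1 : (τstar (node k)) ^ 2 ≤ T ^ 2 := by
          have := (hfp _ hnk).τ_pos
          have := hτT _ hnk
          gcongr
        have h2 : δ * (T ^ 2 + 1 / δ) ≤ δ * M ^ 2 := by gcongr
        have h3 : δ * (T ^ 2 + 1 / δ) = δ * T ^ 2 + 1 := by field_simp
        have h4 : δ * (τstar (node k)) ^ 2 ≤ δ * T ^ 2 := by gcongr
        have h5 : 0 ≤ δ * σ ^ 2 := by positivity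
        linarith only [h2, h3, h4, h5, ht1]) (by
        rw [ht2, hΔ]
        have := mul_le_mul_of_nonneg_right hd1 hε0.le
        linarith only [this])
    have hlip := FixedPoint.sq_sub_sq_tau_le (hfp _ hnk) (hpos _ hnk) (hfp _ hlam) (hpos _ hlam)
      hδ hσ hb hN hn (hbb _ hnk) (hbb _ hlam) (hτT _ hnk) (hτT _ hlam)
    rw [abs_sub_comm (node k)] at hlip
    have hlip' : δ * |τstar (node k) ^ 2 - τstar lam ^ 2| ≤ Real.sqrt ε / 4 := by
      have h1 : δ * (Lp * Δ) ≤ 1 / 4 * ε := by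
        have := mul_le_mul_of_nonneg_right hd2 hε0.le
        rw [hΔ]; linarith only [this]
      have h2 : ε ≤ Real.sqrt ε := by nlinarith only [hsq, hse0, hse1]
      have h3 : δ * |τstar (node k) ^ 2 - τstar lam ^ 2| ≤ δ * (Lp * Δ) := by
        refine mul_le_mul_of_nonneg_left (hlip.trans ?_) hδ.le
        gcongr
      linarith only [h1, h2, h3]
    have hrisk : (1 / (N : ℝ)) * ∑ j, (θhat lam ω.1 ω.2 j - θstar j) ^ 2
        = δ * msq n (fun j => θhat lam ω.1 ω.2 j - θstar j) := by
      rw [msq, hn]; field_simp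
    rw [hrisk] at hω
    set m := msq n (fun j => θhat lam ω.1 ω.2 j - θstar j)
    have hdist : |δ * m - δ * (τstar lam ^ 2 - σ ^ 2)| ≤ 3 / 4 * Real.sqrt ε := by
      have e : δ * m - δ * (τstar lam ^ 2 - σ ^ 2) = (δ * m - δ * (τstar (node k) ^ 2 - σ ^ 2))
          + δ * (τstar (node k) ^ 2 - τstar lam ^ 2) := by ring
      rw [e]
      refine (abs_add_le _ _).trans ?_
      rw [abs_mul δ, abs_of_pos hδ]
      linarith only [hclose, hlip', ht]
    have h1 : (δ * m - δ * (τstar lam ^ 2 - σ ^ 2)) ^ 2 ≤ (3 / 4 * Real.sqrt ε) ^ 2 := by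
      rw [← sq_abs]; gcongr
    rw [mul_pow, hsq] at h1
    linarith only [h1, hω, hε0]
  have hmp := measurePreserving_designMatrix (n := n) (N := N) hn0
  have hnodebd : ∀ lam (h : lam ∈ Set.Icc lmin lmax),
      Pmodel n N (designMatrix ⁻¹' (low lam h ∪ up lam h)) ≤ ENNReal.ofReal (2 * x) := by
    intro lam h
    refine (Measure.le_map_apply hmp.measurable.aemeasurable _).trans ?_
    rw [hmp.map_eq]
    refine (measure_union_le _ _).trans ?_
    have h1 := hL lam h t ht0 ht1
    refine (add_le_add h1.1 h1.2).trans_eq ?_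
    rw [← ENNReal.ofReal_add hx0 hx0, two_mul]
  refine (measure_mono hsub).trans ((measure_biUnion_finset_le _ _).trans
    ((Finset.sum_le_sum fun (k : {k // k ∈ Finset.range (K + 1)}) _ =>
      hnodebd (node k) (hmem k k.2)).trans ?_))
  rw [Finset.sum_const, Finset.card_attach, Finset.card_range, nsmul_eq_mul,
    ← ENNReal.ofReal_natCast, ← ENNReal.ofReal_mul (by positivity)]
  refine ENNReal.ofReal_le_ofReal ?_
  have hcount : ((K + 1 : ℕ) : ℝ) ≤ ((lmax - lmin) / d + 1) / ε ^ 2 := by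
    have h2 : (K : ℝ) ≤ (lmax - lmin) / Δ := Nat.floor_le (by positivity)
    have h3 : (lmax - lmin) / Δ = (lmax - lmin) / d / ε := by rw [hΔ, div_div]
    have h4 : ε ^ 2 ≤ ε := by nlinarith
    have h5 : (lmax - lmin) / d / ε ≤ (lmax - lmin) / d / ε ^ 2 := by gcongr
    have h6 : 1 ≤ 1 / ε ^ 2 := by rw [le_div_iff₀ (by positivity)]; linarith
    push_cast
    rw [add_div]
    linarith
  have hNq : 1 ≤ (N : ℝ) ^ q := Real.one_le_rpow (by exact_mod_cast hN) hq
  have hexp : Real.exp (-c * N * t ^ 4) = Real.exp (-(c / 16) * N * ε ^ 2) := by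
    rw [ht4]; congr 1; ring
  calc ((K + 1 : ℕ) : ℝ) * (2 * x) ≤ ((lmax - lmin) / d + 1) / ε ^ 2 * (2 * x) := by gcongr
    _ = 2 * C * ((lmax - lmin) / d + 1) / ε ^ 2 * 1 * Real.exp (-(c / 16) * N * ε ^ 2) := by
      rw [hx, hexp]; ring
    _ ≤ _ := by gcongr
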